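/- Let n ≥ 2, i ∈ {1,…,n−1}, and let (K_m)_{m=1}^∞ and K be convex bodies in ℝⁿ with centroid at the origin. Then d_LP(S_i(K_m,·), S_i(K,·)) → 0 as m → ∞ if and only if d_H(K_m, K) → 0 as m → ∞. -/

import Mathlib

open scoped InnerProductSpace Pointwise
open MeasureTheory Metric Filter Topology

noncomputable section

/-- Euclidean space `ℝⁿ`. -/
abbrev En (n : ℕ) := EuclideanSpace ℝ (Fin n)

namespace MinkIter

variable {n : ℕ}

/-- The unit sphere `𝕊^{n-1}` as a subtype. -/
abbrev Sph (n : ℕ) := Metric.sphere (0 : En n) 1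

/-- Spherical Lebesgue measure on `𝕊^{n-1}`. -/
def sphVol (n : ℕ) : Measure (Sph n) := (volume : Measure (En n)).toSphere

/-- A fixed pole `ē ∈ 𝕊^{n-1}`. -/
def pole (n : ℕ) : En n :=
  if h : 0 < n then EuclideanSpace.single (⟨0, h⟩ : Fin n) 1 else 0

/-- The support function of a convex body, as a function on all of `ℝⁿ`. -/
def supp (K : ConvexBody (En n)) (x : En n) : ℝ :=
  sSup ((fun y => ⟪x, y⟫_ℝ) '' (K : Set (En n)))

/-- The Euclidean unit ball `𝔹ⁿ` as a convex body. -/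
def ballB (n : ℕ) : ConvexBody (En n) :=
  ⟨closedBall 0 1, convex_closedBall 0 1, isCompact_closedBall 0 1, ⟨0, by simp⟩⟩

/-- The dilate `c • K` of a convex body. -/
def scale (c : ℝ) (K : ConvexBody (En n)) : ConvexBody (En n) :=
  ⟨c • (K : Set (En n)), K.convex.smul c, K.isCompact.smul c, K.nonempty.smul_set⟩

/-- The translate `K + x` of a convex body. -/
def translate (K : ConvexBody (En n)) (x : En n) : ConvexBody (En n) :=
  ⟨(fun y => x + y) '' (K : Set (En n)), K.convex.translate x,
    K.isCompact.image (continuous_add_left x), K.nonempty.image _⟩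

/-- A linear isometry of `ℝⁿ` is a rotation (element of `SO(n)`) if it preserves
orientation. -/
def IsRotation (ρ : En n ≃ₗᵢ[ℝ] En n) : Prop :=
  0 < LinearMap.det (ρ.toLinearEquiv.toLinearMap)

/-- The image `ρ K` of a convex body under a linear isometry. -/
def rotate (ρ : En n ≃ₗᵢ[ℝ] En n) (K : ConvexBody (En n)) : ConvexBody (En n) :=
  ⟨ρ '' (K : Set (En n)), K.convex.linear_image ρ.toLinearEquiv.toLinearMap,
    K.isCompact.image ρ.continuous, K.nonempty.image _⟩

/-- `Φ` is a Minkowski valuation: `ΦK + ΦL = Φ(K ∪ L) + Φ(K ∩ L)` whenever `K ∪ L`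
is convex (Minkowski addition on the left). -/
def IsMinkowskiValuation (Φ : ConvexBody (En n) → ConvexBody (En n)) : Prop :=
  ∀ (K L : ConvexBody (En n)) (hu : Convex ℝ ((K : Set (En n)) ∪ (L : Set (En n))))
    (hi : ((K : Set (En n)) ∩ (L : Set (En n))).Nonempty),
    Φ K + Φ L =
      Φ ⟨(K : Set (En n)) ∪ (L : Set (En n)), hu, K.isCompact.union L.isCompact,
          K.nonempty.inl⟩ +
      Φ ⟨(K : Set (En n)) ∩ (L : Set (En n)), K.convex.inter L.convex,
          K.isCompact.inter_right L.isCompact.isClosed, hi⟩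

/-- `Φ` is translation invariant. -/
def TranslationInvariant (Φ : ConvexBody (En n) → ConvexBody (En n)) : Prop :=
  ∀ (K : ConvexBody (En n)) (x : En n), Φ (translate K x) = Φ K

/-- `Φ` is (positively) homogeneous of degree `i`. -/
def HasDegree (i : ℕ) (Φ : ConvexBody (En n) → ConvexBody (En n)) : Prop :=
  ∀ (K : ConvexBody (En n)) (c : ℝ), 0 ≤ c → Φ (scale c K) = scale (c ^ i) (Φ K)

/-- `Φ` commutes with `SO(n)`. -/
def RotationEquivariant (Φ : ConvexBody (En n) → ConvexBody (En n)) : Prop :=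
  ∀ ρ : En n ≃ₗᵢ[ℝ] En n, IsRotation ρ → ∀ K, Φ (rotate ρ K) = rotate ρ (Φ K)

/-- `Φ` is even: `Φ(-K) = ΦK`. -/
def IsEven (Φ : ConvexBody (En n) → ConvexBody (En n)) : Prop :=
  ∀ K, Φ (scale (-1) K) = Φ K

/-- `Φ` is monotone w.r.t. set inclusion. -/
def MonotoneVal (Φ : ConvexBody (En n) → ConvexBody (En n)) : Prop :=
  ∀ K L : ConvexBody (En n), (K : Set (En n)) ⊆ (L : Set (En n)) →
    (Φ K : Set (En n)) ⊆ (Φ L : Set (En n))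

/-- `Φ` is non-trivial: `ΦK ≠ {o}` for some `K`. -/
def NontrivialVal (Φ : ConvexBody (En n) → ConvexBody (En n)) : Prop :=
  ∃ K : ConvexBody (En n), (Φ K : Set (En n)) ≠ {0}

/-- The mixed volume `V(K₁,…,Kₙ)`, via polarization of the volume. -/
def mixedVol (Ks : Fin n → ConvexBody (En n)) : ℝ :=
  ((n.factorial : ℝ))⁻¹ *
    ∑ S : Finset (Fin n), (-1 : ℝ) ^ (n - S.card) *
      (volume ((∑ k ∈ S, Ks k : ConvexBody (En n)) : Set (En n))).toReal

/-- `κ_m`, the volume of the `m`-dimensional unit ball. -/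
def kappa (m : ℕ) : ℝ := (volume (closedBall (0 : En m) 1)).toReal

/-- `ω_m`, the surface area of the `m`-dimensional unit ball. -/
def omegaS (m : ℕ) : ℝ := m * kappa m

/-- The `j`-th intrinsic volume `V_j(K) = binom(n,j) V(K[j],𝔹ⁿ[n-j]) / κ_{n-j}`. -/
def intrinsicVol (j : ℕ) (K : ConvexBody (En n)) : ℝ :=
  (n.choose j : ℝ) / kappa (n - j) *
    mixedVol (fun k : Fin n => if (k : ℕ) < j then K else ballB n)

/-- `μ` is the area measure of order `i` of `K`: for every convex body `L`,
`∫ h_L dμ = n V(L, K[i], 𝔹ⁿ[n-1-i])`. -/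
def IsAreaMeasure (i : ℕ) (K : ConvexBody (En n)) (μ : Measure (Sph n)) : Prop :=
  ∀ L : ConvexBody (En n),
    (∫ v : Sph n, supp L (v : En n) ∂μ) =
      n * mixedVol (fun k : Fin n =>
        if (k : ℕ) = 0 then L else if (k : ℕ) ≤ i then K else ballB n)

/-- `Φ` is generated by the zonal function with profile `g : [-1,1] → ℝ`, i.e.
`h_{ΦK} = S_i(K,·) ∗ g` where `∗` is the spherical convolution. -/
def GeneratedBy (i : ℕ) (Φ : ConvexBody (En n) → ConvexBody (En n)) (g : ℝ → ℝ) : Prop :=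
  ∀ (K : ConvexBody (En n)) (μ : Measure (Sph n)), IsAreaMeasure i K μ →
    ∀ u : En n, ‖u‖ = 1 →
      supp (Φ K) u = ∫ v : Sph n, g ⟪u, (v : En n)⟫_ℝ ∂μ

/-- `L` is a body of revolution: invariant under all rotations fixing the pole. -/
def IsZonalBody (L : ConvexBody (En n)) : Prop :=
  ∀ ρ : En n ≃ₗᵢ[ℝ] En n, IsRotation ρ → ρ (pole n) = pole n → rotate ρ L = L

/-- The quadratic form of the Hessian of `F` at `u` in direction `w`. -/
def hessQ (F : En n → ℝ) (u w : En n) : ℝ := iteratedFDeriv ℝ 2 F u ![w, w]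

/-- `(j,l)` entry of the Hessian of `F` at `u`. -/
def hessE (F : En n → ℝ) (u : En n) (j l : Fin n) : ℝ :=
  iteratedFDeriv ℝ 2 F u ![EuclideanSpace.single j 1, EuclideanSpace.single l 1]

/-- A convex body is of class `C^k₊` if its support function is of class `C^k`
away from the origin and the restriction of its Hessian to `u^⊥` is positive
definite for every unit vector `u`. -/
def IsCkPlus (k : ℕ∞) (L : ConvexBody (En n)) : Prop :=
  ContDiffOn ℝ k (supp L) {0}ᶜ ∧
    ∀ u : En n, ‖u‖ = 1 → ∀ w : En n, w ≠ 0 → ⟪u, w⟫_ℝ = 0 → 0 < hessQ (supp L) u w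

/-- `Φ` is a `C^∞₊` regular Minkowski valuation of degree `i`: it is generated by
the support function of a body of revolution of class `C^∞₊`. -/
def CInfRegular (i : ℕ) (Φ : ConvexBody (En n) → ConvexBody (En n)) : Prop :=
  ∃ (L : ConvexBody (En n)) (g : ℝ → ℝ), IsZonalBody L ∧ IsCkPlus ⊤ L ∧
    (∀ u : En n, ‖u‖ = 1 → supp L u = g ⟪u, pole n⟫_ℝ) ∧ GeneratedBy i Φ g

/-- The `C²(𝕊^{n-1})` distance of two functions. -/
def C2dist (F G : En n → ℝ) : ℝ :=
  ⨆ u : Sph n, (|F (u : En n) - G (u : En n)| +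
    ‖fderiv ℝ F (u : En n) - fderiv ℝ G (u : En n)‖ +
    ‖iteratedFDeriv ℝ 2 F (u : En n) - iteratedFDeriv ℝ 2 G (u : En n)‖)

/-- The Legendre polynomial of dimension `d` and degree `k` (Rodrigues formula). -/
def legendreP (d k : ℕ) (t : ℝ) : ℝ :=
  (-1 : ℝ) ^ k *
    (Real.Gamma (((d : ℝ) - 1) / 2) / (2 ^ k * Real.Gamma (((d : ℝ) - 1) / 2 + k))) *
    (1 - t ^ 2) ^ (-(((d : ℝ) - 3) / 2)) *
    iteratedDeriv k (fun s : ℝ => (1 - s ^ 2) ^ ((((d : ℝ) - 3) / 2) + (k : ℝ))) t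

/-- The multiplier `a_k^d[h]` of a zonal function with profile `h : [-1,1] → ℝ`. -/
def multInt (d k : ℕ) (h : ℝ → ℝ) : ℝ :=
  omegaS (d - 1) *
    ∫ t in (-1 : ℝ)..1, legendreP d k t * h t * (1 - t ^ 2) ^ (((d : ℝ) - 3) / 2)

/-- The multiplier `a_k^n[f] = ∫_{𝕊^{n-1}} f(u) P_k^n(ē·u) du` of a zonal function
`f` on the sphere. -/
def multSph (k : ℕ) (f : En n → ℝ) : ℝ :=
  ∫ u : Sph n, f (u : En n) * legendreP n k ⟪pole n, (u : En n)⟫_ℝ ∂(sphVol n)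

/-- The projection `π₀ f` of `f` onto the constants (its mean value). -/
def proj0 (f : En n → ℝ) : ℝ :=
  (omegaS n)⁻¹ * ∫ u : Sph n, f (u : En n) ∂(sphVol n)

/-- The `L²(𝕊^{n-1})` norm. -/
def sphL2 (f : En n → ℝ) : ℝ :=
  Real.sqrt (∫ u : Sph n, (f (u : En n)) ^ 2 ∂(sphVol n))

/-- The sup norm on the sphere. -/
def supSph (f : En n → ℝ) : ℝ := ⨆ u : Sph n, |f (u : En n)|

/-- `M ∈ UBounds α f` iff `M` witnesses `‖f‖_{𝒰_α} ≤ M`: `‖f‖_∞ ≤ M` and for every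
`k ≥ 1` there is a polynomial of degree at most `k` with `‖f - p_k‖_{L²} ≤ M k^{-α}`. -/
def UBounds (α : ℝ) (f : En n → ℝ) : Set ℝ :=
  {M | (∀ u : En n, ‖u‖ = 1 → |f u| ≤ M) ∧
    ∀ k : ℕ, 0 < k → ∃ p : MvPolynomial (Fin n) ℝ, p.totalDegree ≤ k ∧
      sphL2 (fun x => f x - MvPolynomial.eval (fun j => x j) p) ≤ M * (k : ℝ) ^ (-α)}

/-- `f ∈ 𝒰_α`. -/
def MemU (α : ℝ) (f : En n → ℝ) : Prop := (UBounds α f).Nonempty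

/-- The norm `‖f‖_{𝒰_α}`. -/
def UNorm (α : ℝ) (f : En n → ℝ) : ℝ := sInf (UBounds α f)

/-- The convolution transform `T_g f` with zonal kernel of profile `g`, extended
1-homogeneously to `ℝⁿ`: `(T_g f)(u) = ∫_{𝕊^{n-1}} g(u·v) f(v) dv` for unit `u`. -/
def Tg (g : ℝ → ℝ) (f : En n → ℝ) (x : En n) : ℝ :=
  ‖x‖ * ∫ v : Sph n, g ⟪‖x‖⁻¹ • x, (v : En n)⟫_ℝ * f (v : En n) ∂(sphVol n)

/-- The 0-homogeneous extension of a function on the sphere. -/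
def zeroExt (f : En n → ℝ) (x : En n) : ℝ := f (‖x‖⁻¹ • x)

/-- The spherical Laplacian `Δ_𝕊 f`, i.e. the Euclidean Laplacian of the
0-homogeneous extension. -/
def sphLap (f : En n → ℝ) (u : En n) : ℝ := ∑ j : Fin n, hessE (zeroExt f) u j j

/-- The operator `□_n f = f + Δ_𝕊 f /(n-1)`. -/
def boxN (f : En n → ℝ) (u : En n) : ℝ := f u + ((n : ℝ) - 1)⁻¹ * sphLap f u

/-- The mixed discriminant of `m` symmetric `m × m` matrices, via polarization of
the determinant. -/
def mixedDisc {m : ℕ} (A : Fin m → Matrix (Fin m) (Fin m) ℝ) : ℝ :=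
  ((m.factorial : ℝ))⁻¹ *
    ∑ S : Finset (Fin m), (-1 : ℝ) ^ (m - S.card) * (∑ k ∈ S, A k).det

/-- The rank one matrix `u ⊗ u`. -/
def outer (u : En n) : Matrix (Fin n) (Fin n) ℝ := Matrix.of fun j l => u j * u l

/-- The matrix of the orthogonal projection onto `u^⊥`. -/
def projMat (u : En n) : Matrix (Fin n) (Fin n) ℝ := 1 - outer u

/-- The Hessian matrix of `F` at `u`. -/
def hessMat (F : En n → ℝ) (u : En n) : Matrix (Fin n) (Fin n) ℝ :=
  Matrix.of fun j l => hessE F u j l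

/-- The mixed discriminant `D_{n-1}(B₁|_{u^⊥},…,B_{n-1}|_{u^⊥})` of the restrictions
to `u^⊥` of matrices annihilating `u`, computed via the identity
`D_{n-1}(B₁|_{u^⊥},…) = n · D_n(u ⊗ u, B₁,…,B_{n-1})`. -/
def restrDisc (u : En n) (B : Fin (n - 1) → Matrix (Fin n) (Fin n) ℝ) : ℝ :=
  n * mixedDisc (fun k : Fin n =>
    if h : (k : ℕ) = 0 then outer u else B ⟨(k : ℕ) - 1, by have := k.isLt; omega⟩)

/-- Total variation distance between two Borel measures on the sphere. -/
def dTV (μ ν : Measure (Sph n)) : ℝ :=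
  ⨆ A : {A : Set (Sph n) // MeasurableSet A}, |(μ A).toReal - (ν A).toReal|

/-- Lévy–Prokhorov distance between two Borel measures on the sphere. -/
def dLP (μ ν : Measure (Sph n)) : ℝ :=
  sInf {ε : ℝ | 0 < ε ∧ ∀ A : Set (Sph n), MeasurableSet A →
    μ A ≤ ν (Metric.thickening ε A) + ENNReal.ofReal ε ∧
    ν A ≤ μ (Metric.thickening ε A) + ENNReal.ofReal ε}

/-- Two convex bodies are homothetic: one is a translate of a positive dilate of
the other. -/
def Homothetic (K L : ConvexBody (En n)) : Prop :=
  ∃ (c : ℝ) (x : En n), 0 < c ∧ (L : Set (En n)) = x +ᵥ c • (K : Set (En n))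

/-- The dimension of a convex body (dimension of its affine hull). -/
def bodyDim (K : ConvexBody (En n)) : ℕ :=
  Module.finrank ℝ (vectorSpan ℝ (K : Set (En n)))

/-- `K` is a Euclidean ball. -/
def IsBall (K : ConvexBody (En n)) : Prop :=
  ∃ (c : En n) (r : ℝ), 0 < r ∧ (K : Set (En n)) = closedBall c r

/-- The mean width `w(K) = (2/ω_n) ∫_{𝕊^{n-1}} h_K`. -/
def meanWidth (K : ConvexBody (En n)) : ℝ :=
  2 / omegaS n * ∫ u : Sph n, supp K (u : En n) ∂(sphVol n)

/-- `N(n,k)`, the dimension of the space of spherical harmonics of dimension `n`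
and degree `k`. -/
def Nnk (n k : ℕ) : ℝ :=
  (((n : ℝ) + 2 * k - 2) / ((n : ℝ) + k - 2)) * (Nat.choose (n + k - 2) (n - 2) : ℝ)

/-! ### Support functions -/

lemma bddAbove_inner_image (K : ConvexBody (En n)) (x : En n) :
    BddAbove ((fun y => ⟪x, y⟫_ℝ) '' (K : Set (En n))) :=
  (K.isCompact.image (by fun_prop)).bddAbove

lemma inner_le_supp {K : ConvexBody (En n)} {y : En n} (hy : y ∈ K) (x : En n) :
    ⟪x, y⟫_ℝ ≤ supp K x :=
  le_csSup (bddAbove_inner_image K x) ⟨y, hy, rfl⟩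

lemma exists_mem_supp_eq (K : ConvexBody (En n)) (x : En n) :
    ∃ y ∈ K, ⟪x, y⟫_ℝ = supp K x :=
  (K.isCompact.image (f := fun y => ⟪x, y⟫_ℝ) (by fun_prop)).sSup_mem (K.nonempty.image _)

lemma supp_le {K : ConvexBody (En n)} {x : En n} {c : ℝ} (h : ∀ y ∈ K, ⟪x, y⟫_ℝ ≤ c) :
    supp K x ≤ c := by
  obtain ⟨y, hy, e⟩ := exists_mem_supp_eq K x
  exact e ▸ h y hy

lemma supp_mono {K L : ConvexBody (En n)} (h : K ≤ L) (x : En n) : supp K x ≤ supp L x :=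
  supp_le fun _ hy => inner_le_supp (h hy) x

lemma mem_add_iff {K L : ConvexBody (En n)} {x : En n} :
    x ∈ K + L ↔ ∃ y ∈ K, ∃ z ∈ L, y + z = x := by
  rw [← SetLike.mem_coe, ConvexBody.coe_add, Set.mem_add]; rfl

lemma mem_smul_iff {K : ConvexBody (En n)} {c : ℝ} {x : En n} :
    x ∈ c • K ↔ ∃ y ∈ K, c • y = x := by
  rw [← SetLike.mem_coe, ConvexBody.coe_smul, Set.mem_smul_set]; rfl

lemma supp_add (K L : ConvexBody (En n)) (x : En n) :
    supp (K + L) x = supp K x + supp L x := by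
  apply le_antisymm
  · refine supp_le fun y hy => ?_
    obtain ⟨a, ha, b, hb, rfl⟩ := mem_add_iff.1 hy
    rw [inner_add_right]
    exact add_le_add (inner_le_supp ha x) (inner_le_supp hb x)
  · obtain ⟨a, ha, ea⟩ := exists_mem_supp_eq K x
    obtain ⟨b, hb, eb⟩ := exists_mem_supp_eq L x
    rw [← ea, ← eb, ← inner_add_right]
    exact inner_le_supp (mem_add_iff.2 ⟨a, ha, b, hb, rfl⟩) x

lemma supp_smul {c : ℝ} (hc : 0 ≤ c) (K : ConvexBody (En n)) (x : En n) :
    supp (c • K) x = c * supp K x := by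
  apply le_antisymm
  · refine supp_le fun y hy => ?_
    obtain ⟨a, ha, rfl⟩ := mem_smul_iff.1 hy
    rw [inner_smul_right]
    exact mul_le_mul_of_nonneg_left (inner_le_supp ha x) hc
  · obtain ⟨a, ha, ea⟩ := exists_mem_supp_eq K x
    rw [← ea, ← inner_smul_right]
    exact inner_le_supp (mem_smul_iff.2 ⟨a, ha, rfl⟩) x

lemma supp_smul_arg {c : ℝ} (hc : 0 ≤ c) (K : ConvexBody (En n)) (x : En n) :
    supp K (c • x) = c * supp K x := by
  apply le_antisymm
  · refine supp_le fun y hy => ?_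
    rw [real_inner_smul_left]
    exact mul_le_mul_of_nonneg_left (inner_le_supp hy x) hc
  · obtain ⟨a, ha, ea⟩ := exists_mem_supp_eq K x
    rw [← ea, ← real_inner_smul_left]
    exact inner_le_supp ha _

lemma supp_zero_arg (K : ConvexBody (En n)) : supp K 0 = 0 := by
  simpa using supp_smul_arg le_rfl K 0

lemma supp_add_arg_le (K : ConvexBody (En n)) (x y : En n) :
    supp K (x + y) ≤ supp K x + supp K y := by
  refine supp_le fun z hz => ?_
  rw [inner_add_left]
  exact add_le_add (inner_le_supp hz x) (inner_le_supp hz y)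

lemma convexOn_supp (K : ConvexBody (En n)) : ConvexOn ℝ Set.univ (supp K) := by
  refine ⟨convex_univ, fun x _ y _ a b ha hb _ => ?_⟩
  calc supp K (a • x + b • y) ≤ supp K (a • x) + supp K (b • y) := supp_add_arg_le K _ _
    _ = a • supp K x + b • supp K y := by
      rw [supp_smul_arg ha, supp_smul_arg hb, smul_eq_mul, smul_eq_mul]

lemma le_of_supp_le {K L : ConvexBody (En n)} (h : ∀ x, supp K x ≤ supp L x) : K ≤ L := by
  intro y hy
  by_contra hyL
  obtain ⟨f, u, hf, hu⟩ := geometric_hahn_banach_closed_point L.convex L.isClosed hyL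
  obtain ⟨v, rfl⟩ := (InnerProductSpace.toDual ℝ (En n)).surjective f
  simp only [InnerProductSpace.toDual_apply_apply] at hf hu
  obtain ⟨z, hz, e⟩ := exists_mem_supp_eq L v
  have := inner_le_supp hy v
  linarith [hf z hz, h v]

lemma eq_of_supp_eq {K L : ConvexBody (En n)} (h : ∀ x, supp K x = supp L x) : K = L :=
  le_antisymm (le_of_supp_le fun x => (h x).le) (le_of_supp_le fun x => (h x).ge)

lemma supp_ballB (x : En n) : supp (ballB n) x = ‖x‖ := by
  apply le_antisymm
  · refine supp_le fun y hy => ?_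
    have hy : ‖y‖ ≤ 1 := mem_closedBall_zero_iff.1 hy
    calc ⟪x, y⟫_ℝ ≤ ‖x‖ * ‖y‖ := real_inner_le_norm x y
      _ ≤ ‖x‖ := mul_le_of_le_one_right (norm_nonneg x) hy
  · rcases eq_or_ne x 0 with rfl | hx
    · simp [supp_zero_arg]
    have h : ‖x‖⁻¹ • x ∈ ballB n := by
      change _ ∈ closedBall (0 : En n) 1
      simp [norm_smul, hx]
    have := inner_le_supp h x
    rwa [inner_smul_right, real_inner_self_eq_norm_sq, pow_two, ← mul_assoc,
      inv_mul_cancel₀ (norm_ne_zero_iff.2 hx), one_mul] at this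

/-- A point as a convex body. -/
def point (x : En n) : ConvexBody (En n) :=
  ⟨{x}, convex_singleton x, isCompact_singleton, Set.singleton_nonempty x⟩

lemma mem_point {x y : En n} : y ∈ point x ↔ y = x := Iff.rfl

lemma supp_point (x y : En n) : supp (point x) y = ⟪y, x⟫_ℝ := by
  simp [supp, point]

/-- The segment from the origin to `v` as a convex body. -/
def seg (v : En n) : ConvexBody (En n) :=
  ⟨segment ℝ 0 v, convex_segment 0 v, by
    rw [segment_eq_image']; exact isCompact_Icc.image (by fun_prop),
    ⟨0, left_mem_segment ℝ 0 v⟩⟩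

lemma mem_seg {v x : En n} : x ∈ seg v ↔ ∃ t ∈ Set.Icc (0 : ℝ) 1, t • v = x := by
  change x ∈ segment ℝ 0 v ↔ _
  rw [segment_eq_image']
  simp

lemma zero_mem_seg (v : En n) : (0 : En n) ∈ seg v := mem_seg.2 ⟨0, by simp, by simp⟩

lemma self_mem_seg (v : En n) : v ∈ seg v := mem_seg.2 ⟨1, by simp, by simp⟩

lemma seg_le {v : En n} {K : ConvexBody (En n)} (h0 : (0 : En n) ∈ K) (hv : v ∈ K) :
    seg v ≤ K := K.convex.segment_subset h0 hv

lemma supp_seg (v x : En n) : supp (seg v) x = max 0 ⟪x, v⟫_ℝ := by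
  apply le_antisymm
  · refine supp_le fun y hy => ?_
    obtain ⟨t, ⟨h0, h1⟩, rfl⟩ := mem_seg.1 hy
    rw [inner_smul_right]
    rcases le_total 0 ⟪x, v⟫_ℝ with h | h
    · exact le_max_of_le_right (mul_le_of_le_one_left h h1)
    · exact le_max_of_le_left (mul_nonpos_of_nonneg_of_nonpos h0 h)
  · exact max_le (by simpa using inner_le_supp (zero_mem_seg v) x)
      (inner_le_supp (self_mem_seg v) x)

lemma mem_scale_ballB {ε : ℝ} (hε : 0 ≤ ε) {x : En n} : x ∈ ε • ballB n ↔ ‖x‖ ≤ ε := by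
  rw [← SetLike.mem_coe, ConvexBody.coe_smul]
  change x ∈ ε • closedBall (0 : En n) 1 ↔ _
  rw [_root_.smul_closedBall _ _ zero_le_one]
  simp [abs_of_nonneg hε]

/-! ### The Hausdorff metric -/

lemma supp_le_add_dist (K L : ConvexBody (En n)) (x : En n) :
    supp K x ≤ supp L x + ‖x‖ * dist K L := by
  refine supp_le fun y hy => ?_
  refine le_of_forall_pos_le_add fun ε hε => ?_
  have hx : 0 < ‖x‖ + 1 := by positivity
  obtain ⟨z, hz, h⟩ := exists_dist_lt_of_hausdorffDist_lt (s := (K : Set (En n)))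
    (t := (L : Set (En n))) (r := dist K L + ε / (‖x‖ + 1)) hy
    (by rw [ConvexBody.hausdorffDist_coe]; linarith [div_pos hε hx])
    ConvexBody.hausdorffEDist_ne_top
  have h1 : ⟪x, y⟫_ℝ = ⟪x, z⟫_ℝ + ⟪x, y - z⟫_ℝ := by rw [inner_sub_right]; ring
  have h2 : ⟪x, y - z⟫_ℝ ≤ ‖x‖ * ‖y - z‖ := real_inner_le_norm _ _
  have h3 : ‖x‖ * ‖y - z‖ ≤ ‖x‖ * (dist K L + ε / (‖x‖ + 1)) :=
    mul_le_mul_of_nonneg_left (dist_eq_norm y z ▸ h.le) (norm_nonneg x)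
  have h4 : ‖x‖ * (ε / (‖x‖ + 1)) ≤ ε := by
    rw [mul_div_assoc', div_le_iff₀ hx]; nlinarith [norm_nonneg x]
  linarith [inner_le_supp hz x]

lemma abs_supp_sub_le (K L : ConvexBody (En n)) (x : En n) :
    |supp K x - supp L x| ≤ ‖x‖ * dist K L := by
  rw [abs_le]
  constructor
  · have := supp_le_add_dist L K x
    rw [dist_comm] at this; linarith
  · linarith [supp_le_add_dist K L x]

lemma dist_le_of_supp_le {K L : ConvexBody (En n)} {ε : ℝ} (hε : 0 ≤ ε)
    (h : ∀ x, |supp K x - supp L x| ≤ ε * ‖x‖) : dist K L ≤ ε := by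
  have key : ∀ A B : ConvexBody (En n), (∀ x, supp A x ≤ supp B x + ε * ‖x‖) →
      ∀ x ∈ (A : Set (En n)), ∃ y ∈ (B : Set (En n)), dist x y ≤ ε := by
    intro A B hAB x hx
    have : A ≤ B + ε • ballB n := le_of_supp_le fun x => by
      rw [supp_add, supp_smul hε, supp_ballB]; exact hAB x
    obtain ⟨y, hy, z, hz, rfl⟩ := mem_add_iff.1 (this hx)
    refine ⟨y, hy, ?_⟩
    rw [dist_eq_norm, add_sub_cancel_left]
    exact (mem_scale_ballB hε).1 hz
  rw [← ConvexBody.hausdorffDist_coe]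
  refine hausdorffDist_le_of_mem_dist hε (key K L fun x => ?_) (key L K fun x => ?_)
  · linarith [(abs_le.1 (h x)).2]
  · linarith [(abs_le.1 (h x)).1]

lemma exists_norm_le (K : ConvexBody (En n)) : ∃ R, 0 < R ∧ ∀ x ∈ K, ‖x‖ ≤ R := by
  obtain ⟨R, hR⟩ := K.isBounded.exists_norm_le
  exact ⟨max R 1, by positivity, fun x hx => (hR x hx).trans (le_max_left _ _)⟩

lemma exists_abs_supp_le (K : ConvexBody (En n)) : ∃ R, 0 < R ∧ ∀ x, |supp K x| ≤ R * ‖x‖ := by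
  obtain ⟨R, hR, h⟩ := exists_norm_le K
  refine ⟨R, hR, fun x => ?_⟩
  obtain ⟨y, hy, e⟩ := exists_mem_supp_eq K x
  rw [← e, mul_comm]
  exact (abs_real_inner_le_norm x y).trans
    (mul_le_mul_of_nonneg_left (h y hy) (norm_nonneg x))

lemma abs_supp_sub_arg_le {K : ConvexBody (En n)} {R : ℝ}
    (h : ∀ x, |supp K x| ≤ R * ‖x‖) (x y : En n) :
    |supp K x - supp K y| ≤ R * ‖x - y‖ := by
  have h1 := supp_add_arg_le K (x - y) y
  have h2 := supp_add_arg_le K (y - x) x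
  rw [sub_add_cancel] at h1 h2
  have h3 := (abs_le.1 (h (x - y))).2
  have h4 := (abs_le.1 (h (y - x))).2
  rw [norm_sub_rev] at h4
  rw [abs_le]; constructor <;> linarith

lemma continuous_supp (K : ConvexBody (En n)) : Continuous (supp K) := by
  obtain ⟨R, hR, h⟩ := exists_abs_supp_le K
  exact (LipschitzWith.of_dist_le_mul (K := ⟨R, hR.le⟩) fun x y => by
    rw [Real.dist_eq, dist_eq_norm]; exact abs_supp_sub_arg_le h x y).continuous

lemma dist_add_add_body_le (K L K' L' : ConvexBody (En n)) :
    dist (K + L) (K' + L') ≤ dist K K' + dist L L' := by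
  refine dist_le_of_supp_le (by positivity) fun x => ?_
  rw [supp_add, supp_add]
  have h1 := abs_le.1 (abs_supp_sub_le K K' x)
  have h2 := abs_le.1 (abs_supp_sub_le L L' x)
  rw [abs_le]; constructor <;> nlinarith [h1.1, h1.2, h2.1, h2.2]

instance : ContinuousAdd (ConvexBody (En n)) :=
  ⟨(LipschitzWith.of_dist_le_mul (K := 2) fun p q => by
    refine (dist_add_add_body_le _ _ _ _).trans ?_
    rw [Prod.dist_eq]
    have h1 := le_max_left (dist p.1 q.1) (dist p.2 q.2)
    have h2 := le_max_right (dist p.1 q.1) (dist p.2 q.2)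
    push_cast; linarith).continuous⟩

lemma tendsto_add_smul_zero (K L : ConvexBody (En n)) :
    Tendsto (fun t : ℝ => K + t • L) (𝓝[≥] 0) (𝓝 K) := by
  obtain ⟨R, hR, h⟩ := exists_abs_supp_le L
  rw [tendsto_iff_dist_tendsto_zero]
  have h1 : Tendsto (fun t : ℝ => t * R) (𝓝[≥] 0) (𝓝 0) := by
    have : Tendsto (fun t : ℝ => t * R) (𝓝 0) (𝓝 (0 * R)) := (continuous_mul_const R).tendsto 0
    rw [zero_mul] at this
    exact this.mono_left nhdsWithin_le_nhds
  refine squeeze_zero' (.of_forall fun _ => dist_nonneg) ?_ h1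
  filter_upwards [self_mem_nhdsWithin] with t ht
  have ht : 0 ≤ t := ht
  refine dist_le_of_supp_le (by positivity) fun x => ?_
  rw [supp_add, supp_smul ht, add_sub_cancel_left, abs_mul, abs_of_nonneg ht, mul_assoc]
  exact mul_le_mul_of_nonneg_left (h x) ht

lemma smul_add_body (c : ℝ) (K L : ConvexBody (En n)) : c • (K + L) = c • K + c • L :=
  smul_add c K L

lemma add_smul_body {a b : ℝ} (ha : 0 ≤ a) (hb : 0 ≤ b) (K : ConvexBody (En n)) :
    (a + b) • K = a • K + b • K :=
  eq_of_supp_eq fun x => by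
    rw [supp_add, supp_smul ha, supp_smul hb, supp_smul (add_nonneg ha hb)]; ring

/-! ### Continuity of volume and of moments -/

lemma mem_of_inner_le_supp {K : ConvexBody (En n)} {x : En n}
    (h : ∀ v, ⟪v, x⟫_ℝ ≤ supp K v) : x ∈ K :=
  le_of_supp_le (K := point x) (fun v => by rw [supp_point]; exact h v) (mem_point.2 rfl)

lemma point_add_le {K : ConvexBody (En n)} {x : En n} {r : ℝ} (hr : 0 ≤ r) :
    point x + r • ballB n ≤ K ↔ closedBall x r ⊆ (K : Set (En n)) := by
  have : ((point x + r • ballB n : ConvexBody (En n)) : Set (En n)) = closedBall x r := by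
    ext y
    rw [SetLike.mem_coe, mem_add_iff, mem_closedBall, dist_eq_norm]
    constructor
    · rintro ⟨a, rfl, b, hb, rfl⟩
      rw [add_sub_cancel_left]; exact (mem_scale_ballB hr).1 hb
    · exact fun h => ⟨x, rfl, y - x, (mem_scale_ballB hr).2 h, by abel⟩
  rw [← this]; rfl

lemma inner_add_le_supp {K : ConvexBody (En n)} {x : En n} {r : ℝ} (hr : 0 ≤ r)
    (h : closedBall x r ⊆ (K : Set (En n))) (v : En n) : ⟪v, x⟫_ℝ + r * ‖v‖ ≤ supp K v := by
  have := supp_mono ((point_add_le hr).2 h) v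
  rwa [supp_add, supp_point, supp_smul hr, supp_ballB] at this

lemma mem_of_closedBall_subset {K L : ConvexBody (En n)} {x : En n} {r : ℝ} (hr : 0 ≤ r)
    (h : closedBall x r ⊆ (K : Set (En n))) (hd : dist K L ≤ r) : x ∈ L := by
  refine mem_of_inner_le_supp fun v => ?_
  nlinarith [inner_add_le_supp hr h v, supp_le_add_dist K L v, norm_nonneg v]

lemma eventually_mem_of_mem_interior {K : ConvexBody (En n)} {x : En n}
    (hx : x ∈ interior (K : Set (En n))) : ∀ᶠ L in 𝓝 K, x ∈ L := by
  obtain ⟨r, hr, h⟩ := Metric.nhds_basis_closedBall.mem_iff.1 (mem_interior_iff_mem_nhds.1 hx)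
  filter_upwards [Metric.closedBall_mem_nhds K hr] with L hL
  exact mem_of_closedBall_subset hr.le h (by rwa [dist_comm])

lemma continuous_supp_body (x : En n) : Continuous (fun K : ConvexBody (En n) => supp K x) :=
  (LipschitzWith.of_dist_le_mul (K := ‖x‖₊) fun K L => by
    rw [Real.dist_eq]; exact abs_supp_sub_le K L x).continuous

lemma eventually_notMem {K : ConvexBody (En n)} {x : En n} (hx : x ∉ K) :
    ∀ᶠ L in 𝓝 K, x ∉ L := by
  have : ∃ v, supp K v < ⟪v, x⟫_ℝ := by
    by_contra! h; exact hx (mem_of_inner_le_supp h)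
  obtain ⟨v, hv⟩ := this
  filter_upwards [(continuous_supp_body v).continuousAt.eventually_lt
    continuousAt_const hv] with L hL hxL
  exact absurd (inner_le_supp hxL v) (not_le.2 hL)

lemma volume_frontier (K : ConvexBody (En n)) : volume (frontier (K : Set (En n))) = 0 :=
  K.convex.addHaar_frontier volume

lemma measurableSet_body (K : ConvexBody (En n)) : MeasurableSet (K : Set (En n)) :=
  K.isClosed.measurableSet

lemma continuous_setIntegral_body {E : Type*} [NormedAddCommGroup E] [NormedSpace ℝ E]
    {f : En n → E} (hf : Continuous f) :
    Continuous (fun K : ConvexBody (En n) => ∫ x in (K : Set (En n)), f x) := by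
  rw [continuous_iff_continuousAt]
  intro K
  simp only [ContinuousAt, ← integral_indicator (measurableSet_body _)]
  obtain ⟨R, hR, hKR⟩ := exists_norm_le K
  have hcomp : IsCompact (closedBall (0 : En n) (R + 1)) := isCompact_closedBall _ _
  refine tendsto_integral_filter_of_dominated_convergence
    ((closedBall (0 : En n) (R + 1)).indicator fun x => ‖f x‖)
    (.of_forall fun L => hf.aestronglyMeasurable.indicator (measurableSet_body L)) ?_ ?_ ?_
  · filter_upwards [Metric.ball_mem_nhds K one_pos] with L hL
    refine .of_forall fun x => ?_
    by_cases hx : x ∈ (L : Set (En n))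
    · have hxR : x ∈ closedBall (0 : En n) (R + 1) := by
        obtain ⟨y, hy, h⟩ := exists_dist_lt_of_hausdorffDist_lt (s := (L : Set (En n)))
          (t := (K : Set (En n))) hx hL ConvexBody.hausdorffEDist_ne_top
        rw [mem_closedBall_zero_iff]
        have := norm_le_norm_add_norm_sub y x
        rw [← dist_eq_norm, dist_comm] at this
        linarith [hKR y hy]
      rw [Set.indicator_of_mem hx, Set.indicator_of_mem hxR]
    · rw [Set.indicator_of_notMem hx, norm_zero]
      exact Set.indicator_nonneg (fun _ _ => norm_nonneg _) _
  · rw [integrable_indicator_iff measurableSet_closedBall]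
    exact hf.norm.continuousOn.integrableOn_compact hcomp
  · have h0 : ∀ᵐ x : En n, x ∉ frontier (K : Set (En n)) :=
      measure_eq_zero_iff_ae_notMem.1 (volume_frontier K)
    filter_upwards [h0] with x hx
    refine tendsto_const_nhds.congr' ?_
    by_cases hxK : x ∈ K
    · have hi : x ∈ interior (K : Set (En n)) := by
        by_contra h; exact hx ⟨subset_closure hxK, h⟩
      filter_upwards [eventually_mem_of_mem_interior hi] with L hL
      rw [Set.indicator_of_mem (by exact hxK), Set.indicator_of_mem (by exact hL)]
    · filter_upwards [eventually_notMem hxK] with L hL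
      rw [Set.indicator_of_notMem (by exact hxK), Set.indicator_of_notMem (by exact hL)]

/-- The volume of a convex body. -/
def vol (K : ConvexBody (En n)) : ℝ := (volume (K : Set (En n))).toReal

lemma continuous_vol : Continuous (vol (n := n)) := by
  have := continuous_setIntegral_body (n := n) (f := fun _ => (1 : ℝ)) continuous_const
  simp only [setIntegral_const, smul_eq_mul, mul_one] at this
  exact this

lemma volume_ne_top (K : ConvexBody (En n)) : volume (K : Set (En n)) ≠ ⊤ :=
  K.isCompact.measure_lt_top.ne

lemma vol_nonneg (K : ConvexBody (En n)) : 0 ≤ vol K := ENNReal.toReal_nonneg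

lemma vol_smul {c : ℝ} (hc : 0 ≤ c) (K : ConvexBody (En n)) : vol (c • K) = c ^ n * vol K := by
  rw [vol, vol, ConvexBody.coe_smul, Measure.addHaar_smul, ENNReal.toReal_mul,
    ENNReal.toReal_ofReal (abs_nonneg _)]
  simp [abs_of_nonneg hc]

lemma vol_add_point (K : ConvexBody (En n)) (x : En n) : vol (point x + K) = vol K := by
  rw [vol, vol, ConvexBody.coe_add]
  congr 1
  change volume ({x} + (K : Set (En n))) = _
  rw [Set.singleton_add, Set.image_add_left, measure_preimage_add]

lemma vol_pos {K : ConvexBody (En n)} (h : (interior (K : Set (En n))).Nonempty) : 0 < vol K :=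
  ENNReal.toReal_pos (Measure.measure_pos_of_nonempty_interior _ h).ne' (volume_ne_top K)

/-! ### Polarization -/

/-- The polarization `∑ t ≤ s, (-1)^{|s|-|t|} F(∑ t)` of a function on a commutative monoid. -/
def pol {M : Type*} [AddCommMonoid M] (F : M → ℝ) (s : Multiset M) : ℝ :=
  (s.powerset.map fun t => (-1 : ℝ) ^ (s.card - t.card) * F t.sum).sum

lemma pol_zero {M : Type*} [AddCommMonoid M] (F : M → ℝ) : pol F 0 = F 0 := by simp [pol]

lemma pol_cons {M : Type*} [AddCommMonoid M] (F : M → ℝ) (a : M) (s : Multiset M) :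
    pol F (a ::ₘ s) = pol (fun x => F (a + x)) s - pol F s := by
  simp only [pol, Multiset.powerset_cons, Multiset.map_add, Multiset.sum_add, Multiset.map_map]
  rw [add_comm, sub_eq_add_neg]
  congr 1
  · congr 1
    refine Multiset.map_congr rfl fun t _ => ?_
    simp
  · rw [← Multiset.sum_map_neg]
    congr 1
    refine Multiset.map_congr rfl fun t ht => ?_
    have := Multiset.card_le_card (Multiset.mem_powerset.1 ht)
    rw [Multiset.card_cons, Nat.succ_sub this, pow_succ]; ring

lemma pol_map {ι M : Type*} [AddCommMonoid M] (F : M → ℝ) (g : ι → M) (s : Multiset ι) :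
    pol F (s.map g) = (s.powerset.map fun t => (-1 : ℝ) ^ (s.card - t.card) *
      F (t.map g).sum).sum := by
  have key : ∀ (G : M → ℝ) (k : ℕ → ℝ) (u : Multiset ι),
      ((u.map g).powerset.map fun t => k t.card * G t.sum).sum =
      (u.powerset.map fun t => k t.card * G (t.map g).sum).sum := by
    intro G k u
    induction u using Multiset.induction_on generalizing G k with
    | empty => simp
    | cons b u ih =>
      simp only [Multiset.map_cons, Multiset.powerset_cons, Multiset.map_add, Multiset.sum_add,
        Multiset.map_map, Function.comp_apply, Multiset.card_cons, Multiset.sum_cons]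
      rw [ih G k, ih (fun x => G (g b + x)) (fun j => k (j + 1))]
  simpa [pol] using key F (fun j => (-1) ^ (s.card - j)) s

/-! ### Polarization of functions with vanishing iterated differences -/

section pol
variable {M : Type*} [AddCommMonoid M]

/-- `F` has degree at most `d` in the sense of iterated finite differences. -/
def FinDeg : ℕ → (M → ℝ) → Prop
  | 0, F => ∀ h x, F (h + x) = F x
  | d + 1, F => ∀ h, FinDeg d fun x => F (h + x) - F x

lemma FinDeg.add {d : ℕ} {F G : M → ℝ} (hF : FinDeg d F) (hG : FinDeg d G) :
    FinDeg d fun x => F x + G x := by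
  induction d generalizing F G with
  | zero => intro h x; simp only [hF h x, hG h x]
  | succ d ih =>
    intro h
    convert ih (hF h) (hG h) using 2
    ring

lemma FinDeg.const_mul {d : ℕ} {F : M → ℝ} (c : ℝ) (hF : FinDeg d F) :
    FinDeg d fun x => c * F x := by
  induction d generalizing F with
  | zero => intro h x; simp only [hF h x]
  | succ d ih =>
    intro h
    convert ih (hF h) using 2
    ring

lemma FinDeg.shift {d : ℕ} {F : M → ℝ} (a : M) (hF : FinDeg d F) :
    FinDeg d fun x => F (a + x) := by
  induction d generalizing F with
  | zero => intro h x; simp only [add_left_comm a h, hF h]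
  | succ d ih =>
    intro h
    have := ih (hF h)
    simp only [add_left_comm h a] at this ⊢
    exact this

lemma FinDeg.mul_linear {d : ℕ} {F ℓ : M → ℝ} (hF : FinDeg d F)
    (hℓ : ∀ a b, ℓ (a + b) = ℓ a + ℓ b) : FinDeg (d + 1) fun x => ℓ x * F x := by
  induction d generalizing F with
  | zero =>
    intro h k x
    simp only [hℓ, hF k, hF h]; ring
  | succ d ih =>
    intro h
    have h1 := (ih (hF h)).add ((hF.shift h).const_mul (ℓ h))
    convert h1 using 2
    simp only [hℓ]; ring

lemma FinDeg.finset_sum {ι : Type*} {d : ℕ} {F : ι → M → ℝ} (s : Finset ι)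
    (hF : ∀ i ∈ s, FinDeg d (F i)) : FinDeg d fun x => ∑ i ∈ s, F i x := by
  classical
  induction s using Finset.induction_on with
  | empty =>
    simp only [Finset.sum_empty]
    clear hF
    induction d with
    | zero => intro h x; rfl
    | succ d ih => intro h; simpa using ih
  | insert a s ha ih =>
    simp only [Finset.sum_insert ha]
    exact (hF a (Finset.mem_insert_self a s)).add
      (ih fun i hi => hF i (Finset.mem_insert_of_mem hi))

lemma finDeg_prod {ι : Type*} {ℓ : ι → M → ℝ} (hℓ : ∀ i a b, ℓ i (a + b) = ℓ i a + ℓ i b)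
    (s : Finset ι) : FinDeg s.card fun x => ∏ i ∈ s, ℓ i x := by
  classical
  induction s using Finset.induction_on with
  | empty => intro h x; simp
  | insert a s ha ih =>
    simp only [Finset.prod_insert ha, Finset.card_insert_of_notMem ha]
    exact ih.mul_linear (hℓ a)

lemma pol_sub (F G : M → ℝ) (s : Multiset M) :
    pol (fun x => F x - G x) s = pol F s - pol G s := by
  rw [pol, pol, pol, ← Multiset.sum_map_sub]
  congr 1
  exact Multiset.map_congr rfl fun t _ => mul_sub _ _ _

lemma pol_cons' (F : M → ℝ) (a : M) (s : Multiset M) :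
    pol F (a ::ₘ s) = pol (fun x => F (a + x) - F x) s := by
  rw [pol_sub, pol_cons]

lemma pol_zero_cons (F : M → ℝ) (s : Multiset M) : pol F (0 ::ₘ s) = 0 := by
  rw [pol_cons]; simp

lemma FinDeg.pol_add_cons {d : ℕ} {F : M → ℝ} (hF : FinDeg d F) {s : Multiset M}
    (hs : d = s.card + 1) (a b : M) :
    pol F ((a + b) ::ₘ s) = pol F (a ::ₘ s) + pol F (b ::ₘ s) := by
  subst hs
  induction s using Multiset.induction_on generalizing F with
  | empty =>
    have h := hF a b 0
    simp only [pol_cons, pol_zero, add_zero] at h ⊢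
    linarith
  | cons c s ih =>
    rw [Multiset.card_cons] at hF
    rw [Multiset.cons_swap, pol_cons', ih (hF c), Multiset.cons_swap a, Multiset.cons_swap b,
      pol_cons' F c, pol_cons' F c]

lemma pol_replicate (F : M → ℝ) (a : M) (k : ℕ) :
    pol F (Multiset.replicate k a) = (fwdDiff 1)^[k] (fun j : ℕ => F (j • a)) 0 := by
  have key : ∀ j : ℕ, pol (fun x => F (j • a + x)) (Multiset.replicate k a) =
      (fwdDiff 1)^[k] (fun j : ℕ => F (j • a)) j := by
    induction k with
    | zero => intro j; simp [pol_zero]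
    | succ k ih =>
      intro j
      rw [Multiset.replicate_succ, pol_cons, Function.iterate_succ_apply', fwdDiff, ← ih, ← ih]
      simp only [succ_nsmul, add_assoc]
  simpa using key 0

end pol

/-! ### Mixed discriminants -/

lemma finDeg_det : FinDeg n (Matrix.det (n := Fin n) (R := ℝ)) := by
  have : (Matrix.det (n := Fin n) (R := ℝ)) = fun A =>
      ∑ σ : Equiv.Perm (Fin n), ((Equiv.Perm.sign σ : ℤ) : ℝ) * ∏ i, A (σ i) i := by
    funext A; rw [Matrix.det_apply']
  rw [this]
  refine FinDeg.finset_sum _ fun σ _ => FinDeg.const_mul _ ?_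
  have := finDeg_prod (M := Matrix (Fin n) (Fin n) ℝ) (ℓ := fun i A => A (σ i) i)
    (fun i A B => by simp) Finset.univ
  simpa using this

lemma rank_add_le_add (A B : Matrix (Fin n) (Fin n) ℝ) : (A + B).rank ≤ A.rank + B.rank := by
  have h : LinearMap.range (A + B).mulVecLin ≤
      LinearMap.range A.mulVecLin ⊔ LinearMap.range B.mulVecLin := by
    rw [Matrix.mulVecLin_add]; exact LinearMap.range_add_le _ _
  exact (Submodule.finrank_mono h).trans (Submodule.finrank_add_le_finrank_add_finrank _ _)

lemma det_sum_vecMulVec_eq_zero {t : Multiset (Fin n → ℝ)} (ht : t.card < n) :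
    ((t.map fun u => Matrix.vecMulVec u u).sum).det = 0 := by
  have key : ((t.map fun u => Matrix.vecMulVec u u).sum).rank ≤ t.card := by
    clear ht
    induction t using Multiset.induction_on with
    | empty => simp
    | cons u t ih =>
      rw [Multiset.map_cons, Multiset.sum_cons, Multiset.card_cons, add_comm]
      have h1 := Matrix.rank_vecMulVec_le (R := ℝ) u u
      have h2 := rank_add_le_add (t.map fun u => Matrix.vecMulVec u u).sum (Matrix.vecMulVec u u)
      omega
  by_contra h
  have := Matrix.rank_of_det_ne_zero h
  rw [Fintype.card_fin] at this
  omega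

lemma pol_det_nonneg {s : Multiset (Matrix (Fin n) (Fin n) ℝ)} (hs : s.card = n)
    (h : ∀ A ∈ s, A.PosSemidef) : 0 ≤ pol Matrix.det s := by
  suffices H : ∀ (s : Multiset (Matrix (Fin n) (Fin n) ℝ)) (r : Multiset (Fin n → ℝ)),
      s.card + r.card = n → (∀ A ∈ s, A.PosSemidef) →
      0 ≤ pol Matrix.det (s + r.map fun u => Matrix.vecMulVec u u) by
    simpa using H s 0 (by simpa using hs) h
  clear hs h s
  intro s
  induction s using Multiset.induction_on with
  | empty =>
    intro r hr _
    simp only [Multiset.card_zero, zero_add] at hr ⊢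
    rw [pol_map]
    refine Multiset.sum_nonneg fun y hy => ?_
    obtain ⟨t, ht, rfl⟩ := Multiset.mem_map.1 hy
    have htr := Multiset.mem_powerset.1 ht
    rcases (Multiset.card_le_card htr).lt_or_eq with hlt | heq
    · rw [det_sum_vecMulVec_eq_zero (hlt.trans_eq hr), mul_zero]
    · rw [heq, Nat.sub_self, pow_zero, one_mul]
      refine Matrix.PosSemidef.det_nonneg ?_
      clear hy ht htr heq
      induction t using Multiset.induction_on with
      | empty => simpa using Matrix.PosSemidef.zero
      | cons u t ih =>
        rw [Multiset.map_cons, Multiset.sum_cons]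
        exact (by simpa using Matrix.posSemidef_vecMulVec_self_star u :
          (Matrix.vecMulVec u u).PosSemidef).add ih
  | cons A s ih =>
    intro r hr hA
    have hs : ∀ A ∈ s, A.PosSemidef := fun B hB => hA B (Multiset.mem_cons_of_mem hB)
    rw [Multiset.card_cons] at hr
    have hadd : ∀ A B : Matrix (Fin n) (Fin n) ℝ,
        pol Matrix.det ((A + B) ::ₘ (s + r.map fun u => Matrix.vecMulVec u u)) =
        pol Matrix.det (A ::ₘ (s + r.map fun u => Matrix.vecMulVec u u)) +
        pol Matrix.det (B ::ₘ (s + r.map fun u => Matrix.vecMulVec u u)) :=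
      fun A B => finDeg_det.pol_add_cons (by simp; omega) A B
    rw [Multiset.cons_add]
    open scoped MatrixOrder in
    have hmem := StarOrderedRing.nonneg_iff.1
      (Matrix.nonneg_iff_posSemidef.2 (hA A (Multiset.mem_cons_self A s)))
    clear hA
    induction hmem using AddSubmonoid.closure_induction with
    | mem B hB =>
      obtain ⟨C, rfl⟩ := hB
      have : star C * C = ∑ k, Matrix.vecMulVec (C k) (C k) := by
        ext i j
        simp [Matrix.mul_apply, Matrix.sum_apply, Matrix.vecMulVec_apply]
      simp only [this]
      generalize (Finset.univ : Finset (Fin n)) = F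
      induction F using Finset.induction_on with
      | empty => rw [Finset.sum_empty, pol_zero_cons]
      | insert k F hk ihF =>
        rw [Finset.sum_insert hk, hadd]
        refine add_nonneg ?_ ihF
        have := ih (C k ::ₘ r) (by simp; omega) hs
        rwa [Multiset.map_cons, Multiset.add_cons] at this
    | zero => rw [pol_zero_cons]
    | add B C _ _ hB hC => rw [hadd]; exact add_nonneg hB hC

/-! ### Mixed volumes indexed by multisets -/

/-- The mixed volume of a multiset of `n` convex bodies. -/
def mv (s : Multiset (ConvexBody (En n))) : ℝ := ((n.factorial : ℝ))⁻¹ * pol vol s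

lemma mixedVol_eq_mv (Ks : Fin n → ConvexBody (En n)) :
    mixedVol Ks = mv ((Finset.univ : Finset (Fin n)).val.map Ks) := by
  rw [mixedVol, mv, pol_map]
  congr 1
  have key : ∀ (f : Multiset (Fin n) → ℝ) (s : Finset (Fin n)),
      ∑ S ∈ s.powerset, f S.val = (s.val.powerset.map f).sum := by
    intro f s
    induction s using Finset.induction_on generalizing f with
    | empty => simp
    | insert a s ha ih =>
      rw [Finset.sum_powerset_insert ha, ih, Finset.insert_val_of_notMem ha,
        Multiset.powerset_cons, Multiset.map_add, Multiset.sum_add, Multiset.map_map,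
        ← ih (f ∘ Multiset.cons a)]
      congr 1
      refine Finset.sum_congr rfl fun S hS => ?_
      rw [Finset.insert_val_of_notMem fun h => ha (Finset.mem_powerset.1 hS h)]
      rfl
  have := key (fun t => (-1 : ℝ) ^ (Multiset.card (Finset.univ : Finset (Fin n)).val -
    Multiset.card t) * vol (t.map Ks).sum) Finset.univ
  rw [← this, Finset.powerset_univ]
  refine Finset.sum_congr rfl fun S _ => ?_
  simp only [vol, Finset.card_val, Finset.card_univ, Fintype.card_fin]
  rfl

lemma mv_replicate (K : ConvexBody (En n)) : mv (Multiset.replicate n K) = vol K := by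
  have h : (fun j : ℕ => vol (j • K)) = vol K • (fun j : ℕ => (j : ℝ) ^ n) := by
    funext j
    have : j • K = (j : ℝ) • K := by
      induction j with
      | zero => refine eq_of_supp_eq fun x => ?_
                rw [Nat.cast_zero, supp_smul le_rfl, zero_mul, zero_nsmul]
                simp [supp]
      | succ j ih =>
        rw [succ_nsmul, ih, Nat.cast_succ, add_smul_body (Nat.cast_nonneg j) zero_le_one, one_smul]
    simp only [Pi.smul_apply, smul_eq_mul, this]
    rw [vol_smul (Nat.cast_nonneg j), mul_comm]
  have h2 : ∀ k : ℕ, ∀ y : ℕ, (fwdDiff 1)^[k] (fun j : ℕ => (j : ℝ) ^ n) y =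
      (fwdDiff 1)^[k] (fun j : ℝ => j ^ n) y := by
    intro k
    induction k with
    | zero => intro y; rfl
    | succ k ih => intro y; simp only [Function.iterate_succ_apply', fwdDiff, ih]; push_cast; rfl
  rw [mv, pol_replicate, h, fwdDiff_iter_const_smul, Pi.smul_apply, h2,
    fwdDiff_iter_eq_factorial]
  have : (n.factorial : ℝ) ≠ 0 := by positivity
  simp only [Pi.natCast_apply, smul_eq_mul]
  field_simp

lemma mv_point_cons (x : En n) (s : Multiset (ConvexBody (En n))) : mv (point x ::ₘ s) = 0 := by
  rw [mv, pol_cons]; simp [vol_add_point]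

/-! ### Smooth potentials -/

lemma convex_add_fderiv_le {f : En n → ℝ} (hc : ConvexOn ℝ Set.univ f) (hd : Differentiable ℝ f)
    (x y : En n) : f x + fderiv ℝ f x (y - x) ≤ f y := by
  have h1 : HasDerivAt (fun t : ℝ => f (x + t • (y - x))) (fderiv ℝ f x (y - x)) 0 := by
    have h2 : HasDerivAt (fun t : ℝ => x + t • (y - x)) (y - x) 0 := by
      simpa using ((hasDerivAt_id (0 : ℝ)).smul_const (y - x)).const_add x
    have h3 : HasFDerivAt f (fderiv ℝ f x) (x + (0 : ℝ) • (y - x)) := by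
      simpa using (hd x).hasFDerivAt
    exact h3.comp_hasDerivAt 0 h2
  have h2 := hasDerivWithinAt_iff_tendsto_slope.1 (h1.hasDerivWithinAt (s := Set.Ioi 0))
  rw [Set.sdiff_singleton_eq_self (by simp)] at h2
  have h3 : ∀ᶠ t in 𝓝[>] (0 : ℝ), slope (fun t : ℝ => f (x + t • (y - x))) 0 t ≤ f y - f x := by
    filter_upwards [Ioo_mem_nhdsGT (zero_lt_one' ℝ)] with t ht
    have := hc.2 (Set.mem_univ x) (Set.mem_univ y) (sub_nonneg.2 ht.2.le) ht.1.le (by ring)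
    have e : (1 - t) • x + t • y = x + t • (y - x) := by module
    rw [e, smul_eq_mul, smul_eq_mul] at this
    rw [slope_def_field, div_le_iff₀ (by linarith [ht.1])]
    simp only [zero_smul, add_zero, sub_zero]
    linarith
  linarith [le_of_tendsto h2 h3]

/-- The Riesz isomorphism as a continuous linear map. -/
def riesz (n : ℕ) : (En n →L[ℝ] ℝ) →L[ℝ] En n :=
  LinearMap.toContinuousLinearMap
    { toFun := (InnerProductSpace.toDual ℝ (En n)).symm
      map_add' := fun a b => map_add _ a b
      map_smul' := fun c a => by simp }

/-- The gradient of `f`. -/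
def grad (f : En n → ℝ) (x : En n) : En n := riesz n (fderiv ℝ f x)

/-- The Hessian matrix of `f`. -/
def hess (f : En n → ℝ) (x : En n) : Matrix (Fin n) (Fin n) ℝ :=
  Matrix.of fun i j => fderiv ℝ (fderiv ℝ f) x (EuclideanSpace.single j 1)
    (EuclideanSpace.single i 1)

lemma inner_grad (f : En n → ℝ) (x v : En n) : ⟪grad f x, v⟫_ℝ = fderiv ℝ f x v :=
  InnerProductSpace.toDual_symm_apply

lemma differentiable_fderiv {f : En n → ℝ} (hf : ContDiff ℝ 2 f) :
    Differentiable ℝ (fderiv ℝ f) :=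
  (hf.fderiv_right (m := 1) (by norm_num)).differentiable (by norm_num)

lemma continuous_hess {f : En n → ℝ} (hf : ContDiff ℝ 2 f) : Continuous (hess f) := by
  have h1 : Continuous (fderiv ℝ (fderiv ℝ f)) :=
    (hf.fderiv_right (m := 1) (by norm_num)).continuous_fderiv (by norm_num)
  refine continuous_matrix fun i j => ?_
  exact (h1.clm_apply continuous_const).clm_apply continuous_const

lemma hasFDerivAt_grad {f : En n → ℝ} (hf : ContDiff ℝ 2 f) (x : En n) :
    HasFDerivAt (grad f) (riesz n ∘L fderiv ℝ (fderiv ℝ f) x) x :=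
  (riesz n).hasFDerivAt.comp x (differentiable_fderiv hf x).hasFDerivAt

lemma inner_fderiv_grad {f : En n → ℝ} (hf : ContDiff ℝ 2 f) (x v w : En n) :
    ⟪fderiv ℝ (grad f) x v, w⟫_ℝ = fderiv ℝ (fderiv ℝ f) x v w := by
  rw [(hasFDerivAt_grad hf x).fderiv]
  exact InnerProductSpace.toDual_symm_apply

lemma det_fderiv_grad {f : En n → ℝ} (hf : ContDiff ℝ 2 f) (x : En n) :
    (fderiv ℝ (grad f) x).det = (hess f x).det := by
  rw [ContinuousLinearMap.det, ← LinearMap.det_toMatrix (EuclideanSpace.basisFun (Fin n) ℝ).toBasis]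
  congr 1
  ext i j
  rw [LinearMap.toMatrix_apply]
  simp only [OrthonormalBasis.coe_toBasis, EuclideanSpace.basisFun_apply, hess, Matrix.of_apply]
  rw [← inner_fderiv_grad hf, real_inner_comm, EuclideanSpace.inner_single_left]
  simp

lemma hess_posSemidef {f : En n → ℝ} (hf : ContDiff ℝ 2 f) (hc : ConvexOn ℝ Set.univ f)
    (x : En n) : (hess f x).PosSemidef := by
  have hd : Differentiable ℝ f := hf.differentiable (by norm_num)
  have hnn : ∀ v, 0 ≤ fderiv ℝ (fderiv ℝ f) x v v := by
    intro v
    have h1 : HasDerivAt (fun t : ℝ => fderiv ℝ f (x + t • v) v)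
        (fderiv ℝ (fderiv ℝ f) x v v) 0 := by
      have h2 : HasDerivAt (fun t : ℝ => x + t • v) v 0 := by
        simpa using ((hasDerivAt_id (0 : ℝ)).smul_const v).const_add x
      have h3 : HasFDerivAt (fun y => fderiv ℝ f y v)
          ((ContinuousLinearMap.apply ℝ ℝ v) ∘L fderiv ℝ (fderiv ℝ f) x) (x + (0 : ℝ) • v) := by
        rw [zero_smul, add_zero]
        exact (ContinuousLinearMap.apply ℝ ℝ v).hasFDerivAt.comp x
          (differentiable_fderiv hf x).hasFDerivAt
      exact h3.comp_hasDerivAt 0 h2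
    have h2 := hasDerivWithinAt_iff_tendsto_slope.1 (h1.hasDerivWithinAt (s := Set.Ioi 0))
    rw [Set.sdiff_singleton_eq_self (by simp)] at h2
    refine ge_of_tendsto h2 ?_
    filter_upwards [self_mem_nhdsWithin] with t ht
    have ht : 0 < t := ht
    rw [slope_def_field]
    refine div_nonneg ?_ (by linarith)
    have a1 := convex_add_fderiv_le hc hd x (x + t • v)
    have a2 := convex_add_fderiv_le hc hd (x + t • v) x
    simp only [add_sub_cancel_left, sub_add_cancel_left, map_neg, map_smul, smul_eq_mul,
      zero_smul, add_zero] at a1 a2 ⊢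
    nlinarith
  have hsym : IsSymmSndFDerivAt ℝ f x :=
    hf.contDiffAt.isSymmSndFDerivAt (by simp)
  refine Matrix.PosSemidef.of_dotProduct_mulVec_nonneg ?_ fun v => ?_
  · ext i j
    simp only [hess, Matrix.conjTranspose_apply, Matrix.of_apply, star_trivial]
    exact hsym _ _
  · have := hnn (WithLp.toLp 2 v)
    have e : WithLp.toLp 2 v = ∑ i, v i • EuclideanSpace.single i (1 : ℝ) := by
      ext k; simp [Finset.sum_apply, Pi.single_apply]
    rw [e] at this
    simp only [map_sum, map_smul, _root_.sum_apply, _root_.smul_apply,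
      smul_eq_mul] at this
    simp only [dotProduct, Matrix.mulVec, hess, Matrix.of_apply, star_trivial]
    refine this.trans_eq ?_
    rw [Finset.sum_congr rfl fun i _ => ?_]
    simp only [Finset.mul_sum]
    refine Finset.sum_congr rfl fun j _ => ?_
    ring

lemma hess_add {f g : En n → ℝ} (hf : ContDiff ℝ 2 f) (hg : ContDiff ℝ 2 g) (x : En n) :
    hess (f + g) x = hess f x + hess g x := by
  have h1 : fderiv ℝ (f + g) = fderiv ℝ f + fderiv ℝ g := by
    funext y
    exact fderiv_add (hf.differentiable (by norm_num) y) (hg.differentiable (by norm_num) y)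
  ext i j
  simp only [hess, Matrix.of_apply, Matrix.add_apply, h1]
  rw [fderiv_add (differentiable_fderiv hf x) (differentiable_fderiv hg x)]
  rfl

lemma hess_congr {f g : En n → ℝ} {x : En n} (h : f =ᶠ[𝓝 x] g) : hess f x = hess g x := by
  ext i j
  simp only [hess, Matrix.of_apply, (h.fderiv).fderiv_eq]

/-- Smooth convex functions at bounded distance from the support function of a body. -/
def pots (n : ℕ) : AddSubmonoid (ConvexBody (En n) × (En n → ℝ)) where
  carrier := {p | ContDiff ℝ 2 p.2 ∧ ConvexOn ℝ Set.univ p.2 ∧ ∃ C, ∀ x, |p.2 x - supp p.1 x| ≤ C}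
  zero_mem' := ⟨contDiff_const, convexOn_const 0 convex_univ, 0, fun x => by simp [supp]⟩
  add_mem' := by
    rintro p q ⟨hp, hp', C, hC⟩ ⟨hq, hq', D, hD⟩
    refine ⟨hp.add hq, hp'.add hq', C + D, fun x => ?_⟩
    have h1 := abs_le.1 (hC x)
    have h2 := abs_le.1 (hD x)
    simp only [Prod.snd_add, Prod.fst_add, Pi.add_apply, supp_add]
    exact abs_le.2 ⟨by linarith, by linarith⟩

lemma grad_mem {p : ConvexBody (En n) × (En n → ℝ)} (hp : p ∈ pots n) (x : En n) :
    grad p.2 x ∈ p.1 := by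
  obtain ⟨h2, hc, C, hC⟩ := hp
  refine mem_of_inner_le_supp fun z => ?_
  have hd : Differentiable ℝ p.2 := h2.differentiable (by norm_num)
  rw [real_inner_comm]
  have key : ∀ t : ℝ, 0 < t →
      ⟪grad p.2 x, z⟫_ℝ ≤ supp p.1 z + t⁻¹ * (C - p.2 x + ⟪grad p.2 x, x⟫_ℝ) := by
    intro t ht
    have h := convex_add_fderiv_le hc hd x (t • z)
    have h' := (abs_le.1 (hC (t • z))).2
    rw [supp_smul_arg ht.le] at h'
    rw [← inner_grad, inner_sub_right, inner_smul_right] at h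
    have : t * ⟪grad p.2 x, z⟫_ℝ ≤ t * (supp p.1 z + t⁻¹ * (C - p.2 x + ⟪grad p.2 x, x⟫_ℝ)) := by
      rw [mul_add, mul_inv_cancel_left₀ ht.ne']; linarith
    exact le_of_mul_le_mul_left this ht
  have hl : Tendsto (fun t : ℝ => supp p.1 z + t⁻¹ * (C - p.2 x + ⟪grad p.2 x, x⟫_ℝ)) atTop
      (𝓝 (supp p.1 z + 0 * (C - p.2 x + ⟪grad p.2 x, x⟫_ℝ))) :=
    (tendsto_inv_atTop_zero.mul_const _).const_add _
  rw [zero_mul, add_zero] at hl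
  exact ge_of_tendsto hl ((eventually_gt_atTop 0).mono fun t ht => key t ht)

lemma interior_subset_range_grad {p : ConvexBody (En n) × (En n → ℝ)} (hp : p ∈ pots n) :
    interior (p.1 : Set (En n)) ⊆ Set.range (grad p.2) := by
  obtain ⟨h2, hc, C, hC⟩ := hp
  intro y hy
  have hd : Differentiable ℝ p.2 := h2.differentiable (by norm_num)
  obtain ⟨r, hr, h⟩ := Metric.nhds_basis_closedBall.mem_iff.1 (mem_interior_iff_mem_nhds.1 hy)
  have hlim : Tendsto (fun z => p.2 z - ⟪z, y⟫_ℝ) (cocompact (En n)) atTop := by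
    refine tendsto_atTop_mono (f := fun z => r * ‖z‖ - C) (fun z => ?_) ?_
    · have h1 := inner_add_le_supp hr.le h z
      have h2 := (abs_le.1 (hC z)).1
      linarith
    · exact tendsto_atTop_add_const_right _ _
        ((tendsto_norm_cocompact_atTop).const_mul_atTop hr)
  obtain ⟨x, hx⟩ := (hd.continuous.sub (by fun_prop)).exists_forall_le hlim
  refine ⟨x, ext_inner_right ℝ fun v => ?_⟩
  have h1 : HasFDerivAt (fun z => p.2 z - ⟪y, z⟫_ℝ) (fderiv ℝ p.2 x - innerSL ℝ y) x :=
    (hd x).hasFDerivAt.sub (innerSL ℝ y).hasFDerivAt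
  have h3 : IsLocalMin (fun z => p.2 z - ⟪y, z⟫_ℝ) x := by
    refine Eventually.of_forall fun z => ?_
    have : p.2 x - ⟪x, y⟫_ℝ ≤ p.2 z - ⟪z, y⟫_ℝ := hx z
    rwa [real_inner_comm y x, real_inner_comm y z] at this
  have h4 := h3.hasFDerivAt_eq_zero h1
  rw [inner_grad]
  have := congrArg (fun φ : En n →L[ℝ] ℝ => φ v) h4
  simp only [_root_.sub_apply, innerSL_apply_apply, _root_.zero_apply] at this
  linarith

lemma injOn_grad {p : ConvexBody (En n) × (En n → ℝ)} (hp : p ∈ pots n) :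
    Set.InjOn (grad p.2) {x | (fderiv ℝ (grad p.2) x).det ≠ 0} := by
  obtain ⟨h2, hc, -⟩ := hp
  have hd : Differentiable ℝ p.2 := h2.differentiable (by norm_num)
  intro a ha b _ hab
  have hmin : ∀ x, grad p.2 x = grad p.2 a ↔
      ∀ z, p.2 x - ⟪grad p.2 a, x⟫_ℝ ≤ p.2 z - ⟪grad p.2 a, z⟫_ℝ := by
    intro x
    refine ⟨fun h z => ?_, fun h => ext_inner_right ℝ fun v => ?_⟩
    · have := convex_add_fderiv_le hc hd x z
      rw [← inner_grad, h, inner_sub_right] at this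
      linarith
    · have h1 : HasFDerivAt (fun z => p.2 z - ⟪grad p.2 a, z⟫_ℝ)
          (fderiv ℝ p.2 x - innerSL ℝ (grad p.2 a)) x :=
        (hd x).hasFDerivAt.sub (innerSL ℝ _).hasFDerivAt
      have h3 : IsLocalMin (fun z => p.2 z - ⟪grad p.2 a, z⟫_ℝ) x := Eventually.of_forall h
      have := congrArg (fun φ : En n →L[ℝ] ℝ => φ v) (h3.hasFDerivAt_eq_zero h1)
      simp only [_root_.sub_apply, innerSL_apply_apply, _root_.zero_apply] at this
      rw [inner_grad]; linarith
  have hseg : ∀ t ∈ Set.Icc (0 : ℝ) 1, grad p.2 (a + t • (b - a)) = grad p.2 a := by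
    intro t ht
    rw [hmin]
    intro z
    have ha' := (hmin a).1 rfl z
    have hb' := (hmin b).1 hab.symm z
    have := hc.2 (Set.mem_univ a) (Set.mem_univ b) (sub_nonneg.2 ht.2) ht.1 (by ring)
    have e : (1 - t) • a + t • b = a + t • (b - a) := by module
    rw [e, smul_eq_mul, smul_eq_mul] at this
    rw [← e, inner_add_right, inner_smul_right, inner_smul_right, e]
    nlinarith [ht.1, ht.2, mul_le_mul_of_nonneg_left ha' (sub_nonneg.2 ht.2),
      mul_le_mul_of_nonneg_left hb' ht.1]
  have hder : HasDerivAt (fun t : ℝ => grad p.2 (a + t • (b - a)))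
      (fderiv ℝ (grad p.2) a (b - a)) 0 := by
    have h2' : HasDerivAt (fun t : ℝ => a + t • (b - a)) (b - a) 0 := by
      simpa using ((hasDerivAt_id (0 : ℝ)).smul_const (b - a)).const_add a
    have h3 : HasFDerivAt (grad p.2) (fderiv ℝ (grad p.2) a) (a + (0 : ℝ) • (b - a)) := by
      simpa using (hasFDerivAt_grad h2 a).differentiableAt.hasFDerivAt
    exact h3.comp_hasDerivAt 0 h2'
  have h0 : fderiv ℝ (grad p.2) a (b - a) = 0 := by
    have hu : UniqueDiffWithinAt ℝ (Set.Icc (0 : ℝ) 1) 0 :=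
      uniqueDiffOn_Icc zero_lt_one 0 (by simp)
    have h5 : HasDerivWithinAt (fun t : ℝ => grad p.2 (a + t • (b - a))) 0 (Set.Icc 0 1) 0 :=
      (hasDerivWithinAt_const 0 (Set.Icc (0 : ℝ) 1) (grad p.2 a)).congr hseg (by simp)
    exact hu.eq_deriv _ hder.hasDerivWithinAt h5
  by_contra hne
  refine ha ?_
  exact LinearMap.det_eq_zero_iff_ker_ne_bot.2
    fun hk => hne (by
      have : b - a ∈ LinearMap.ker (fderiv ℝ (grad p.2) a : En n →ₗ[ℝ] En n) := h0
      rw [hk, Submodule.mem_bot, sub_eq_zero] at this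
      exact this.symm)

lemma lintegral_det_hess {p : ConvexBody (En n) × (En n → ℝ)} (hp : p ∈ pots n) :
    ∫⁻ x, ENNReal.ofReal (hess p.2 x).det = volume (p.1 : Set (En n)) := by
  have h2 := hp.1
  have hc := hp.2.1
  set S := {x | (fderiv ℝ (grad p.2) x).det ≠ 0} with hS
  have hcont : Continuous fun x => (fderiv ℝ (grad p.2) x).det := by
    simp only [det_fderiv_grad h2]
    exact (continuous_hess h2).matrix_det
  have hSm : MeasurableSet S := (isOpen_ne_fun hcont continuous_const).measurableSet
  have hder : ∀ T : Set (En n), ∀ x ∈ T, HasFDerivWithinAt (grad p.2) (fderiv ℝ (grad p.2) x) T x :=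
    fun T x _ => (hasFDerivAt_grad h2 x).differentiableAt.hasFDerivAt.hasFDerivWithinAt
  have h1 := lintegral_abs_det_fderiv_eq_addHaar_image volume hSm (hder S) (injOn_grad hp)
  have h0 : volume (grad p.2 '' Sᶜ) = 0 :=
    addHaar_image_eq_zero_of_det_fderivWithin_eq_zero volume (hder Sᶜ) fun x hx => by
      simpa [hS] using hx
  have hvol : volume (grad p.2 '' S) = volume (p.1 : Set (En n)) := by
    apply le_antisymm
    · exact measure_mono (by rintro _ ⟨x, -, rfl⟩; exact grad_mem hp x)
    · have hsub : (p.1 : Set (En n)) ⊆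
          grad p.2 '' S ∪ (grad p.2 '' Sᶜ ∪ frontier (p.1 : Set (En n))) := by
        intro y hy
        by_cases hyi : y ∈ interior (p.1 : Set (En n))
        · obtain ⟨x, rfl⟩ := interior_subset_range_grad hp hyi
          by_cases hx : x ∈ S
          · exact Or.inl ⟨x, hx, rfl⟩
          · exact Or.inr (Or.inl ⟨x, hx, rfl⟩)
        · exact Or.inr (Or.inr ⟨subset_closure hy, hyi⟩)
      refine (measure_mono hsub).trans ((measure_union_le _ _).trans ?_)
      rw [measure_union_null h0 (volume_frontier _), add_zero]
  rw [← hvol, ← h1, ← lintegral_indicator hSm]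
  refine lintegral_congr fun x => ?_
  rw [← det_fderiv_grad h2, Set.indicator_apply]
  split_ifs with h
  · rw [abs_of_nonneg]
    rw [det_fderiv_grad h2]
    exact (hess_posSemidef h2 hc x).det_nonneg
  · have : (fderiv ℝ (grad p.2) x).det = 0 := by simpa [hS] using h
    rw [this, ENNReal.ofReal_zero]

lemma integrable_det_hess {p : ConvexBody (En n) × (En n → ℝ)} (hp : p ∈ pots n) :
    Integrable fun x => (hess p.2 x).det := by
  refine ⟨((continuous_hess hp.1).matrix_det).aestronglyMeasurable, ?_⟩
  rw [hasFiniteIntegral_iff_ofReal (Eventually.of_forall fun x =>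
    (hess_posSemidef hp.1 hp.2.1 x).det_nonneg), lintegral_det_hess hp]
  exact (volume_ne_top _).lt_top

lemma integral_det_hess {p : ConvexBody (En n) × (En n → ℝ)} (hp : p ∈ pots n) :
    ∫ x, (hess p.2 x).det = vol p.1 := by
  rw [integral_eq_lintegral_of_nonneg_ae (Eventually.of_forall fun x =>
    (hess_posSemidef hp.1 hp.2.1 x).det_nonneg)
    ((continuous_hess hp.1).matrix_det).aestronglyMeasurable, lintegral_det_hess hp]
  rfl

/-- A fixed smooth bump of integral one. -/
def bump (n : ℕ) : En n → ℝ :=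
  (⟨1, 2, by norm_num, by norm_num⟩ : ContDiffBump (0 : En n)).normed volume

lemma bump_nonneg (x : En n) : 0 ≤ bump n x := ContDiffBump.nonneg_normed _ _

lemma integral_bump : ∫ x, bump n x = 1 := ContDiffBump.integral_normed _

lemma hasCompactSupport_bump : HasCompactSupport (bump n) :=
  ContDiffBump.hasCompactSupport_normed _

lemma continuous_bump : Continuous (bump n) := ContDiffBump.continuous_normed _

lemma norm_lt_of_bump_ne_zero {x : En n} (h : bump n x ≠ 0) : ‖x‖ < 2 := by
  have : x ∈ Function.support (bump n) := h
  rw [bump, ContDiffBump.support_normed_eq] at this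
  simpa using this

/-- The mollification of `f`. -/
def smooth (f : En n → ℝ) : En n → ℝ :=
  convolution (bump n) f (ContinuousLinearMap.lsmul ℝ ℝ) volume

lemma smooth_apply (f : En n → ℝ) (x : En n) : smooth f x = ∫ t, bump n t * f (x - t) := rfl

lemma contDiff_smooth {f : En n → ℝ} (hf : Continuous f) : ContDiff ℝ 2 (smooth f) :=
  hasCompactSupport_bump.contDiff_convolution_left _ (ContDiffBump.contDiff_normed _)
    hf.locallyIntegrable

lemma integrable_bump_mul {f : En n → ℝ} (hf : Continuous f) (x : En n) :
    Integrable fun t => bump n t * f (x - t) :=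
  (continuous_bump.mul (hf.comp (continuous_const.sub
    continuous_id))).integrable_of_hasCompactSupport
    hasCompactSupport_bump.mul_right

lemma continuous_of_convexOn {f : En n → ℝ} (hc : ConvexOn ℝ Set.univ f) : Continuous f :=
  continuousOn_univ.1 (hc.continuousOn isOpen_univ)

lemma convexOn_smooth {f : En n → ℝ} (hc : ConvexOn ℝ Set.univ f) :
    ConvexOn ℝ Set.univ (smooth f) := by
  have hf := continuous_of_convexOn hc
  refine ⟨convex_univ, fun x _ y _ a b ha hb hab => ?_⟩
  simp only [smooth_apply, smul_eq_mul]
  rw [← integral_const_mul, ← integral_const_mul, ← integral_add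
    ((integrable_bump_mul hf x).const_mul a) ((integrable_bump_mul hf y).const_mul b)]
  refine integral_mono (integrable_bump_mul hf _) (((integrable_bump_mul hf x).const_mul a).add
    ((integrable_bump_mul hf y).const_mul b)) fun t => ?_
  have h := hc.2 (Set.mem_univ (x - t)) (Set.mem_univ (y - t)) ha hb hab
  have e : a • (x - t) + b • (y - t) = a • x + b • y - t := by
    obtain rfl : b = 1 - a := by linarith
    module
  rw [e, smul_eq_mul, smul_eq_mul] at h
  have := mul_le_mul_of_nonneg_left h (bump_nonneg t)
  simp only
  linarith

lemma abs_smooth_sub_le {f : En n → ℝ} (hf : Continuous f) {c C : ℝ} {x : En n}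
    (h : ∀ t, ‖t‖ < 2 → |f (x - t) - c| ≤ C) : |smooth f x - c| ≤ C := by
  have e : smooth f x - c = ∫ t, bump n t * (f (x - t) - c) := by
    have h1 : Integrable fun t => bump n t * c :=
      (continuous_bump.integrable_of_hasCompactSupport hasCompactSupport_bump).mul_const c
    simp only [mul_sub]
    rw [integral_sub (integrable_bump_mul hf x) h1, integral_mul_const, integral_bump, one_mul,
      smooth_apply]
  have h2 : ∫ t, bump n t * C = C := by rw [integral_mul_const, integral_bump, one_mul]
  rw [e, ← Real.norm_eq_abs]
  conv_rhs => rw [← h2]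
  refine norm_integral_le_of_norm_le
    ((continuous_bump.integrable_of_hasCompactSupport hasCompactSupport_bump).mul_const C)
    (Eventually.of_forall fun t => ?_)
  rw [Real.norm_eq_abs, abs_mul, abs_of_nonneg (bump_nonneg t)]
  by_cases ht : bump n t = 0
  · simp [ht]
  · exact mul_le_mul_of_nonneg_left (h t (norm_lt_of_bump_ne_zero ht)) (bump_nonneg t)

lemma smooth_congr {f g : En n → ℝ} {x : En n} (h : ∀ t, ‖t‖ < 2 → f (x - t) = g (x - t)) :
    smooth f x = smooth g x := by
  rw [smooth_apply, smooth_apply]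
  refine integral_congr_ae (Eventually.of_forall fun t => ?_)
  by_cases ht : bump n t = 0
  · simp [ht]
  · simp only [h t (norm_lt_of_bump_ne_zero ht)]

lemma smooth_mem_pots {K : ConvexBody (En n)} {f : En n → ℝ} (hc : ConvexOn ℝ Set.univ f)
    {C : ℝ} (hC : ∀ x, |f x - supp K x| ≤ C) : (K, smooth f) ∈ pots n := by
  have hf := continuous_of_convexOn hc
  obtain ⟨R, hR, h⟩ := exists_abs_supp_le K
  refine ⟨contDiff_smooth hf, convexOn_smooth hc, C + R * 2, fun x => ?_⟩
  refine abs_smooth_sub_le hf fun t ht => ?_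
  have h1 := abs_supp_sub_arg_le h (x - t) x
  have h2 := hC (x - t)
  have e : ‖x - t - x‖ = ‖t‖ := by rw [sub_sub_cancel_left, norm_neg]
  rw [e] at h1
  calc _ ≤ |f (x - t) - supp K (x - t)| + |supp K (x - t) - supp K x| := abs_sub_le _ _ _
    _ ≤ C + R * 2 := by nlinarith

lemma smooth_supp_mem_pots (K : ConvexBody (En n)) : (K, smooth (supp K)) ∈ pots n :=
  smooth_mem_pots (convexOn_supp K) (C := 0) (by simp)

/-- The canonical potential of a body. -/
def pot (K : ConvexBody (En n)) : pots n := ⟨(K, smooth (supp K)), smooth_supp_mem_pots K⟩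

/-- The body of a potential. -/
def potBody (n : ℕ) : pots n →+ ConvexBody (En n) :=
  (AddMonoidHom.fst _ _).comp (pots n).subtype

lemma potBody_pot (K : ConvexBody (En n)) : potBody n (pot K) = K := rfl

/-- The Hessian of a potential. -/
def potHess (x : En n) : pots n →+ Matrix (Fin n) (Fin n) ℝ where
  toFun p := hess p.1.2 x
  map_zero' := by
    ext i j
    have : fderiv ℝ (fun _ : En n => (0 : ℝ)) = 0 := by funext y; simp
    change fderiv ℝ (fderiv ℝ (fun _ : En n => (0 : ℝ))) x _ _ = 0
    rw [this]; simp
  map_add' p q := hess_add p.2.1 q.2.1 x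

lemma FinDeg.comp {M N : Type*} [AddCommMonoid M] [AddCommMonoid N] {d : ℕ} {F : N → ℝ}
    (hF : FinDeg d F) (φ : M →+ N) : FinDeg d fun x => F (φ x) := by
  induction d generalizing F with
  | zero => intro h x; simp only [map_add, hF (φ h)]
  | succ d ih => intro h; simpa only [map_add] using ih (hF (φ h))

lemma FinDeg.of_comp {M N : Type*} [AddCommMonoid M] [AddCommMonoid N] {d : ℕ} {F : N → ℝ}
    {φ : M →+ N} (hφ : Function.Surjective φ) (hF : FinDeg d fun x => F (φ x)) : FinDeg d F := by
  induction d generalizing F with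
  | zero =>
    intro h x
    obtain ⟨h, rfl⟩ := hφ h
    obtain ⟨x, rfl⟩ := hφ x
    simpa only [map_add] using hF h x
  | succ d ih =>
    intro h
    obtain ⟨h, rfl⟩ := hφ h
    exact ih (by simpa only [map_add] using hF h)

lemma FinDeg.integral {M Ω : Type*} [AddCommMonoid M] [MeasurableSpace Ω] {μ : Measure Ω} {d : ℕ}
    {F : Ω → M → ℝ} (hF : ∀ ω, FinDeg d (F ω)) (hi : ∀ x, Integrable (fun ω => F ω x) μ) :
    FinDeg d fun x => ∫ ω, F ω x ∂μ := by
  induction d generalizing F with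
  | zero => intro h x; simp only [hF _ h]
  | succ d ih =>
    intro h
    simp only [← integral_sub (hi _) (hi _)]
    exact ih (fun ω => hF ω h) fun x => (hi _).sub (hi _)

lemma pol_comp {M N : Type*} [AddCommMonoid M] [AddCommMonoid N] (F : N → ℝ) (φ : M →+ N)
    (s : Multiset M) : pol F (s.map φ) = pol (fun x => F (φ x)) s := by
  induction s using Multiset.induction_on generalizing F with
  | empty => simp [pol_zero]
  | cons a s ih => rw [Multiset.map_cons, pol_cons', ih, pol_cons']; simp only [map_add]

lemma pol_integral {M Ω : Type*} [AddCommMonoid M] [MeasurableSpace Ω] {μ : Measure Ω}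
    {F : Ω → M → ℝ} (hi : ∀ x, Integrable (fun ω => F ω x) μ) (s : Multiset M) :
    Integrable (fun ω => pol (F ω) s) μ ∧ pol (fun x => ∫ ω, F ω x ∂μ) s = ∫ ω, pol (F ω) s ∂μ := by
  induction s using Multiset.induction_on generalizing F with
  | empty => simpa only [pol_zero, and_true] using hi 0
  | cons a s ih =>
    simp only [pol_cons', ← integral_sub (hi _) (hi _)]
    exact ih (F := fun ω x => F ω (a + x) - F ω x) fun x => (hi _).sub (hi _)

lemma vol_potBody (p : pots n) : vol (potBody n p) = ∫ x, (potHess x p).det :=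
  (integral_det_hess p.2).symm

lemma finDeg_vol : FinDeg n (vol (n := n)) := by
  refine FinDeg.of_comp (φ := potBody n) (fun K => ⟨pot K, rfl⟩) ?_
  simp only [vol_potBody]
  exact FinDeg.integral (fun x => finDeg_det.comp (potHess x)) fun p => integrable_det_hess p.2

lemma mv_map_potBody (s : Multiset (pots n)) :
    Integrable (fun x => pol Matrix.det (s.map (potHess x))) ∧
    mv (s.map (potBody n)) = ((n.factorial : ℝ))⁻¹ * ∫ x, pol Matrix.det (s.map (potHess x)) := by
  have := pol_integral (μ := volume) (F := fun x (p : pots n) => (potHess x p).det)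
    (fun p => integrable_det_hess p.2) s
  simp only [pol_comp, mv, vol_potBody]
  exact ⟨this.1, by rw [this.2]⟩

lemma exists_map_potBody (s : Multiset (ConvexBody (En n))) :
    ∃ t : Multiset (pots n), t.map (potBody n) = s :=
  ⟨s.map pot, by simp [Multiset.map_map, Function.comp_def, potBody_pot]⟩

lemma pol_potHess_nonneg {s : Multiset (pots n)} (hs : s.card = n) (x : En n) :
    0 ≤ pol Matrix.det (s.map (potHess x)) := by
  refine pol_det_nonneg (by simpa) fun A hA => ?_
  obtain ⟨p, -, rfl⟩ := Multiset.mem_map.1 hA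
  exact hess_posSemidef p.2.1 p.2.2.1 x

lemma mv_nonneg {s : Multiset (ConvexBody (En n))} (hs : s.card = n) : 0 ≤ mv s := by
  obtain ⟨t, rfl⟩ := exists_map_potBody s
  rw [(mv_map_potBody t).2]
  exact mul_nonneg (by positivity)
    (integral_nonneg fun x => pol_potHess_nonneg (by simpa using hs) x)

lemma mv_add_cons {s : Multiset (ConvexBody (En n))} (hs : s.card + 1 = n)
    (K L : ConvexBody (En n)) : mv ((K + L) ::ₘ s) = mv (K ::ₘ s) + mv (L ::ₘ s) := by
  rw [mv, mv, mv, finDeg_vol.pol_add_cons hs.symm]; ring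

lemma mv_mono_cons {s : Multiset (ConvexBody (En n))} (hs : s.card + 1 = n)
    {K L : ConvexBody (En n)} (h : K ≤ L) : mv (K ::ₘ s) ≤ mv (L ::ₘ s) := by
  obtain ⟨t, rfl⟩ := exists_map_potBody s
  rw [Multiset.card_map] at hs
  have e : mv (K ::ₘ t.map (potBody n)) = mv ((pot K ::ₘ t).map (potBody n)) := by
    rw [Multiset.map_cons, potBody_pot]
  obtain ⟨hi, hv⟩ := mv_map_potBody (pot K ::ₘ t)
  have hl : Tendsto (fun m : ℕ => ∫ x in ball (0 : En n) m,
      pol Matrix.det ((pot K ::ₘ t).map (potHess x))) atTop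
      (𝓝 (∫ x in ⋃ m : ℕ, ball (0 : En n) m, pol Matrix.det ((pot K ::ₘ t).map (potHess x)))) :=
    tendsto_setIntegral_of_monotone (fun m => measurableSet_ball)
      (fun a b hab => ball_subset_ball (by exact_mod_cast hab)) hi.integrableOn
  rw [iUnion_ball_nat, setIntegral_univ] at hl
  rw [e, hv]
  refine le_of_tendsto (hl.const_mul _) (Eventually.of_forall fun m => ?_)
  obtain ⟨A, hA, hKA⟩ := exists_abs_supp_le K
  obtain ⟨B, hB, hLB⟩ := exists_abs_supp_le L
  set R : ℝ := (A + B) * (m + 2) with hRdef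
  have hR : 0 ≤ R := by positivity
  set f : En n → ℝ := fun x => max (supp K x) (supp L x - R) with hf
  have hfc : ConvexOn ℝ Set.univ f := by
    refine (convexOn_supp K).sup ?_
    exact (convexOn_supp L).add_const (-R) |>.congr fun x _ => by simp [sub_eq_add_neg]
  have hfb : ∀ x, |f x - supp L x| ≤ R := fun x => by
    have h1 := supp_mono h x
    rw [abs_le]
    constructor
    · have := le_max_right (supp K x) (supp L x - R)
      simp only [hf]; linarith
    · simp only [hf]
      have : max (supp K x) (supp L x - R) ≤ supp L x := max_le h1 (by linarith)
      linarith
  let q : pots n := ⟨(L, smooth f), smooth_mem_pots hfc hfb⟩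
  have e' : mv (L ::ₘ t.map (potBody n)) = mv ((q ::ₘ t).map (potBody n)) := by
    rw [Multiset.map_cons]; rfl
  obtain ⟨hi', hv'⟩ := mv_map_potBody (q ::ₘ t)
  rw [e', hv']
  refine mul_le_mul_of_nonneg_left ?_ (by positivity)
  have hagree : ∀ x ∈ ball (0 : En n) m, pol Matrix.det ((pot K ::ₘ t).map (potHess x)) =
      pol Matrix.det ((q ::ₘ t).map (potHess x)) := by
    intro x hx
    rw [Multiset.map_cons, Multiset.map_cons]
    have : potHess x (pot K) = potHess x q := by
      refine hess_congr ?_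
      filter_upwards [isOpen_ball.mem_nhds hx] with y hy
      refine smooth_congr fun u hu => ?_
      have hy' : ‖y - u‖ ≤ m + 2 := by
        have := norm_sub_le y u
        have h3 : ‖y‖ < m := by simpa using hy
        linarith
      have h4 := abs_le.1 (hKA (y - u))
      have h5 := abs_le.1 (hLB (y - u))
      refine (max_eq_left ?_).symm
      have : (A + B) * ‖y - u‖ ≤ R := mul_le_mul_of_nonneg_left hy' (by positivity)
      linarith
    rw [this]
  rw [setIntegral_congr_fun measurableSet_ball hagree]
  exact setIntegral_le_integral hi' (Eventually.of_forall fun x =>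
    pol_potHess_nonneg (by simpa using hs) x)

lemma tendsto_mv {ι α : Type*} {l : Filter α} {f : α → ι → ConvexBody (En n)}
    {g : ι → ConvexBody (En n)} (s : Multiset ι)
    (h : ∀ i, Tendsto (fun a => f a i) l (𝓝 (g i))) :
    Tendsto (fun a => mv (s.map (f a))) l (𝓝 (mv (s.map g))) := by
  suffices H : ∀ (x : α → ConvexBody (En n)) (y : ConvexBody (En n)), Tendsto x l (𝓝 y) →
      Tendsto (fun a => pol (fun z => vol (x a + z)) (s.map (f a))) l
        (𝓝 (pol (fun z => vol (y + z)) (s.map g))) by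
    have := H (fun _ => 0) 0 tendsto_const_nhds
    simp only [zero_add] at this
    exact this.const_mul _
  induction s using Multiset.induction_on with
  | empty =>
    intro x y hx
    simp only [Multiset.map_zero, pol_zero, add_zero]
    exact (continuous_vol.tendsto y).comp hx
  | cons i s ih =>
    intro x y hx
    simp only [Multiset.map_cons, pol_cons, ← add_assoc]
    exact (ih _ _ (hx.add (h i))).sub (ih x y hx)

lemma mul_of_additive_nonneg {g : ℝ → ℝ} (hg : ∀ a b, 0 ≤ a → 0 ≤ b → g (a + b) = g a + g b)
    (h0 : ∀ a, 0 ≤ a → 0 ≤ g a) {c : ℝ} (hc : 0 ≤ c) : g c = c * g 1 := by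
  have hmono : ∀ a b, 0 ≤ a → a ≤ b → g a ≤ g b := fun a b ha hab => by
    have := hg a (b - a) ha (by linarith)
    rw [add_sub_cancel] at this
    linarith [h0 (b - a) (by linarith)]
  have hg0 : g 0 = 0 := by have := hg 0 0 le_rfl le_rfl; rw [add_zero] at this; linarith
  have hnat : ∀ (k : ℕ) (a : ℝ), 0 ≤ a → g (k * a) = k * g a := by
    intro k a ha
    induction k with
    | zero => simp [hg0]
    | succ k ih =>
      rw [Nat.cast_succ, add_mul, one_mul, hg _ _ (by positivity) ha, ih]; ring
  have hg1 := h0 1 zero_le_one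
  have key : ∀ k : ℕ, |(k : ℝ) * (g c - c * g 1)| ≤ g 1 := by
    intro k
    have hkc : 0 ≤ (k : ℝ) * c := by positivity
    set m := ⌊(k : ℝ) * c⌋₊
    have h1 : (m : ℝ) ≤ k * c := Nat.floor_le hkc
    have h2 : (k : ℝ) * c ≤ m + 1 := (Nat.lt_floor_add_one _).le
    have h3 := hmono _ _ (by positivity) h1
    have h4 := hmono _ _ hkc h2
    have h5 := hnat m 1 zero_le_one
    have h6 := hnat (m + 1) 1 zero_le_one
    push_cast at h6
    rw [mul_one] at h5 h6
    rw [hnat k c hc] at h3 h4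
    rw [abs_le]
    constructor <;> nlinarith
  by_contra hne
  have hpos : 0 < |g c - c * g 1| := abs_pos.2 (sub_ne_zero.2 hne)
  obtain ⟨k, hk⟩ := exists_nat_gt (g 1 / |g c - c * g 1|)
  have := key k
  rw [abs_mul, Nat.abs_cast] at this
  rw [div_lt_iff₀ hpos] at hk
  linarith

lemma mv_smul_cons {s : Multiset (ConvexBody (En n))} (hs : s.card + 1 = n) {c : ℝ} (hc : 0 ≤ c)
    (K : ConvexBody (En n)) : mv (c • K ::ₘ s) = c * mv (K ::ₘ s) := by
  have := mul_of_additive_nonneg (g := fun c => mv (c • K ::ₘ s))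
    (fun a b ha hb => by simp only [add_smul_body ha hb, mv_add_cons hs])
    (fun a _ => mv_nonneg (by simpa using hs)) hc
  simpa only [one_smul] using this

/-! ### Brunn–Minkowski -/

lemma volume_add_le_one {A B C : Set ℝ} (hA : MeasurableSet A) (hB : MeasurableSet B)
    (hA' : A.Nonempty) (hB' : B.Nonempty) (h : ∀ x ∈ A, ∀ y ∈ B, x + y ∈ C) :
    volume A + volume B ≤ volume C := by
  have key : ∀ K ⊆ A, IsCompact K → ∀ L ⊆ B, IsCompact L → K.Nonempty → L.Nonempty →
      volume K + volume L ≤ volume C := by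
    intro K hKA hK L hLB hL hK' hL'
    obtain ⟨k, hk, hkm⟩ := hK.exists_isGreatest hK'
    obtain ⟨l, hl, hlm⟩ := hL.exists_isLeast hL'
    have h1 : volume K = volume ((fun x => x + l) '' K) := by simp
    have h2 : volume L = volume ((fun x => k + x) '' L) := by simp
    have hLm : MeasurableSet ((fun x => k + x) '' L) :=
      (hL.image (continuous_const.add continuous_id)).measurableSet
    have hdisj : AEDisjoint volume ((fun x => x + l) '' K) ((fun x => k + x) '' L) := by
      refine measure_mono_null (t := {k + l}) ?_ (by simp)
      rintro _ ⟨⟨x, hx, rfl⟩, y, hy, e⟩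
      have := hkm hx
      have := hlm hy
      simp only at e
      simp only [Set.mem_singleton_iff]
      linarith
    rw [h1, h2, ← measure_union₀ hLm.nullMeasurableSet hdisj]
    refine measure_mono (Set.union_subset ?_ ?_)
    · rintro _ ⟨x, hx, rfl⟩; exact h x (hKA hx) l (hLB hl)
    · rintro _ ⟨y, hy, rfl⟩; exact h k (hKA hk) y (hLB hy)
  obtain ⟨a, ha⟩ := hA'
  obtain ⟨b, hb⟩ := hB'
  rw [hA.measure_eq_iSup_isCompact, hB.measure_eq_iSup_isCompact]
  simp only [iSup_and']
  refine ENNReal.biSup_add_biSup_le' ⟨∅, by simp⟩ ⟨∅, by simp⟩ fun K hK L hL => ?_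
  exact (add_le_add (measure_mono (Set.subset_insert a K))
    (measure_mono (Set.subset_insert b L))).trans
    (key _ (Set.insert_subset ha hK.1) (hK.2.insert a) _ (Set.insert_subset hb hL.1) (hL.2.insert b)
      (Set.insert_nonempty _ _) (Set.insert_nonempty _ _))

lemma lintegral_layer {α : Type*} [MeasurableSpace α] {μ : Measure α} [SFinite μ]
    {f : α → ENNReal} (hf : Measurable f) :
    ∫⁻ x, f x ∂μ = ∫⁻ t in Set.Ioi (0 : ℝ), μ {x | ENNReal.ofReal t < f x} := by
  have h1 : ∀ c : ENNReal, ∫⁻ t in Set.Ioi (0 : ℝ),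
      (if ENNReal.ofReal t < c then 1 else 0 : ENNReal) = c := by
    intro c
    have : (fun t : ℝ => (if ENNReal.ofReal t < c then 1 else 0 : ENNReal)) =
        Set.indicator {t | ENNReal.ofReal t < c} 1 := by
      ext t; simp [Set.indicator_apply]
    have hm : MeasurableSet {t : ℝ | ENNReal.ofReal t < c} :=
      (isOpen_lt ENNReal.continuous_ofReal continuous_const).measurableSet
    rw [this, lintegral_indicator_one hm, Measure.restrict_apply hm]
    rcases eq_or_ne c ⊤ with rfl | hc
    · simp
    · have : {t : ℝ | ENNReal.ofReal t < c} ∩ Set.Ioi 0 = Set.Ioo 0 c.toReal := by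
        ext t
        simp only [Set.mem_inter_iff, Set.mem_ofPred_eq, Set.mem_Ioi, Set.mem_Ioo]
        constructor
        · rintro ⟨h, h0⟩
          exact ⟨h0, (ENNReal.ofReal_lt_iff_lt_toReal h0.le hc).1 h⟩
        · rintro ⟨h0, h⟩
          exact ⟨(ENNReal.ofReal_lt_iff_lt_toReal h0.le hc).2 h, h0⟩
      rw [this, Real.volume_Ioo, sub_zero, ENNReal.ofReal_toReal hc]
  have hm : MeasurableSet {p : α × ℝ | ENNReal.ofReal p.2 < f p.1} :=
    measurableSet_lt (ENNReal.measurable_ofReal.comp measurable_snd) (hf.comp measurable_fst)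
  calc ∫⁻ x, f x ∂μ = ∫⁻ x, (∫⁻ t in Set.Ioi (0 : ℝ),
        (if ENNReal.ofReal t < f x then 1 else 0 : ENNReal)) ∂μ := by simp only [h1]
    _ = ∫⁻ t in Set.Ioi (0 : ℝ),
        (∫⁻ x, (if ENNReal.ofReal t < f x then 1 else 0 : ENNReal) ∂μ) :=
        lintegral_lintegral_swap
          (Measurable.ite hm measurable_const measurable_const).aemeasurable
    _ = _ := by
        refine lintegral_congr fun t => ?_
        have hmt : MeasurableSet {x | ENNReal.ofReal t < f x} :=
          measurableSet_lt measurable_const hf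
        rw [← lintegral_indicator_one hmt]
        refine lintegral_congr fun x => ?_
        simp [Set.indicator_apply]

lemma four_mul_le_sq_add (a b : ENNReal) : 4 * (a * b) ≤ (a + b) ^ 2 := by
  rcases eq_or_ne a ⊤ with rfl | ha
  · simp
  rcases eq_or_ne b ⊤ with rfl | hb
  · simp
  lift a to NNReal using ha
  lift b to NNReal using hb
  norm_cast
  rw [← NNReal.coe_le_coe]
  push_cast
  nlinarith [sq_nonneg ((a : ℝ) - b)]

lemma prekopa_normalized {f g h : ℝ → ENNReal} (hf : Measurable f) (hg : Measurable g)
    (hh : Measurable h) (hf1 : ⨆ x, f x = 1) (hg1 : ⨆ x, g x = 1)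
    (hfg : ∀ x y, f x * g y ≤ h (x + y) ^ 2) : 4 * ((∫⁻ x, f x) * ∫⁻ x, g x) ≤ (∫⁻ x, h x) ^ 2 := by
  refine (four_mul_le_sq_add _ _).trans (pow_le_pow_left₀ zero_le ?_ 2)
  rw [lintegral_layer hf, lintegral_layer hg, lintegral_layer hh]
  have hmono : Measurable fun t : ℝ => volume {x | ENNReal.ofReal t < g x} := by
    refine Antitone.measurable fun s t hst => measure_mono fun x hx => ?_
    exact (ENNReal.ofReal_le_ofReal hst).trans_lt hx
  rw [← lintegral_add_right _ hmono]
  refine setLIntegral_mono' measurableSet_Ioi fun t ht => ?_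
  rcases lt_or_ge (ENNReal.ofReal t) 1 with h1 | h1
  · refine volume_add_le_one (measurableSet_lt measurable_const hf)
      (measurableSet_lt measurable_const hg) ?_ ?_ ?_
    · exact lt_iSup_iff.1 (hf1 ▸ h1)
    · exact lt_iSup_iff.1 (hg1 ▸ h1)
    · intro x hx y hy
      by_contra hc
      have hc : h (x + y) ≤ ENNReal.ofReal t := not_lt.1 hc
      have h2 := (hfg x y).trans (pow_le_pow_left₀ zero_le hc 2)
      rw [sq] at h2
      exact h2.not_gt (ENNReal.mul_lt_mul hx hy)
  · have e1 : {x | ENNReal.ofReal t < f x} = ∅ := by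
      ext x; simpa using ((le_iSup f x).trans hf1.le).trans h1
    have e2 : {x | ENNReal.ofReal t < g x} = ∅ := by
      ext x; simpa using ((le_iSup g x).trans hg1.le).trans h1
    simp [e1, e2]

lemma prekopa_bounded {f g h : ℝ → ENNReal} (hf : Measurable f) (hg : Measurable g)
    (hh : Measurable h) (hf1 : ⨆ x, f x ≠ ⊤) (hg1 : ⨆ x, g x ≠ ⊤)
    (hfg : ∀ x y, f x * g y ≤ h (x + y) ^ 2) : 4 * ((∫⁻ x, f x) * ∫⁻ x, g x) ≤ (∫⁻ x, h x) ^ 2 := by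
  set a := ⨆ x, f x with ha
  set b := ⨆ x, g x with hb
  rcases eq_or_ne a 0 with h0 | ha0
  · have : ∀ x, f x = 0 := fun x => le_antisymm ((le_iSup f x).trans (ha ▸ h0).le) zero_le
    simp [this]
  rcases eq_or_ne b 0 with h0 | hb0
  · have : ∀ x, g x = 0 := fun x => le_antisymm ((le_iSup g x).trans (hb ▸ h0).le) zero_le
    simp [this]
  set c : ENNReal := (a⁻¹ * b⁻¹) ^ (1 / 2 : ℝ) with hc
  have hc2 : c ^ 2 = a⁻¹ * b⁻¹ := by
    rw [hc, ← ENNReal.rpow_natCast, ← ENNReal.rpow_mul]; norm_num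
  have := prekopa_normalized (f := fun x => a⁻¹ * f x) (g := fun x => b⁻¹ * g x)
    (h := fun x => c * h x) (hf.const_mul _) (hg.const_mul _) (hh.const_mul _)
    (by rw [← ENNReal.mul_iSup, ← ha, ENNReal.inv_mul_cancel ha0 hf1])
    (by rw [← ENNReal.mul_iSup, ← hb, ENNReal.inv_mul_cancel hb0 hg1])
    (fun x y => by
      rw [mul_pow, hc2]
      calc a⁻¹ * f x * (b⁻¹ * g y) = a⁻¹ * b⁻¹ * (f x * g y) := by ring
        _ ≤ _ := by gcongr; exact hfg x y)
  rw [lintegral_const_mul _ hf, lintegral_const_mul _ hg, lintegral_const_mul _ hh, mul_pow,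
    hc2] at this
  have h2 : a * b * (4 * (a⁻¹ * (∫⁻ x, f x) * (b⁻¹ * ∫⁻ x, g x))) ≤
      a * b * (a⁻¹ * b⁻¹ * (∫⁻ x, h x) ^ 2) := by gcongr
  have e : ∀ y, a * b * (a⁻¹ * b⁻¹ * y) = y := fun y => by
    calc a * b * (a⁻¹ * b⁻¹ * y) = (a * a⁻¹) * (b * b⁻¹) * y := by ring
      _ = y := by rw [ENNReal.mul_inv_cancel ha0 hf1, ENNReal.mul_inv_cancel hb0 hg1]; simp
  rw [e] at h2
  calc _ = a * b * (a⁻¹ * b⁻¹ * (4 * ((∫⁻ x, f x) * ∫⁻ x, g x))) := (e _).symm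
    _ = a * b * (4 * (a⁻¹ * (∫⁻ x, f x) * (b⁻¹ * ∫⁻ x, g x))) := by ring
    _ ≤ _ := h2

lemma prekopa_one {f g h : ℝ → ENNReal} (hf : Measurable f) (hg : Measurable g)
    (hh : Measurable h) (hfg : ∀ x y, f x * g y ≤ h (x + y) ^ 2) :
    4 * ((∫⁻ x, f x) * ∫⁻ x, g x) ≤ (∫⁻ x, h x) ^ 2 := by
  have hsup : ∀ c : ENNReal, ⨆ k : ℕ, min c k = c := by
    intro c
    rw [← inf_iSup_eq, ENNReal.iSup_natCast, inf_top_eq]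
  have hm : ∀ {f : ℝ → ENNReal}, Measurable f → ∫⁻ x, f x = ⨆ k : ℕ, ∫⁻ x, min (f x) k := by
    intro f hf
    rw [← lintegral_iSup (fun k => hf.min measurable_const)
      (fun a b hab x => min_le_min le_rfl (by exact_mod_cast hab))]
    simp only [hsup]
  rw [hm hf, hm hg]
  simp only [ENNReal.iSup_mul, ENNReal.mul_iSup]
  refine iSup_le fun j => iSup_le fun k => ?_
  refine prekopa_bounded (hf.min measurable_const) (hg.min measurable_const) hh ?_ ?_ fun x y =>
    (mul_le_mul' (min_le_left _ _) (min_le_left _ _)).trans (hfg x y)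
  · exact ((iSup_le fun x => min_le_right _ _).trans_lt (ENNReal.natCast_lt_top _)).ne
  · exact ((iSup_le fun x => min_le_right _ _).trans_lt (ENNReal.natCast_lt_top _)).ne

lemma prekopa (d : ℕ) {f g h : (Fin d → ℝ) → ENNReal} (hf : Measurable f) (hg : Measurable g)
    (hh : Measurable h) (hfg : ∀ x y, f x * g y ≤ h (x + y) ^ 2) :
    4 ^ d * ((∫⁻ x, f x) * ∫⁻ x, g x) ≤ (∫⁻ x, h x) ^ 2 := by
  induction d with
  | zero =>
    have e : ∀ f : (Fin 0 → ℝ) → ENNReal, ∫⁻ x, f x = f 0 := fun f => by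
      rw [lintegral_unique]
      simp [Measure.volume_pi_eq_dirac 0]
      rfl
    rw [e, e, e]
    simpa using hfg 0 0
  | succ d ih =>
    have e : ∀ {f : (Fin (d + 1) → ℝ) → ENNReal}, Measurable f →
        ∫⁻ x, f x = ∫⁻ s : ℝ, ∫⁻ y : Fin d → ℝ, f (Fin.cons s y) := fun {f} hf => by
      have h1 := (volume_preserving_piFinSuccAbove (fun _ : Fin (d + 1) => ℝ) 0).symm
      rw [← h1.lintegral_comp hf, Measure.volume_eq_prod, lintegral_prod (fun p => f _)
        (hf.comp (MeasurableEquiv.measurable _)).aemeasurable]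
      simp [MeasurableEquiv.piFinSuccAbove, Fin.insertNthEquiv]
    have hc : Measurable fun p : ℝ × (Fin d → ℝ) => (Fin.cons p.1 p.2 : Fin (d + 1) → ℝ) := by
      have := (MeasurableEquiv.piFinSuccAbove (fun _ : Fin (d + 1) => ℝ) 0).symm.measurable
      simpa [MeasurableEquiv.piFinSuccAbove, Fin.insertNthEquiv] using this
    have hms : ∀ {f : (Fin (d + 1) → ℝ) → ENNReal}, Measurable f → ∀ s : ℝ,
        Measurable fun y : Fin d → ℝ => f (Fin.cons s y) :=
      fun {f} hf s => hf.comp (hc.comp measurable_prodMk_left)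
    have hmi : ∀ {f : (Fin (d + 1) → ℝ) → ENNReal}, Measurable f →
        Measurable fun s : ℝ => ∫⁻ y : Fin d → ℝ, f (Fin.cons s y) :=
      fun {f} hf => (hf.comp hc).lintegral_prod_right'
    rw [e hf, e hg, e hh]
    have := prekopa_one (f := fun s => 4 ^ d * ∫⁻ y : Fin d → ℝ, f (Fin.cons s y))
      ((hmi hf).const_mul _) (hmi hg) (hmi hh) fun s t => by
        rw [mul_assoc]
        refine ih (hms hf s) (hms hg t) (hms hh _) fun x y => ?_
        refine (hfg _ _).trans_eq ?_
        congr 2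
        ext i
        refine Fin.cases ?_ (fun i => ?_) i <;> simp
    rw [lintegral_const_mul _ (hmi hf)] at this
    rw [pow_succ]
    refine le_trans (le_of_eq ?_) this
    ring

lemma vol_mul_vol_le (A B : ConvexBody (En n)) : 4 ^ n * (vol A * vol B) ≤ vol (A + B) ^ 2 := by
  have key : ∀ K : ConvexBody (En n), ∫⁻ x : Fin n → ℝ,
      Set.indicator ((WithLp.toLp 2) ⁻¹' (K : Set (En n))) 1 x = volume (K : Set (En n)) := by
    intro K
    have hm : MeasurableSet ((WithLp.toLp 2 : (Fin n → ℝ) → En n) ⁻¹' (K : Set (En n))) :=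
      (MeasurableEquiv.toLp 2 (Fin n → ℝ)).measurable (measurableSet_body K)
    rw [lintegral_indicator_one hm]
    exact (EuclideanSpace.volume_preserving_symm_measurableEquiv_toLp (Fin n)).symm.measure_preimage
      (measurableSet_body K).nullMeasurableSet
  have hm : ∀ K : ConvexBody (En n), Measurable (Set.indicator
      ((WithLp.toLp 2 : (Fin n → ℝ) → En n) ⁻¹' (K : Set (En n))) (1 : (Fin n → ℝ) → ENNReal)) :=
    fun K => measurable_one.indicator
      ((MeasurableEquiv.toLp 2 (Fin n → ℝ)).measurable (measurableSet_body K))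
  have := prekopa n (hm A) (hm B) (hm (A + B)) fun x y => by
    by_cases h1 : WithLp.toLp 2 x ∈ A
    · by_cases h2 : WithLp.toLp 2 y ∈ B
      · have h3 : WithLp.toLp 2 (x + y) ∈ A + B := mem_add_iff.2 ⟨_, h1, _, h2, rfl⟩
        rw [Set.indicator_of_mem (show x ∈ WithLp.toLp 2 ⁻¹' (A : Set (En n)) from h1),
          Set.indicator_of_mem (show y ∈ WithLp.toLp 2 ⁻¹' (B : Set (En n)) from h2),
          Set.indicator_of_mem (show x + y ∈ WithLp.toLp 2
            ⁻¹' ((A + B : ConvexBody (En n)) : Set (En n)) from h3)]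
        simp
      · simp [h2]
    · simp [h1]
  rw [key, key, key] at this
  have h2 := ENNReal.toReal_mono (by finiteness [volume_ne_top (A + B)]) this
  simpa [vol, ENNReal.toReal_mul, ENNReal.toReal_pow] using h2

/-! ### Mixed volumes of segments -/

lemma mv_zero_cons (s : Multiset (ConvexBody (En n))) : mv (0 ::ₘ s) = 0 := by
  rw [mv, pol_zero_cons, mul_zero]

lemma mv_point_add_cons {s : Multiset (ConvexBody (En n))} (hs : s.card + 1 = n) (x : En n)
    (K : ConvexBody (En n)) : mv ((point x + K) ::ₘ s) = mv (K ::ₘ s) := by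
  rw [mv_add_cons hs, mv_point_cons, zero_add]

lemma mv_mono_rel {s t : Multiset (ConvexBody (En n))} (h : Multiset.Rel (· ≤ ·) s t)
    (u : Multiset (ConvexBody (En n))) (hs : (s + u).card = n) : mv (s + u) ≤ mv (t + u) := by
  induction h generalizing u with
  | zero => rfl
  | @cons a b s t hab hst ih =>
    rw [Multiset.cons_add, Multiset.cons_add]
    rw [Multiset.cons_add, Multiset.card_cons] at hs
    refine (mv_mono_cons hs hab).trans ?_
    have := ih (b ::ₘ u) (by simp at hs ⊢; omega)
    rwa [Multiset.add_cons, Multiset.add_cons] at this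

/-- A body containing the origin and every member of a given finite family. -/
lemma exists_common_bound (s : Multiset (ConvexBody (En n))) :
    ∃ C : ConvexBody (En n), 0 ∈ C ∧ ∀ K ∈ s, K ≤ C := by
  induction s using Multiset.induction_on with
  | empty => exact ⟨0, by simp [← SetLike.mem_coe], by simp⟩
  | cons K s ih =>
    obtain ⟨C, h0, hC⟩ := ih
    obtain ⟨R, hR, hK⟩ := exists_abs_supp_le K
    have h0B : ∀ r : ℝ, 0 ≤ r → (0 : En n) ∈ r • ballB n := fun r hr => by
      rw [mem_scale_ballB hr]; simpa
    refine ⟨C + R • ballB n, mem_add_iff.2 ⟨0, h0, 0, h0B R hR.le, by simp⟩, fun L hL => ?_⟩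
    rcases Multiset.mem_cons.1 hL with rfl | hL
    · refine fun x hx => mem_add_iff.2 ⟨0, h0, x, ?_, by simp⟩
      rw [mem_scale_ballB hR.le]
      have h1 := inner_le_supp hx x
      rw [real_inner_self_eq_norm_sq] at h1
      have h2 := (le_abs_self _).trans (hK x)
      by_contra hc
      push Not at hc
      have : 0 < ‖x‖ := hR.trans hc
      nlinarith
    · exact fun x hx => mem_add_iff.2 ⟨x, hC L hL hx, 0, h0B R hR.le, by simp⟩

lemma mv_le_replicate {s u : Multiset (ConvexBody (En n))} {C : ConvexBody (En n)}
    (hC : ∀ K ∈ s, K ≤ C) (hs : (s + u).card = n) :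
    mv (s + u) ≤ mv (Multiset.replicate s.card C + u) := by
  refine mv_mono_rel ?_ u hs
  rw [Multiset.rel_replicate_right]
  exact ⟨rfl, hC⟩

lemma zero_smul_body (K : ConvexBody (En n)) : (0 : ℝ) • K = 0 :=
  eq_of_supp_eq fun x => by
    rw [supp_smul le_rfl, zero_mul, show (0 : ConvexBody (En n)) = point 0 from rfl, supp_point,
      inner_zero_right]

lemma vol_add_smul_seg_le (C : ConvexBody (En n)) (v : En n) (N : ℕ) :
    vol (C + (N : ℝ) • seg v) ≤ N * vol (C + seg v) + vol C := by
  induction N with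
  | zero => rw [Nat.cast_zero, zero_smul_body, add_zero]; simp
  | succ N ih =>
    have hsub : ((C + ((N + 1 : ℕ) : ℝ) • seg v : ConvexBody (En n)) : Set (En n)) ⊆
        (C + (N : ℝ) • seg v : ConvexBody (En n)) ∪
          (point ((N : ℝ) • v) + (C + seg v) : ConvexBody (En n)) := by
      intro x hx
      obtain ⟨c, hc, y, hy, rfl⟩ := mem_add_iff.1 hx
      obtain ⟨z, hz, rfl⟩ := mem_smul_iff.1 hy
      obtain ⟨t, ⟨ht0, ht1⟩, rfl⟩ := mem_seg.1 hz
      rcases le_total (((N + 1 : ℕ) : ℝ) * t) N with h | h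
      · left
        rcases N.eq_zero_or_pos with rfl | hN
        · have : t = 0 := le_antisymm (by simpa using h) ht0
          refine mem_add_iff.2 ⟨c, hc, 0,
            mem_smul_iff.2 ⟨0, zero_mem_seg v, by simp⟩, by simp [this]⟩
        · have hN' : (0 : ℝ) < N := by exact_mod_cast hN
          refine mem_add_iff.2 ⟨c, hc, _, mem_smul_iff.2
            ⟨((((N + 1 : ℕ) : ℝ) * t) / N) • v, mem_seg.2 ⟨_, ⟨by positivity, by
              rw [div_le_one hN']; exact h⟩, rfl⟩, rfl⟩, ?_⟩
          rw [smul_smul, smul_smul, mul_div_cancel₀ _ hN'.ne']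
      · right
        refine mem_add_iff.2 ⟨_, mem_point.2 rfl, c + (((N + 1 : ℕ) : ℝ) * t - N) • v,
          mem_add_iff.2 ⟨c, hc, _, mem_seg.2 ⟨_, ⟨by linarith, ?_⟩, rfl⟩, rfl⟩, ?_⟩
        · push_cast at h ⊢
          nlinarith
        · module
    have h1 : vol (C + ((N + 1 : ℕ) : ℝ) • seg v) ≤
        vol (C + (N : ℝ) • seg v) + vol (point ((N : ℝ) • v) + (C + seg v)) := by
      unfold vol
      rw [← ENNReal.toReal_add (volume_ne_top _) (volume_ne_top _)]
      exact ENNReal.toReal_mono (ENNReal.add_ne_top.2 ⟨volume_ne_top _, volume_ne_top _⟩)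
        ((measure_mono hsub).trans (measure_union_le _ _))
    rw [vol_add_point] at h1
    push_cast at h1 ⊢
    linarith

lemma mv_seg_seg (v : En n) {s : Multiset (ConvexBody (En n))} (hs : s.card + 2 = n) :
    mv (seg v ::ₘ seg v ::ₘ s) = 0 := by
  refine le_antisymm ?_ (mv_nonneg (by simp; omega))
  obtain ⟨C, h0, hC⟩ := exists_common_bound s
  have h1 : ∀ N : ℕ, (N : ℝ) * (N * mv (seg v ::ₘ seg v ::ₘ s)) ≤ N * vol (C + seg v) + vol C := by
    intro N
    have hN : (0 : ℝ) ≤ N := N.cast_nonneg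
    rw [← mv_smul_cons (by simp; omega) hN, Multiset.cons_swap, ← mv_smul_cons (by simp; omega) hN]
    refine le_trans ?_ (vol_add_smul_seg_le C v N)
    have h0S : (0 : En n) ∈ (N : ℝ) • seg v := mem_smul_iff.2 ⟨0, zero_mem_seg v, by simp⟩
    have := mv_le_replicate (s := (N : ℝ) • seg v ::ₘ (N : ℝ) • seg v ::ₘ s) (u := 0)
      (C := C + (N : ℝ) • seg v) (by
        intro K hK
        have hS : (N : ℝ) • seg v ≤ C + (N : ℝ) • seg v :=
          fun x hx => mem_add_iff.2 ⟨0, h0, x, hx, by simp⟩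
        simp only [Multiset.mem_cons] at hK
        rcases hK with rfl | rfl | hK
        · exact hS
        · exact hS
        · exact fun x hx => mem_add_iff.2 ⟨x, hC K hK hx, 0, h0S, by simp⟩) (by simp; omega)
    rw [add_zero, add_zero, show Multiset.card _ = n by simp; omega, mv_replicate] at this
    exact this
  by_contra hc
  push Not at hc
  set c := mv (seg v ::ₘ seg v ::ₘ s)
  have hV := vol_nonneg (C + seg v)
  have hV' := vol_nonneg C
  obtain ⟨N, hN⟩ := exists_nat_gt ((vol (C + seg v) + vol C) / c + 1)
  have h2 := h1 N
  have h3 : vol (C + seg v) + vol C < (N - 1) * c := by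
    rw [← div_lt_iff₀ hc]; linarith
  have h4 : (1 : ℝ) ≤ N := by
    have : 0 ≤ (vol (C + seg v) + vol C) / c := by positivity
    linarith
  nlinarith

lemma mv_replicate_add_seg (K : ConvexBody (En n)) (v : En n) (m : ℕ)
    {s : Multiset (ConvexBody (En n))} (hs : m + s.card = n) {c : ℝ} (hc : 0 ≤ c) :
    mv (Multiset.replicate m (K + c • seg v) + s) = mv (Multiset.replicate m K + s) +
      m * (c * mv (seg v ::ₘ (Multiset.replicate (m - 1) K + s))) := by
  induction m generalizing s with
  | zero => simp
  | succ m ih =>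
    rw [Multiset.replicate_succ, Multiset.cons_add, mv_add_cons (by simp; omega),
      mv_smul_cons (by simp; omega) hc, ← Multiset.add_cons, ← Multiset.add_cons,
      ih (by simp; omega), ih (by simp; omega)]
    rcases m with _ | m
    · simp [Multiset.replicate_succ]
    · simp only [Nat.add_sub_cancel, Multiset.replicate_succ (n := m + 1), Multiset.add_cons,
        Multiset.cons_add]
      rw [mv_seg_seg v (by simp; omega)]
      simp only [Multiset.replicate_succ, Multiset.cons_add]
      rw [Multiset.cons_swap (seg v) K]
      push_cast
      ring

/-- The segments `[0, w]` for `w` in a list. -/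
def segs (ws : List (En n)) : Multiset (ConvexBody (En n)) := (ws.map seg : List _)

/-- The sum of the segments `[0, w]` for `w` in a list. -/
def zono (ws : List (En n)) : ConvexBody (En n) := (ws.map seg).sum

/-- The span of a list of vectors. -/
def wspan : List (En n) → Submodule ℝ (En n)
  | [] => ⊥
  | w :: ws => wspan ws ⊔ Submodule.span ℝ {w}

/-- Linear independence of a list of vectors. -/
def Indep : List (En n) → Prop
  | [] => True
  | w :: ws => w ∉ wspan ws ∧ Indep ws

lemma segs_nil : segs ([] : List (En n)) = 0 := rfl

lemma segs_cons (w : En n) (ws : List (En n)) : segs (w :: ws) = seg w ::ₘ segs ws := rfl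

lemma card_segs (ws : List (En n)) : (segs ws).card = ws.length := by simp [segs]

lemma zono_cons (w : En n) (ws : List (En n)) : zono (w :: ws) = seg w + zono ws := by
  simp [zono]

lemma mv_replicate_zono_eq_zero (ws : List (En n)) {m : ℕ} (hm : ws.length < m)
    (u : Multiset (ConvexBody (En n))) (hu : m + u.card = n) :
    mv (Multiset.replicate m (zono ws) + u) = 0 := by
  induction ws generalizing m u with
  | nil =>
    obtain ⟨m, rfl⟩ := Nat.exists_eq_succ_of_ne_zero (Nat.ne_of_gt hm)
    rw [Multiset.replicate_succ, Multiset.cons_add]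
    exact mv_zero_cons _
  | cons w ws ih =>
    rw [List.length_cons] at hm
    have h := mv_replicate_add_seg (zono ws) w m hu zero_le_one
    rw [one_smul, add_comm (zono ws)] at h
    rw [zono_cons, h, ih (by omega) u hu, ← Multiset.add_cons, ih (by omega) _ (by simp; omega)]
    simp

lemma mv_replicate_zono (ws : List (En n)) (u : Multiset (ConvexBody (En n)))
    (hu : ws.length + u.card = n) :
    mv (Multiset.replicate ws.length (zono ws) + u) = ws.length.factorial * mv (segs ws + u) := by
  induction ws generalizing u with
  | nil => simp [segs_nil]
  | cons w ws ih =>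
    have h := mv_replicate_add_seg (zono ws) w (w :: ws).length hu zero_le_one
    rw [one_smul, add_comm (zono ws)] at h
    rw [List.length_cons] at hu h ⊢
    rw [zono_cons, h, mv_replicate_zono_eq_zero ws (by omega) u hu, Nat.add_sub_cancel,
      ← Multiset.add_cons, ih _ (by simp; omega), segs_cons, Multiset.add_cons, Multiset.cons_add,
      Nat.factorial_succ]
    push_cast
    ring

lemma zero_mem_zono (ws : List (En n)) : (0 : En n) ∈ zono ws := by
  induction ws with
  | nil => exact Set.mem_singleton _
  | cons w ws ih =>
    rw [zono_cons]
    exact mem_add_iff.2 ⟨0, zero_mem_seg w, 0, ih, by simp⟩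

lemma wspan_le_span_zono (ws : List (En n)) :
    wspan ws ≤ Submodule.span ℝ (zono ws : Set (En n)) := by
  induction ws with
  | nil => exact bot_le
  | cons w ws ih =>
    refine sup_le (ih.trans (Submodule.span_mono fun x hx => ?_)) (Submodule.span_mono ?_)
    · rw [zono_cons]
      exact mem_add_iff.2 ⟨0, zero_mem_seg w, x, hx, by simp⟩
    · rintro _ rfl
      rw [zono_cons]
      exact mem_add_iff.2 ⟨_, self_mem_seg _, 0, zero_mem_zono ws, by simp⟩

lemma Indep.finrank {ws : List (En n)} (h : Indep ws) :
    Module.finrank ℝ (wspan ws) = ws.length := by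
  induction ws with
  | nil => exact finrank_bot ℝ (En n)
  | cons w ws ih =>
    rw [wspan, Submodule.finrank_sup_span_singleton h.1, ih h.2, List.length_cons]

lemma Indep.interior_zono {ws : List (En n)} (h : Indep ws) (hl : ws.length = n) :
    (interior (zono ws : Set (En n))).Nonempty := by
  rw [(zono ws).convex.interior_nonempty_iff_affineSpan_eq_top]
  have h1 : wspan ws = ⊤ := Submodule.eq_top_of_finrank_eq (by rw [h.finrank, hl]; simp)
  have h2 := affineSpan_insert_zero (k := ℝ) (zono ws : Set (En n))
  rw [Set.insert_eq_of_mem (zero_mem_zono ws),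
    eq_top_iff.2 (h1.ge.trans (wspan_le_span_zono ws))] at h2
  exact SetLike.coe_injective (by rw [h2]; simp)

lemma Indep.exists_cons {ws : List (En n)} (h : Indep ws) (hl : ws.length < n) :
    ∃ w, Indep (w :: ws) := by
  have : wspan ws ≠ ⊤ := fun e => by
    have := h.finrank
    rw [e, finrank_top] at this
    simp at this
    omega
  obtain ⟨w, hw⟩ := SetLike.exists_not_mem_of_ne_top _ this rfl
  exact ⟨w, hw, h⟩

lemma exists_point_add_smul_seg_le {K : ConvexBody (En n)}
    (hK : (interior (K : Set (En n))).Nonempty) (w : En n) :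
    ∃ x, ∃ δ : ℝ, 0 < δ ∧ point x + δ • seg w ≤ K := by
  obtain ⟨x, hx⟩ := hK
  obtain ⟨r, hr, hb⟩ := Metric.isOpen_iff.1 isOpen_interior x hx
  refine ⟨x, r / (‖w‖ + 1), by positivity, fun y hy => interior_subset (hb ?_)⟩
  obtain ⟨a, ha, b, hb', rfl⟩ := mem_add_iff.1 hy
  obtain rfl := mem_point.1 ha
  obtain ⟨c, hc, rfl⟩ := mem_smul_iff.1 hb'
  obtain ⟨t, ⟨ht0, ht1⟩, rfl⟩ := mem_seg.1 hc
  rw [mem_ball, dist_eq_norm, add_sub_cancel_left, norm_smul, norm_smul, Real.norm_of_nonneg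
    (by positivity), Real.norm_of_nonneg ht0, div_mul_eq_mul_div, div_lt_iff₀ (by positivity)]
  have := norm_nonneg w
  have : t * ‖w‖ ≤ 1 * ‖w‖ := by gcongr
  nlinarith

lemma mv_pos {s : Multiset (ConvexBody (En n))} {ws : List (En n)} (hw : Indep ws)
    (hs : ∀ K ∈ s, (interior (K : Set (En n))).Nonempty) (hc : s.card + ws.length = n) :
    0 < mv (s + segs ws) := by
  induction s using Multiset.induction_on generalizing ws with
  | empty =>
    have hl : ws.length = n := by simpa using hc
    have h := mv_replicate_zono ws 0 (by simpa using hl)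
    rw [add_zero, add_zero, hl, mv_replicate] at h
    have := vol_pos (hw.interior_zono hl)
    rw [h] at this
    rw [zero_add]
    exact pos_of_mul_pos_right this (by positivity)
  | cons K s ih =>
    rw [Multiset.card_cons] at hc
    obtain ⟨w, hw'⟩ := hw.exists_cons (by omega)
    have h1 := ih hw' (fun L hL => hs L (Multiset.mem_cons_of_mem hL)) (by simp; omega)
    obtain ⟨x, δ, hδ, hle⟩ := exists_point_add_smul_seg_le (hs K (Multiset.mem_cons_self _ _)) w
    have hcard : (s + segs ws).card + 1 = n := by simp [card_segs]; omega
    have h2 := mv_mono_cons hcard hle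
    rw [mv_point_add_cons hcard, mv_smul_cons hcard hδ.le, ← Multiset.add_cons, ← segs_cons] at h2
    rw [Multiset.cons_add]
    exact (mul_pos hδ h1).trans_le h2

/-! ### Hyperbolic quadratic forms -/

section Hyperbolic

variable {E : Type*} [AddCommGroup E] [Module ℝ E]

/-- A bilinear form satisfying the reversed Cauchy–Schwarz inequality. -/
def Hyp (q : E →ₗ[ℝ] E →ₗ[ℝ] ℝ) : Prop :=
  ∀ x y, 0 ≤ q y y → q x x * q y y ≤ q x y ^ 2

variable {q q₁ q₂ : E →ₗ[ℝ] E →ₗ[ℝ] ℝ}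

lemma eq_zero_of_forall_mul_le {a b c : ℝ} (h : ∀ t : ℝ, a + t * b ≤ c) : b = 0 := by
  by_contra hb
  have := h ((c - a + 1) / b)
  rw [div_mul_cancel₀ _ hb] at this
  linarith

lemma Hyp.of_orthogonal (hq : ∀ x y, q x y = q y x) {e : E}
    (h : ∀ x, q x e = 0 → q x x ≤ 0) : Hyp q := by
  intro x y hy
  rcases hy.eq_or_lt with hy | hy
  · rw [← hy, mul_zero]; positivity
  have h1 : ∀ x, q x y = 0 → q x x ≤ 0 := by
    intro x hxy
    by_contra hx
    push Not at hx
    have h2 := h (q x e • y - q y e • x) (by simp; ring)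
    have h3 := hq y x
    simp only [map_sub, map_smul, LinearMap.sub_apply, LinearMap.smul_apply, smul_eq_mul, h3,
      hxy] at h2
    have h4 : q x e = 0 := by
      by_contra hc
      have : 0 < q x e ^ 2 := by positivity
      nlinarith [mul_pos this hy, mul_nonneg (sq_nonneg (q y e)) hx.le]
    exact (h x h4).not_gt hx
  have h2 := h1 (x - (q x y / q y y) • y) (by
    simp only [map_sub, map_smul, LinearMap.sub_apply, LinearMap.smul_apply, smul_eq_mul]
    rw [div_mul_cancel₀ _ hy.ne', sub_self])
  simp only [map_sub, map_smul, LinearMap.sub_apply, LinearMap.smul_apply, smul_eq_mul,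
    hq y x] at h2
  have e : q x x - q x y / q y y * q x y - q x y / q y y * (q x y - q x y / q y y * q y y) =
      (q x x * q y y - q x y ^ 2) / q y y := by field_simp; ring
  rw [e, div_le_iff₀ hy] at h2
  linarith

lemma Hyp.nonpos (h : Hyp q) {x e : E} (he : 0 < q e e) (hx : q x e = 0) : q x x ≤ 0 := by
  have := h x e he.le
  rw [hx] at this
  by_contra hc
  push Not at hc
  nlinarith [mul_pos hc he]

lemma Hyp.eq_zero (hq : ∀ x y, q x y = q y x) (h : Hyp q) {x e : E} (he : 0 < q e e)
    (hx : q x e = 0) (hxx : q x x = 0) (y : E) : q x y = 0 := by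
  have h1 : ∀ m, q m e = 0 → q x m = 0 := by
    intro m hm
    have h2 : ∀ t : ℝ, q m m + t * (2 * q x m) ≤ 0 := by
      intro t
      have := h.nonpos (x := m + t • x) he (by simp [hm, hx])
      simp only [map_add, map_smul, LinearMap.add_apply, LinearMap.smul_apply, smul_eq_mul, hxx,
        hq m x] at this
      linarith
    linarith [eq_zero_of_forall_mul_le h2]
  have h3 := h1 (y - (q y e / q e e) • e) (by
    simp only [map_sub, map_smul, LinearMap.sub_apply, LinearMap.smul_apply, smul_eq_mul]
    rw [div_mul_cancel₀ _ he.ne', sub_self])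
  simpa [hx] using h3

lemma Hyp.add (hq₁ : ∀ x y, q₁ x y = q₁ y x) (hq₂ : ∀ x y, q₂ x y = q₂ y x) (h₁ : Hyp q₁)
    (h₂ : Hyp q₂) {z₁ z₂ : E} (hz : ∀ x, q₁ z₂ x = q₂ z₁ x) (h11 : 0 ≤ (q₁ + q₂) z₁ z₁)
    (h12 : 0 < (q₁ + q₂) z₁ z₂) (h22 : 0 ≤ (q₁ + q₂) z₂ z₂) : Hyp (q₁ + q₂) := by
  have hq : ∀ x y, (q₁ + q₂) x y = (q₁ + q₂) y x := fun x y => by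
    simp [hq₁ x y, hq₂ x y]
  set q := q₁ + q₂ with hqdef
  have ha1 : ∀ x, q₁ x (z₁ + z₂) = q z₁ x := fun x => by
    rw [hq₁, hqdef]; simp [hz]
  have ha2 : ∀ x, q₂ x (z₁ + z₂) = q z₂ x := fun x => by
    rw [hq₂, hqdef]; simp [hz]
  set a := q z₁ z₁ with ha
  set b := q z₁ z₂ with hb
  set c := q z₂ z₂ with hc
  have hb' : q z₂ z₁ = b := hq _ _
  set w₁ := a + b with hw₁
  set w₂ := b + c with hw₂
  have hw₁' : 0 < w₁ := by linarith
  have hw₂' : 0 < w₂ := by linarith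
  have e1 : q₁ (z₁ + z₂) (z₁ + z₂) = w₁ := by rw [ha1, map_add]
  have e2 : q₂ (z₁ + z₂) (z₁ + z₂) = w₂ := by rw [ha2, map_add, hb']
  have boch : ∀ x, q x x ≤ q z₁ x ^ 2 / w₁ + q z₂ x ^ 2 / w₂ := by
    intro x
    have b1 := h₁ x (z₁ + z₂) (by rw [e1]; exact hw₁'.le)
    have b2 := h₂ x (z₁ + z₂) (by rw [e2]; exact hw₂'.le)
    rw [e1, ha1, ← le_div_iff₀ hw₁'] at b1
    rw [e2, ha2, ← le_div_iff₀ hw₂'] at b2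
    rw [hqdef, LinearMap.add_apply, LinearMap.add_apply]
    exact add_le_add b1 b2
  have hqe : ∀ x, q x (z₁ + z₂) = q z₁ x + q z₂ x := fun x => by
    rw [map_add, hq x z₁, hq x z₂]
  set z := w₂ • z₁ - w₁ • z₂ with hz'
  set d := a * c - b ^ 2 with hd
  have hqz : ∀ x, q x z = w₂ * q z₁ x - w₁ * q z₂ x := fun x => by
    rw [hz', map_sub, map_smul, map_smul, hq x z₁, hq x z₂]; rfl
  have z1 : q z₁ z = d := by rw [hqz, hb', ← ha, hw₁, hw₂, hd]; ring
  have z2 : q z₂ z = -d := by rw [hqz, ← hb, ← hc, hw₁, hw₂, hd]; ring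
  have zz : q z z = (w₁ + w₂) * d := by rw [hqz, z1, z2]; ring
  have hd0 : d ≤ 0 := by
    by_contra hd0
    push Not at hd0
    have := boch z
    rw [z1, z2, zz, neg_sq, div_add_div _ _ hw₁'.ne' hw₂'.ne', le_div_iff₀ (by positivity)] at this
    have h3 : d < w₁ * w₂ := by rw [hd, hw₁, hw₂]; nlinarith
    have h4 : 0 < (w₁ + w₂) * d := by positivity
    nlinarith
  refine Hyp.of_orthogonal hq (e := z₁ + z₂) ?_
  intro x hx
  rw [hqe] at hx
  rcases hd0.eq_or_lt with hd0 | hd0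
  · have h3 : ∀ s : ℝ, q x x + s * (2 * q x z) ≤ q z₁ x ^ 2 / w₁ + q z₂ x ^ 2 / w₂ := by
      intro s
      have := boch (x + s • z)
      simp only [map_add, map_smul, LinearMap.add_apply, LinearMap.smul_apply, smul_eq_mul, z1,
        z2, zz, hd0, hq z x] at this
      simp only [neg_zero, mul_zero, add_zero] at this
      linarith
    have h4 := eq_zero_of_forall_mul_le h3
    rw [hqz] at h4
    have h5 : (w₁ + w₂) * q z₁ x = 0 := by linear_combination h4 / 2 + w₁ * hx
    have h6 : q z₁ x = 0 := by
      rcases mul_eq_zero.1 h5 with h | h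
      · linarith
      · exact h
    have h7 : q z₂ x = 0 := by linarith
    simpa [h6, h7] using boch x
  · set g := q z₁ x / d with hg
    have hgd : g * d = q z₁ x := div_mul_cancel₀ _ hd0.ne
    have h3 := boch (x - g • z)
    have h4 : q z₁ (x - g • z) = 0 := by
      rw [map_sub, map_smul, z1, smul_eq_mul, hgd, sub_self]
    have h5 : q z₂ (x - g • z) = 0 := by
      rw [map_sub, map_smul, z2, smul_eq_mul]; linarith
    have h6 : q (x - g • z) z = 0 := by rw [hqz, h4, h5]; ring
    rw [h4, h5, zero_pow two_ne_zero, zero_div, zero_div, add_zero] at h3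
    have e : q x x = q (x - g • z) (x - g • z) + 2 * g * q (x - g • z) z + g ^ 2 * q z z := by
      simp only [map_sub, map_smul, LinearMap.sub_apply, LinearMap.smul_apply, smul_eq_mul, hq z x]
      ring
    rw [e, h6, zz]
    have : g ^ 2 * ((w₁ + w₂) * d) ≤ 0 :=
      mul_nonpos_of_nonneg_of_nonpos (sq_nonneg _)
        (mul_nonpos_of_nonneg_of_nonpos (by linarith) hd0.le)
    linarith

end Hyperbolic

/-! ### Mixed volumes as bilinear forms -/

/-- The real vector space of formal combinations of convex bodies. -/
abbrev Formal (n : ℕ) := ConvexBody (En n) →₀ ℝ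

/-- A body, as a formal combination. -/
def del (K : ConvexBody (En n)) : Formal n := Finsupp.single K 1

/-- The linear extension of `K ↦ mv (K ::ₘ s)`. -/
def mvL (s : Multiset (ConvexBody (En n))) : Formal n →ₗ[ℝ] ℝ :=
  Finsupp.linearCombination ℝ fun K => mv (K ::ₘ s)

/-- The bilinear extension of `(K, L) ↦ mv (K ::ₘ L ::ₘ s)`. -/
def mvQ (s : Multiset (ConvexBody (En n))) : Formal n →ₗ[ℝ] Formal n →ₗ[ℝ] ℝ :=
  Finsupp.linearCombination ℝ fun K => mvL (K ::ₘ s)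

lemma mvL_del (s : Multiset (ConvexBody (En n))) (K : ConvexBody (En n)) :
    mvL s (del K) = mv (K ::ₘ s) := by simp [mvL, del]

lemma mvQ_del (s : Multiset (ConvexBody (En n))) (K : ConvexBody (En n)) :
    mvQ s (del K) = mvL (K ::ₘ s) := by simp [mvQ, del]

lemma formal_hom_ext {F : Type*} [AddCommGroup F] [Module ℝ F] {f g : Formal n →ₗ[ℝ] F}
    (h : ∀ K, f (del K) = g (del K)) : f = g :=
  Finsupp.lhom_ext' fun K => LinearMap.ext_ring (h K)

lemma mvQ_symm (s : Multiset (ConvexBody (En n))) (x y : Formal n) : mvQ s x y = mvQ s y x := by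
  have : mvQ s = (mvQ s).flip := formal_hom_ext fun K => formal_hom_ext fun L => by
    rw [LinearMap.flip_apply, mvQ_del, mvQ_del, mvL_del, mvL_del, Multiset.cons_swap]
  exact congrArg (fun q => q x y) this

lemma mvQ_del_right (s : Multiset (ConvexBody (En n))) (x : Formal n) (K : ConvexBody (En n)) :
    mvQ s x (del K) = mvL (K ::ₘ s) x := by rw [mvQ_symm, mvQ_del]

lemma mvQ_congr {s : Multiset (ConvexBody (En n))} (hs : s.card + 2 = n) {x x' : Formal n}
    (h : ∀ s : Multiset (ConvexBody (En n)), s.card + 1 = n → mvL s x = mvL s x') :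
    mvQ s x = mvQ s x' :=
  formal_hom_ext fun K => by
    rw [mvQ_del_right, mvQ_del_right, h _ (by simp; omega)]

lemma mvL_sum (s : Multiset (ConvexBody (En n))) (x : Formal n) :
    mvL s x = x.sum fun K a => a * mv (K ::ₘ s) := rfl

lemma mvQ_sum (s : Multiset (ConvexBody (En n))) (x y : Formal n) :
    mvQ s x y = y.sum fun K a => a * mvL (K ::ₘ s) x := by
  rw [mvQ_symm, mvQ, Finsupp.linearCombination_apply, Finsupp.sum, Finsupp.sum,
    LinearMap.sum_apply]
  rfl

lemma exists_formal_sub (x : Formal n) : ∃ A B : ConvexBody (En n),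
    ∀ s : Multiset (ConvexBody (En n)), s.card + 1 = n → mvL s x = mvL s (del A - del B) := by
  induction x using Finsupp.induction_linear with
  | zero => exact ⟨0, 0, fun s _ => by simp⟩
  | add x y hx hy =>
    obtain ⟨A, B, h⟩ := hx
    obtain ⟨A', B', h'⟩ := hy
    refine ⟨A + A', B + B', fun s hs => ?_⟩
    rw [map_add, h s hs, h' s hs]
    simp only [map_sub, mvL_del, mv_add_cons hs]
    ring
  | single K a =>
    have e : ∀ s : Multiset (ConvexBody (En n)), mvL s (Finsupp.single K a) = a * mv (K ::ₘ s) :=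
      fun s => by simp [mvL]
    rcases le_total 0 a with ha | ha
    · refine ⟨a • K, 0, fun s hs => ?_⟩
      rw [e, map_sub, mvL_del, mvL_del, mv_smul_cons hs ha, mv_zero_cons, sub_zero]
    · refine ⟨0, (-a) • K, fun s hs => ?_⟩
      rw [e, map_sub, mvL_del, mvL_del, mv_smul_cons hs (by linarith), mv_zero_cons]
      ring

lemma tendsto_mv_add {ι α : Type*} {l : Filter α} {f : α → ι → ConvexBody (En n)}
    {g : ι → ConvexBody (En n)} (s : Multiset ι) (u : Multiset (ConvexBody (En n)))
    (h : ∀ i, Tendsto (fun a => f a i) l (𝓝 (g i))) :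
    Tendsto (fun a => mv (s.map (f a) + u)) l (𝓝 (mv (s.map g + u))) := by
  have := tendsto_mv (l := l) (f := fun a => Sum.elim (f a) id) (g := Sum.elim g id)
    (s.map Sum.inl + u.map Sum.inr) (by
      rintro (i | K)
      · exact h i
      · exact tendsto_const_nhds)
  simpa [Multiset.map_map, Function.comp_def] using this

lemma tendsto_mvL {ι α : Type*} {l : Filter α} {f : α → ι → ConvexBody (En n)}
    {g : ι → ConvexBody (En n)} (s : Multiset ι) (u : Multiset (ConvexBody (En n)))
    (h : ∀ i, Tendsto (fun a => f a i) l (𝓝 (g i))) (x : Formal n) :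
    Tendsto (fun a => mvL (s.map (f a) + u) x) l (𝓝 (mvL (s.map g + u) x)) := by
  simp only [mvL_sum, Finsupp.sum, ← Multiset.add_cons]
  exact tendsto_finsetSum _ fun K _ => (tendsto_mv_add s _ h).const_mul _

lemma tendsto_mvQ {ι α : Type*} {l : Filter α} {f : α → ι → ConvexBody (En n)}
    {g : ι → ConvexBody (En n)} (s : Multiset ι) (u : Multiset (ConvexBody (En n)))
    (h : ∀ i, Tendsto (fun a => f a i) l (𝓝 (g i))) (x y : Formal n) :
    Tendsto (fun a => mvQ (s.map (f a) + u) x y) l (𝓝 (mvQ (s.map g + u) x y)) := by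
  simp only [mvQ_sum, Finsupp.sum, ← Multiset.add_cons]
  exact tendsto_finsetSum _ fun K _ => (tendsto_mvL s _ h x).const_mul _

lemma Hyp.of_tendsto {E α : Type*} [AddCommGroup E] [Module ℝ E] {q : E →ₗ[ℝ] E →ₗ[ℝ] ℝ}
    {l : Filter α} [l.NeBot] {p : α → E →ₗ[ℝ] E →ₗ[ℝ] ℝ}
    (h : ∀ x y, Tendsto (fun a => p a x y) l (𝓝 (q x y))) (hp : ∀ᶠ a in l, Hyp (p a)) : Hyp q := by
  intro x y hy
  rcases hy.eq_or_lt with hy | hy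
  · rw [← hy, mul_zero]; positivity
  refine le_of_tendsto_of_tendsto ((h x x).mul (h y y)) ((h x y).pow 2) ?_
  filter_upwards [hp, (h y y).eventually (lt_mem_nhds hy)] with a ha hya
  exact ha x y hya.le

lemma tendsto_mv_slot (m : ℕ) (u : Multiset (ConvexBody (En n))) {α : Type*} {l : Filter α}
    {f : α → ConvexBody (En n)} {K : ConvexBody (En n)} (h : Tendsto f l (𝓝 K)) (x y : Formal n) :
    Tendsto (fun a => mvQ (Multiset.replicate m (f a) + u) x y) l
      (𝓝 (mvQ (Multiset.replicate m K + u) x y)) := by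
  have := tendsto_mvQ (f := fun a (_ : Unit) => f a) (g := fun _ => K) (Multiset.replicate m ()) u
    (fun _ => h) x y
  simpa [Multiset.map_replicate] using this

/-- The bodies `N t`, for `t ∈ I`, move linearly in the direction `x`. -/
def IsPath (N : ℝ → ConvexBody (En n)) (x : Formal n) (I : Set ℝ) : Prop :=
  ∀ t ∈ I, ∀ t' ∈ I, ∀ s : Multiset (ConvexBody (En n)), s.card + 1 = n →
    mv (N t ::ₘ s) = mv (N t' ::ₘ s) + (t - t') * mvL s x

lemma IsPath.hasDerivAt {N : ℝ → ConvexBody (En n)} {x : Formal n} {I : Set ℝ} (h : IsPath N x I)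
    (hI : IsOpen I) {t₀ : ℝ} (ht₀ : t₀ ∈ I) (m : ℕ) (u : Multiset (ConvexBody (En n)))
    (hu : m + u.card = n) :
    HasDerivAt (fun t => mv (Multiset.replicate m (N t) + u))
      (m * mvL (Multiset.replicate (m - 1) (N t₀) + u) x) t₀ := by
  induction m generalizing u with
  | zero => simpa using hasDerivAt_const t₀ (mv u)
  | succ m ih =>
    have hcont : ContinuousAt (fun t => mvL (Multiset.replicate m (N t) + u) x) t₀ := by
      simp only [mvL_sum, Finsupp.sum, ← Multiset.add_cons]
      refine tendsto_finsetSum _ fun K _ => Tendsto.const_mul _ ?_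
      exact (ih (K ::ₘ u) (by simp; omega)).continuousAt
    have h1 : HasDerivAt (fun t => mv (Multiset.replicate m (N t) + N t₀ ::ₘ u))
        (m * mvL (Multiset.replicate m (N t₀) + u) x) t₀ := by
      have := ih (N t₀ ::ₘ u) (by simp; omega)
      rcases m with _ | m
      · simpa using this
      · simpa [Multiset.replicate_succ] using this
    have h2 : HasDerivAt (fun t => (t - t₀) * mvL (Multiset.replicate m (N t) + u) x)
        (mvL (Multiset.replicate m (N t₀) + u) x) t₀ := by
      rw [hasDerivAt_iff_tendsto_slope]
      refine (hcont.tendsto.mono_left nhdsWithin_le_nhds).congr' ?_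
      filter_upwards [self_mem_nhdsWithin] with t ht
      have : t - t₀ ≠ 0 := sub_ne_zero.2 ht
      rw [slope_def_field, sub_self, zero_mul, sub_zero, mul_div_cancel_left₀ _ this]
    have h3 := h1.add h2
    rw [Nat.add_sub_cancel]
    push_cast
    rw [add_mul, one_mul]
    refine h3.congr_of_eventuallyEq ?_
    filter_upwards [hI.mem_nhds ht₀] with t ht
    simp only [Pi.add_apply]
    rw [Multiset.replicate_succ, Multiset.cons_add, h t ht t₀ ht₀ _ (by simp; omega),
      Multiset.add_cons]

lemma IsPath.hasDerivAt_mvL {N : ℝ → ConvexBody (En n)} {x : Formal n} {I : Set ℝ}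
    (h : IsPath N x I) (hI : IsOpen I) {t₀ : ℝ} (ht₀ : t₀ ∈ I) (m : ℕ)
    (u : Multiset (ConvexBody (En n))) (hu : m + u.card + 1 = n) (y : Formal n) :
    HasDerivAt (fun t => mvL (Multiset.replicate m (N t) + u) y)
      (m * mvQ (Multiset.replicate (m - 1) (N t₀) + u) x y) t₀ := by
  rw [mvQ_sum]
  simp only [mvL_sum _ y, Finsupp.sum, ← Multiset.add_cons]
  rw [Finset.mul_sum]
  refine HasDerivAt.fun_sum fun K _ => ?_
  rw [mul_left_comm]
  exact (h.hasDerivAt hI ht₀ m (K ::ₘ u) (by simp; omega)).const_mul _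

lemma hasDerivAt_comp_neg {g : ℝ → ℝ} {c t : ℝ} (h : HasDerivAt g c (-t)) :
    HasDerivAt (fun s => g (-s)) (-c) t := by
  have := h.scomp t (hasDerivAt_neg t)
  rw [neg_one_smul] at this
  exact this

lemma isLocalMax_second_deriv_nonpos {g g' : ℝ → ℝ} {c : ℝ}
    (h1 : ∀ᶠ t in 𝓝 0, HasDerivAt g (g' t) t) (h2 : HasDerivAt g' c 0) (hmax : IsLocalMax g 0) :
    c ≤ 0 := by
  by_contra hc
  push Not at hc
  have h0 : g' 0 = 0 := hmax.hasDerivAt_eq_zero h1.self_of_nhds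
  have e1 : ∀ᶠ t in 𝓝 0, HasDerivAt (fun t => g t - c / 4 * t ^ 2) (g' t - c / 4 * (2 * t)) t := by
    filter_upwards [h1] with t ht
    simpa using ht.fun_sub ((hasDerivAt_pow 2 t).const_mul (c / 4))
  have e2 : HasDerivAt (fun t => g' t - c / 4 * (2 * t)) (c / 2) 0 := by
    have := h2.fun_sub (((hasDerivAt_id (0 : ℝ)).const_mul 2).const_mul (c / 4))
    rw [show c / 2 = c - c / 4 * (2 * 1) by ring]
    exact this
  have e3 : deriv (fun t => g t - c / 4 * t ^ 2) =ᶠ[𝓝 0] fun t => g' t - c / 4 * (2 * t) := by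
    filter_upwards [e1] with t ht using ht.deriv
  have hmin : IsLocalMin (fun t => g t - c / 4 * t ^ 2) 0 := by
    refine isLocalMin_of_deriv_deriv_pos ?_ ?_ e1.self_of_nhds.continuousAt
    · rw [e3.deriv_eq, e2.deriv]; linarith
    · rw [e1.self_of_nhds.deriv, h0]; ring
  obtain ⟨t, ht, ht0⟩ := ((((hmin.and hmax).filter_mono nhdsWithin_le_nhds).and
    (self_mem_nhdsWithin : {(0 : ℝ)}ᶜ ∈ 𝓝[≠] (0 : ℝ))).exists)
  have : 0 < t ^ 2 := by have : t ≠ 0 := ht0; positivity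
  have h3 := ht.1
  have h4 := ht.2
  simp only at h3
  nlinarith

lemma mvQ_mul_vol_le (hn : 2 ≤ n) {K A B : ConvexBody (En n)} {ε : ℝ} (hε : 0 < ε) :
    (n - 1) * (mvQ (Multiset.replicate (n - 2) (K + (ε • A + ε • B))) (del A - del B)
      (del A - del B) * vol (K + (ε • A + ε • B))) ≤
      n * mvL (Multiset.replicate (n - 1) (K + (ε • A + ε • B))) (del A - del B) ^ 2 := by
  set N : ℝ → ConvexBody (En n) := fun t => K + ((ε + t) • A + (ε - t) • B) with hN
  set x : Formal n := del A - del B with hx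
  set I := Set.Ioo (-ε) ε with hI
  have h0 : N 0 = K + (ε • A + ε • B) := by simp [hN]
  have h0I : (0 : ℝ) ∈ I := ⟨by linarith, hε⟩
  have hNpath : IsPath N x I := by
    intro t ht t' ht' s hs
    have a1 : 0 ≤ ε + t := by linarith [ht.1]
    have a2 : 0 ≤ ε - t := by linarith [ht.2]
    have a3 : 0 ≤ ε + t' := by linarith [ht'.1]
    have a4 : 0 ≤ ε - t' := by linarith [ht'.2]
    simp only [hN, hx, map_sub, mvL_del, mv_add_cons hs, mv_smul_cons hs a1, mv_smul_cons hs a2,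
      mv_smul_cons hs a3, mv_smul_cons hs a4]
    ring
  set f : ℝ → ℝ := fun t => vol (N t) with hf
  set f' : ℝ → ℝ := fun t => n * mvL (Multiset.replicate (n - 1) (N t)) x with hf'
  set c := n * ((n - 1) * mvQ (Multiset.replicate (n - 2) (N 0)) x x) with hc
  have d1 : ∀ t ∈ I, HasDerivAt f (f' t) t := by
    intro t ht
    have := hNpath.hasDerivAt isOpen_Ioo ht n 0 (by simp)
    simpa only [add_zero, mv_replicate] using this
  have d2 : HasDerivAt f' c 0 := by
    have := (hNpath.hasDerivAt_mvL isOpen_Ioo h0I (n - 1) 0 (by simp; omega) x).const_mul (n : ℝ)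
    simp only [add_zero, Nat.sub_sub] at this
    rw [Nat.cast_sub (by omega), Nat.cast_one] at this
    exact this
  have hsymm : ∀ t ∈ I, -t ∈ I := fun t ht => ⟨by linarith [ht.2], by linarith [ht.1]⟩
  have hsum : ∀ t ∈ I, N t + N (-t) = (2 : ℝ) • N 0 := by
    intro t ht
    refine eq_of_supp_eq fun y => ?_
    simp only [hN, supp_add]
    have a1 : 0 ≤ ε + t := by linarith [ht.1]
    have a2 : 0 ≤ ε - t := by linarith [ht.2]
    rw [supp_smul zero_le_two, supp_smul a1, supp_smul a2,
      supp_smul (by linarith : 0 ≤ ε + -t), supp_smul (by linarith : 0 ≤ ε - -t), supp_add,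
      supp_add, supp_smul (by linarith), supp_smul (by linarith)]
    ring
  have hmax : IsLocalMax (fun t => f t * f (-t)) 0 := by
    filter_upwards [isOpen_Ioo.mem_nhds h0I] with t ht
    have := vol_mul_vol_le (N t) (N (-t))
    rw [hsum t ht, vol_smul zero_le_two, mul_pow, ← pow_mul, mul_comm n 2, pow_mul] at this
    norm_num at this
    simp only [neg_zero]
    rw [← sq]
    exact this
  have key := isLocalMax_second_deriv_nonpos (g := fun t => f t * f (-t))
    (g' := fun t => f' t * f (-t) + f t * -f' (-t)) (c := c * f 0 + f' 0 * -f' 0 +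
      (f' 0 * -f' 0 + f 0 * c)) ?_ ?_ hmax
  · rw [← h0]
    have hn0 : (0 : ℝ) < n := by exact_mod_cast (by omega : 0 < n)
    simp only [hf', hf, hc] at key
    have : 2 * n * ((n - 1) * (mvQ (Multiset.replicate (n - 2) (N 0)) x x * vol (N 0)) -
        n * mvL (Multiset.replicate (n - 1) (N 0)) x ^ 2) ≤ 0 := by linarith
    by_contra hcon
    push Not at hcon
    nlinarith
  · filter_upwards [isOpen_Ioo.mem_nhds h0I] with t ht
    have := hasDerivAt_comp_neg (d1 (-t) (hsymm t ht))
    exact (d1 t ht).mul this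
  · have e0 : HasDerivAt (fun t => f (-t)) (-f' 0) 0 := by
      have := hasDerivAt_comp_neg (t := 0) (by rw [neg_zero]; exact d1 0 h0I)
      exact this
    have e1 : HasDerivAt (fun t => f' (-t)) (-c) 0 :=
      hasDerivAt_comp_neg (t := 0) (by rw [neg_zero]; exact d2)
    have := (d2.fun_mul e0).fun_add ((d1 0 h0I).fun_mul e1.fun_neg)
    simpa using this

lemma hyp_replicate_of_interior (hn : 2 ≤ n) {K : ConvexBody (En n)}
    (hK : (interior (K : Set (En n))).Nonempty) : Hyp (mvQ (Multiset.replicate (n - 2) K)) := by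
  refine Hyp.of_orthogonal (mvQ_symm _) (e := del K) fun x hx => ?_
  obtain ⟨A, B, hAB⟩ := exists_formal_sub x
  have hcong : ∀ s : Multiset (ConvexBody (En n)), s.card + 2 = n →
      mvQ s x x = mvQ s (del A - del B) (del A - del B) := fun s hs => by
    rw [mvQ_congr hs hAB, mvQ_symm, mvQ_congr hs hAB]
  have hL : mvL (Multiset.replicate (n - 1) K) (del A - del B) = 0 := by
    rw [← hAB _ (by simp; omega), ← hx, mvQ_del_right, ← Multiset.replicate_succ]
    congr 3; omega
  rw [hcong _ (by simp; omega)]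
  have hlim : Tendsto (fun ε : ℝ => K + (ε • A + ε • B)) (𝓝[>] 0) (𝓝 K) := by
    have := (tendsto_add_smul_zero K (A + B)).mono_left
      (nhdsWithin_mono 0 (Set.Ioi_subset_Ici_self (a := (0 : ℝ))))
    refine this.congr fun ε => ?_
    rw [smul_add_body]
  have t1 := tendsto_mv_slot (n - 2) 0 hlim (del A - del B) (del A - del B)
  have t2 := tendsto_mvL (f := fun ε (_ : Unit) => K + (ε • A + ε • B)) (g := fun _ => K)
    (Multiset.replicate (n - 1) ()) 0 (fun _ => hlim) (del A - del B)
  have t3 := (continuous_vol.tendsto K).comp hlim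
  simp only [Multiset.map_replicate, add_zero] at t1 t2
  rw [hL] at t2
  have := le_of_tendsto_of_tendsto ((t1.mul t3).const_mul ((n : ℝ) - 1))
    ((t2.pow 2).const_mul (n : ℝ))
    (by filter_upwards [self_mem_nhdsWithin] with ε hε using mvQ_mul_vol_le hn hε)
  have hn1 : (0 : ℝ) < n - 1 := by
    have : (2 : ℝ) ≤ n := by exact_mod_cast hn
    linarith
  have hV := vol_pos hK
  by_contra hc
  push Not at hc
  have := mul_pos hn1 (mul_pos hc hV)
  norm_num at *
  linarith

lemma interior_add_nonempty {K : ConvexBody (En n)} (hK : (interior (K : Set (En n))).Nonempty)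
    (L : ConvexBody (En n)) : (interior ((K + L : ConvexBody (En n)) : Set (En n))).Nonempty := by
  obtain ⟨x, hx⟩ := hK
  obtain ⟨y, hy⟩ := L.nonempty
  exact ⟨x + y, subset_interior_add_left (Set.add_mem_add hx hy)⟩

lemma interior_ballB_nonempty : (interior (ballB n : Set (En n))).Nonempty :=
  ⟨0, ball_subset_interior_closedBall (mem_ball_self one_pos)⟩

lemma interior_smul_nonempty {K : ConvexBody (En n)} (hK : (interior (K : Set (En n))).Nonempty)
    {c : ℝ} (hc : 0 < c) : (interior ((c • K : ConvexBody (En n)) : Set (En n))).Nonempty := by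
  rw [ConvexBody.coe_smul, interior_smul₀ hc.ne']
  exact hK.smul_set

lemma tendsto_add_smul_zero_right (K L : ConvexBody (En n)) :
    Tendsto (fun ε : ℝ => K + ε • L) (𝓝[>] 0) (𝓝 K) :=
  (tendsto_add_smul_zero K L).mono_left (nhdsWithin_mono 0 Set.Ioi_subset_Ici_self)

lemma hyp_of_interior {m : ℕ} {u : Multiset (ConvexBody (En n))}
    (h : ∀ K : ConvexBody (En n), (interior (K : Set (En n))).Nonempty →
      Hyp (mvQ (Multiset.replicate m K + u))) (K : ConvexBody (En n)) :
    Hyp (mvQ (Multiset.replicate m K + u)) := by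
  refine Hyp.of_tendsto
    (fun x y => tendsto_mv_slot m u (tendsto_add_smul_zero_right K (ballB n)) x y) ?_
  filter_upwards [self_mem_nhdsWithin] with ε hε
  refine h _ ?_
  rw [add_comm]
  exact interior_add_nonempty (interior_smul_nonempty interior_ballB_nonempty hε) K

lemma Hyp.smul {E : Type*} [AddCommGroup E] [Module ℝ E] {q : E →ₗ[ℝ] E →ₗ[ℝ] ℝ} (h : Hyp q)
    {c : ℝ} (hc : 0 ≤ c) : Hyp (c • q) := by
  intro x y hy
  rcases hc.eq_or_lt with rfl | hc
  · simp
  simp only [LinearMap.smul_apply, smul_eq_mul] at hy ⊢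
  have := h x y (nonneg_of_mul_nonneg_right hy hc)
  nlinarith [mul_le_mul_of_nonneg_left this (sq_nonneg c)]

lemma mvQ_add_cons {s : Multiset (ConvexBody (En n))} (hs : s.card + 3 = n)
    (K L : ConvexBody (En n)) : mvQ ((K + L) ::ₘ s) = mvQ (K ::ₘ s) + mvQ (L ::ₘ s) :=
  formal_hom_ext fun A => formal_hom_ext fun B => by
    simp only [LinearMap.add_apply, mvQ_del, mvL_del, Multiset.cons_swap _ (_ + _) s]
    simp only [Multiset.cons_swap _ (K + L), Multiset.cons_swap _ K, Multiset.cons_swap _ L]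
    exact mv_add_cons (by simp; omega) _ _

lemma mvQ_smul_cons {s : Multiset (ConvexBody (En n))} (hs : s.card + 3 = n) {c : ℝ} (hc : 0 ≤ c)
    (K : ConvexBody (En n)) : mvQ ((c • K) ::ₘ s) = c • mvQ (K ::ₘ s) :=
  formal_hom_ext fun A => formal_hom_ext fun B => by
    simp only [LinearMap.smul_apply, mvQ_del, mvL_del, smul_eq_mul]
    simp only [Multiset.cons_swap _ (c • K), Multiset.cons_swap _ K]
    exact mv_smul_cons (by simp; omega) hc _

lemma mvQ_point_cons (x : En n) (s : Multiset (ConvexBody (En n))) : mvQ (point x ::ₘ s) = 0 :=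
  formal_hom_ext fun A => formal_hom_ext fun B => by
    simp only [LinearMap.zero_apply, mvQ_del, mvL_del, Multiset.cons_swap _ (point x)]
    exact mv_point_cons _ _

lemma mvQ_replicate_add_seg (K : ConvexBody (En n)) (v : En n) (m : ℕ)
    {s : Multiset (ConvexBody (En n))} (hs : m + s.card + 2 = n) {c : ℝ} (hc : 0 ≤ c) :
    mvQ (Multiset.replicate m (K + c • seg v) + s) = mvQ (Multiset.replicate m K + s) +
      (m * c) • mvQ (Multiset.replicate (m - 1) K + seg v ::ₘ s) :=
  formal_hom_ext fun A => formal_hom_ext fun B => by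
    simp only [LinearMap.smul_apply, LinearMap.add_apply, mvQ_del, mvL_del, smul_eq_mul,
      ← Multiset.add_cons]
    rw [mv_replicate_add_seg K v m (by simp; omega) hc, ← Multiset.add_cons,
      Multiset.cons_swap (seg v), Multiset.cons_swap (seg v)]
    ring

lemma hyp_cons_seg {m : ℕ} {u : Multiset (ConvexBody (En n))} (hu : m + 1 + u.card + 2 = n)
    {K : ConvexBody (En n)} {v : En n}
    (h : ∀ c : ℝ, 0 ≤ c → Hyp (mvQ (Multiset.replicate (m + 1) (K + c • seg v) + u))) :
    Hyp (mvQ (Multiset.replicate m K + seg v ::ₘ u)) := by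
  have h1 : ∀ᶠ c : ℝ in atTop, Hyp ((((m + 1 : ℕ) : ℝ) * c)⁻¹ •
      mvQ (Multiset.replicate (m + 1) (K + c • seg v) + u)) := by
    filter_upwards [eventually_ge_atTop 0] with c hc
    exact (h c hc).smul (by positivity)
  refine Hyp.of_tendsto (fun x y => ?_) h1
  have h2 : Tendsto (fun c : ℝ => (((m + 1 : ℕ) : ℝ) * c)⁻¹ *
      mvQ (Multiset.replicate (m + 1) K + u) x y + mvQ (Multiset.replicate m K + seg v ::ₘ u) x y)
      atTop (𝓝 (0 * mvQ (Multiset.replicate (m + 1) K + u) x y +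
        mvQ (Multiset.replicate m K + seg v ::ₘ u) x y)) := by
    refine Tendsto.add_const _ (Tendsto.mul_const _ ?_)
    exact tendsto_inv_atTop_zero.comp (tendsto_id.const_mul_atTop (by positivity))
  rw [zero_mul, zero_add] at h2
  refine h2.congr' ?_
  filter_upwards [eventually_gt_atTop 0] with c hc
  rw [mvQ_replicate_add_seg K v (m + 1) (by omega) hc.le]
  simp only [LinearMap.smul_apply, LinearMap.add_apply, smul_eq_mul, Nat.add_sub_cancel]
  have : ((m + 1 : ℕ) : ℝ) * c ≠ 0 := by positivity
  rw [mul_add, inv_mul_cancel_left₀ this]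

lemma exists_le_point_add_smul {K : ConvexBody (En n)} (hK : (interior (K : Set (En n))).Nonempty)
    (L : ConvexBody (En n)) : ∃ x, ∃ c : ℝ, 0 < c ∧ L ≤ point x + c • K := by
  obtain ⟨y, hy⟩ := hK
  obtain ⟨r, hr, hb⟩ := Metric.isOpen_iff.1 isOpen_interior y hy
  obtain ⟨R, hR, hL⟩ := exists_norm_le L
  have hc : 0 < 2 * R / r := by positivity
  refine ⟨-((2 * R / r) • y), 2 * R / r, hc, fun z hz => ?_⟩
  refine mem_add_iff.2 ⟨_, mem_point.2 rfl, _, mem_smul_iff.2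
    ⟨y + (2 * R / r)⁻¹ • z, interior_subset (hb ?_), rfl⟩, ?_⟩
  · rw [mem_ball, dist_eq_norm, add_sub_cancel_left, norm_smul, Real.norm_of_nonneg (by positivity),
      inv_mul_lt_iff₀ hc, div_mul_cancel₀ _ hr.ne']
    linarith [hL z hz]
  · rw [smul_add, smul_smul, mul_inv_cancel₀ hc.ne', one_smul]
    abel

lemma mvQ_eq_zero {K : ConvexBody (En n)} (hK : (interior (K : Set (En n))).Nonempty)
    {s : Multiset (ConvexBody (En n))} (hs : s.card + 2 = n) (h : mv (K ::ₘ K ::ₘ s) = 0) :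
    mvQ s = 0 := by
  have key : ∀ L A : ConvexBody (En n), mv (K ::ₘ A ::ₘ s) = 0 → mv (L ::ₘ A ::ₘ s) = 0 := by
    intro L A hA
    obtain ⟨x, c, hc, hL⟩ := exists_le_point_add_smul hK L
    have hcard : (A ::ₘ s).card + 1 = n := by simp; omega
    have := mv_mono_cons hcard hL
    rw [mv_point_add_cons hcard, mv_smul_cons hcard hc.le, hA, mul_zero] at this
    exact le_antisymm this (mv_nonneg (by simp; omega))
  refine formal_hom_ext fun A => formal_hom_ext fun B => ?_
  rw [mvQ_del, mvL_del]
  refine key _ _ ?_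
  rw [Multiset.cons_swap]
  exact key _ _ h

lemma hyp_add_cons {s : Multiset (ConvexBody (En n))} (hs : s.card + 3 = n)
    {K L : ConvexBody (En n)} (hK : (interior (K : Set (En n))).Nonempty)
    (h₁ : Hyp (mvQ (K ::ₘ s))) (h₂ : Hyp (mvQ (L ::ₘ s))) : Hyp (mvQ ((K + L) ::ₘ s)) := by
  rw [mvQ_add_cons hs]
  have hnn : ∀ A B, 0 ≤ (mvQ (K ::ₘ s) + mvQ (L ::ₘ s)) (del A) (del B) := fun A B => by
    simp only [LinearMap.add_apply, mvQ_del, mvL_del]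
    exact add_nonneg (mv_nonneg (by simp; omega)) (mv_nonneg (by simp; omega))
  rcases (hnn K L).eq_or_lt with h0 | h0
  · have h3 : mvQ (L ::ₘ s) = 0 := by
      refine mvQ_eq_zero hK (by simp; omega) ?_
      simp only [LinearMap.add_apply, mvQ_del, mvL_del] at h0
      have a1 := mv_nonneg (s := L ::ₘ K ::ₘ K ::ₘ s) (by simp; omega)
      have a2 := mv_nonneg (s := L ::ₘ K ::ₘ L ::ₘ s) (by simp; omega)
      have a3 : mv (L ::ₘ K ::ₘ K ::ₘ s) = 0 := by linarith
      rwa [Multiset.cons_swap, Multiset.cons_swap L K] at a3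
    rw [h3, add_zero]
    exact h₁
  · refine Hyp.add (mvQ_symm _) (mvQ_symm _) h₁ h₂ (z₁ := del K) (z₂ := del L) (fun x => ?_)
      (hnn _ _) h0 (hnn _ _)
    rw [mvQ_del, mvQ_del, Multiset.cons_swap]

/-- The symmetric segment `[-w, w]`. -/
def sg (w : En n) : ConvexBody (En n) := point (-w) + seg ((2 : ℝ) • w)

lemma supp_sg (w x : En n) : supp (sg w) x = |⟪x, w⟫_ℝ| := by
  rw [sg, supp_add, supp_point, supp_seg, inner_neg_right, real_inner_smul_right]
  rcases le_total 0 ⟪x, w⟫_ℝ with h | h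
  · rw [abs_of_nonneg h, max_eq_right (by linarith)]
    ring
  · rw [abs_of_nonpos h, max_eq_left (by linarith)]
    ring

lemma continuous_sg : Continuous (sg : En n → ConvexBody (En n)) := by
  refine (LipschitzWith.of_dist_le_mul (K := 1) fun v w => ?_).continuous
  rw [NNReal.coe_one, one_mul]
  refine dist_le_of_supp_le dist_nonneg fun x => ?_
  rw [supp_sg, supp_sg, dist_eq_norm, mul_comm]
  refine (abs_abs_sub_abs_le _ _).trans ?_
  rw [← inner_sub_right]
  exact abs_real_inner_le_norm _ _

lemma integrableOn_ball {f : En n → ℝ} (hf : Continuous f) :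
    IntegrableOn f (ball (0 : En n) 1) :=
  (hf.continuousOn.integrableOn_compact (isCompact_closedBall 0 1)).mono_set ball_subset_closedBall

lemma integral_abs_inner_eq {x y : En n} (h : ‖x‖ = ‖y‖) :
    ∫ w in ball (0 : En n) 1, |⟪x, w⟫_ℝ| = ∫ w in ball (0 : En n) 1, |⟪y, w⟫_ℝ| := by
  set ρ := Submodule.reflection (ℝ ∙ (x - y))ᗮ
  have hρ : ρ x = y := Submodule.reflection_sub h
  have h1 := ρ.measurePreserving.setIntegral_preimage_emb
    ρ.toHomeomorph.measurableEmbedding (fun w => |⟪y, w⟫_ℝ|) (ball (0 : En n) 1)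
  rw [← h1]
  have h2 : ρ ⁻¹' ball (0 : En n) 1 = ball 0 1 := by
    ext w
    simp
  rw [h2, ← hρ]
  simp only [LinearIsometryEquiv.inner_map_map]

lemma exists_integral_abs_inner (hn : 2 ≤ n) : ∃ c : ℝ, 0 < c ∧
    ∀ x : En n, ∫ w in ball (0 : En n) 1, |⟪x, w⟫_ℝ| = c * ‖x‖ := by
  set e : En n := EuclideanSpace.single ⟨0, by omega⟩ 1
  have he : ‖e‖ = 1 := by simp [e]
  have hc : Continuous fun w : En n => |⟪e, w⟫_ℝ| := by fun_prop
  refine ⟨∫ w in ball (0 : En n) 1, |⟪e, w⟫_ℝ|, ?_, fun x => ?_⟩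
  · rw [setIntegral_pos_iff_support_of_nonneg_ae (ae_of_all _ fun w => abs_nonneg _)
      (integrableOn_ball hc)]
    refine ((hc.isOpen_support).inter isOpen_ball).measure_pos _ ⟨(2 : ℝ)⁻¹ • e, ?_, ?_⟩
    · simp [real_inner_smul_right, he]
    · simp [norm_smul, he]; norm_num
  · have h1 : ‖x‖ = ‖‖x‖ • e‖ := by simp [norm_smul, he]
    rw [integral_abs_inner_eq h1, mul_comm, ← integral_const_mul]
    simp only [real_inner_smul_left, abs_mul, abs_norm]

lemma exists_tendsto_ballB (hn : 2 ≤ n) : ∃ c : ℝ, 0 < c ∧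
    ∃ (s : ℕ → Finset (En n)) (m : ℕ → En n → ℝ), (∀ k y, 0 ≤ m k y) ∧
      Tendsto (fun k => ∑ y ∈ s k, m k y • sg y) atTop (𝓝 (c • ballB n)) ∧
      ∀ Φ : ConvexBody (En n) → ℝ, Continuous Φ → (∀ A B, Φ (A + B) = Φ A + Φ B) →
        (∀ a : ℝ, 0 ≤ a → ∀ A, Φ (a • A) = a * Φ A) →
        ∫ w in ball (0 : En n) 1, Φ (sg w) = c * Φ (ballB n) := by
  obtain ⟨c, hc, hcx⟩ := exists_integral_abs_inner hn
  set μ : Measure (En n) := volume.restrict (ball 0 1)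
  have : IsFiniteMeasure μ := ⟨by simp [μ, measure_ball_lt_top]⟩
  set f : ℕ → SimpleFunc (En n) (En n) := fun k =>
    SimpleFunc.approxOn id measurable_id Set.univ 0 (Set.mem_univ _) k
  have hf : ∀ w, Tendsto (fun k => f k w) atTop (𝓝 w) := fun w =>
    SimpleFunc.tendsto_approxOn measurable_id (Set.mem_univ 0) (by simp)
  have hfn : ∀ k w, ‖f k w‖ ≤ 2 * ‖w‖ := fun k w => by
    have := SimpleFunc.norm_approxOn_zero_le measurable_id (Set.mem_univ (0 : En n)) w k
    simpa [two_mul] using this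
  have hball : ∀ᵐ w ∂μ, ‖w‖ ≤ 1 := by
    filter_upwards [ae_restrict_mem measurableSet_ball] with w hw
    exact (mem_ball_zero_iff.1 hw).le
  have hint : ∀ Φ : ConvexBody (En n) → ℝ, Φ 0 = 0 → (∀ A B, Φ (A + B) = Φ A + Φ B) →
      (∀ a : ℝ, 0 ≤ a → ∀ A, Φ (a • A) = a * Φ A) → ∀ k,
      Φ (∑ y ∈ (f k).range, μ.real (f k ⁻¹' {y}) • sg y) = ∫ w, Φ (sg (f k w)) ∂μ := by
    intro Φ h0 hadd hsmul k
    have hsum : ∀ s : Finset (En n), Φ (∑ y ∈ s, μ.real (f k ⁻¹' {y}) • sg y) =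
        ∑ y ∈ s, μ.real (f k ⁻¹' {y}) • Φ (sg y) := fun s => by
      induction s using Finset.induction_on with
      | empty => simpa using h0
      | insert a s ha ih =>
        rw [Finset.sum_insert ha, Finset.sum_insert ha, hadd, ih, hsmul _ measureReal_nonneg,
          smul_eq_mul]
    have hsg : Φ (sg 0) = 0 := by
      have : sg (0 : En n) = 0 := eq_of_supp_eq fun x => by
        rw [supp_sg, inner_zero_right, abs_zero, show (0 : ConvexBody (En n)) = point 0 from rfl,
          supp_point, inner_zero_right]
      rw [this, h0]
    rw [hsum, ← SimpleFunc.map_integral (f k) (fun y => Φ (sg y))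
      (SimpleFunc.integrable_of_isFiniteMeasure _) hsg, SimpleFunc.integral_eq_integral _
      (SimpleFunc.integrable_of_isFiniteMeasure _)]
    rfl
  have hlim : Tendsto (fun k => ∑ y ∈ (f k).range, μ.real (f k ⁻¹' {y}) • sg y) atTop
      (𝓝 (c • ballB n)) := by
    have h1 : Tendsto (fun k => ∫ w, ‖f k w - w‖ ∂μ) atTop (𝓝 (∫ w : En n, 0 ∂μ)) := by
      refine tendsto_integral_of_dominated_convergence (fun _ => 3) (fun k => ?_)
        (integrable_const _) (fun k => ?_) (ae_of_all _ fun w => ?_)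
      · exact (((f k).measurable.sub measurable_id).norm).aestronglyMeasurable
      · filter_upwards [hball] with w hw
        rw [norm_norm]
        linarith [norm_sub_le (f k w) w, hfn k w]
      · simpa using ((hf w).sub_const w).norm
    rw [integral_zero] at h1
    refine tendsto_iff_dist_tendsto_zero.2 (squeeze_zero (fun _ => dist_nonneg) (fun k => ?_) h1)
    refine dist_le_of_supp_le (integral_nonneg fun _ => norm_nonneg _) fun x => ?_
    have h2 := hint (fun K => supp K x) (by
      rw [show (0 : ConvexBody (En n)) = point 0 from rfl, supp_point, inner_zero_right])
      (fun A B => supp_add A B x) (fun a ha A => supp_smul ha A x) k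
    rw [h2, supp_smul hc.le, supp_ballB, ← hcx x]
    simp only [supp_sg]
    have hb1 : Integrable (fun w => |⟪x, f k w⟫_ℝ|) μ := by
      refine Integrable.of_bound ?_ (‖x‖ * 2) ?_
      · exact (((f k).measurable).const_inner.abs).aestronglyMeasurable
      · filter_upwards [hball] with w hw
        rw [Real.norm_eq_abs, abs_abs]
        refine (abs_real_inner_le_norm _ _).trans ?_
        gcongr
        linarith [hfn k w]
    have hb2 : Integrable (fun w => |⟪x, w⟫_ℝ|) μ := integrableOn_ball (by fun_prop)
    have hb3 : Integrable (fun w => ‖f k w - w‖) μ := by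
      refine Integrable.of_bound ?_ 3 ?_
      · exact (((f k).measurable.sub measurable_id).norm).aestronglyMeasurable
      · filter_upwards [hball] with w hw
        rw [norm_norm]
        linarith [norm_sub_le (f k w) w, hfn k w]
    rw [← integral_sub hb1 hb2, ← integral_mul_const]
    refine (abs_integral_le_integral_abs).trans (integral_mono (hb1.sub hb2).abs
      (hb3.mul_const _) fun w => ?_)
    refine (abs_abs_sub_abs_le _ _).trans ?_
    rw [← inner_sub_right, mul_comm]
    exact abs_real_inner_le_norm _ _
  refine ⟨c, hc, fun k => (f k).range, fun k y => μ.real (f k ⁻¹' {y}),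
    fun k y => measureReal_nonneg, hlim, fun Φ hΦ hadd hsmul => ?_⟩
  have h0 : Φ 0 = 0 := by simpa using hadd 0 0
  have h1 : Tendsto (fun k => ∫ w, Φ (sg (f k w)) ∂μ) atTop (𝓝 (∫ w, Φ (sg w) ∂μ)) := by
    obtain ⟨C, hC⟩ := (isCompact_closedBall (0 : En n) 2).exists_bound_of_continuousOn
      (hΦ.comp continuous_sg).continuousOn
    refine tendsto_integral_of_dominated_convergence (fun _ => C) (fun k => ?_)
      (integrable_const _) (fun k => ?_) (ae_of_all _ fun w => ?_)
    · exact ((hΦ.comp continuous_sg).measurable.comp (f k).measurable).aestronglyMeasurable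
    · filter_upwards [hball] with w hw
      exact hC _ (mem_closedBall_zero_iff.2 (by linarith [hfn k w]))
    · exact ((hΦ.comp continuous_sg).tendsto w).comp (hf w)
  have h2 := (hΦ.tendsto _).comp hlim
  rw [hsmul c hc.le] at h2
  exact tendsto_nhds_unique (h1.congr fun k => (hint Φ h0 hadd hsmul k).symm) h2

lemma hyp_segs (hn : 2 ≤ n) (ws : List (En n)) (a : ℕ) (K : ConvexBody (En n))
    (h : a + ws.length + 2 = n) : Hyp (mvQ (Multiset.replicate a K + segs ws)) := by
  induction ws generalizing a K with
  | nil =>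
    refine hyp_of_interior (fun K hK => ?_) K
    have ha : a = n - 2 := by
      rw [List.length_nil] at h
      omega
    rw [segs_nil, add_zero, ha]
    exact hyp_replicate_of_interior hn hK
  | cons w ws ih =>
    rw [List.length_cons] at h
    exact hyp_cons_seg (u := segs ws) (by rw [card_segs]; omega)
      fun c _ => ih (a + 1) (K + c • seg w) (by omega)

lemma mvQ_sg_cons {s : Multiset (ConvexBody (En n))} (hs : s.card + 3 = n) (w : En n) :
    mvQ (sg w ::ₘ s) = mvQ (seg ((2 : ℝ) • w) ::ₘ s) := by
  rw [sg, mvQ_add_cons hs, mvQ_point_cons, zero_add]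

theorem hyp_segs_ballB (hn : 2 ≤ n) (q a : ℕ) (ws : List (En n)) (K : ConvexBody (En n))
    (h : a + ws.length + q + 2 = n) :
    Hyp (mvQ (Multiset.replicate a K + (segs ws + Multiset.replicate q (ballB n)))) := by
  induction q generalizing a ws K with
  | zero => simpa using hyp_segs hn ws a K h
  | succ q ih =>
    refine hyp_of_interior (fun K hK => ?_) K
    set u := Multiset.replicate a K + (segs ws + Multiset.replicate q (ballB n)) with hu
    have hcard : u.card + 3 = n := by simp [hu, card_segs]; omega
    have hKu : Hyp (mvQ (K ::ₘ u)) := by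
      have := ih (a + 1) ws K (by omega)
      rwa [Multiset.replicate_succ, Multiset.cons_add] at this
    have hseg : ∀ w, Hyp (mvQ (seg w ::ₘ u)) := fun w => by
      have := ih a (w :: ws) K (by simp; omega)
      rwa [segs_cons, Multiset.cons_add, Multiset.add_cons] at this
    have hgoal : Multiset.replicate a K + (segs ws + Multiset.replicate (q + 1) (ballB n)) =
        ballB n ::ₘ u := by
      rw [Multiset.replicate_succ, Multiset.add_cons, Multiset.add_cons]
    rw [hgoal]
    obtain ⟨c, hc, s, m, hm, hlim, -⟩ := exists_tendsto_ballB hn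
    have hZ : ∀ ε : ℝ, 0 < ε → ∀ k, ∀ s : Finset (En n),
        (interior ((ε • K + ∑ y ∈ s, m k y • sg y : ConvexBody (En n)) : Set (En n))).Nonempty ∧
        Hyp (mvQ ((ε • K + ∑ y ∈ s, m k y • sg y) ::ₘ u)) := by
      intro ε hε k s
      have hi := fun L => interior_add_nonempty (interior_smul_nonempty hK hε) L
      induction s using Finset.induction_on with
      | empty =>
        refine ⟨hi _, ?_⟩
        rw [Finset.sum_empty, add_zero, mvQ_smul_cons hcard hε.le]
        exact hKu.smul hε.le
      | insert y s hy ih =>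
        refine ⟨hi _, ?_⟩
        rw [Finset.sum_insert hy, add_comm (m k y • sg y), ← add_assoc]
        refine hyp_add_cons hcard ih.1 ih.2 ?_
        rw [mvQ_smul_cons hcard (hm k y), mvQ_sg_cons hcard]
        exact (hseg _).smul (hm k y)
    have h1 : Tendsto (fun k : ℕ => (1 / ((k : ℝ) + 1)) • K + ∑ y ∈ s k, m k y • sg y) atTop
        (𝓝 (c • ballB n)) := by
      have h2 : Tendsto (fun k : ℕ => (1 / ((k : ℝ) + 1)) • K) atTop (𝓝 0) := by
        have := (tendsto_add_smul_zero_right 0 K).comp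
          (tendsto_nhdsWithin_iff.2 ⟨tendsto_one_div_add_atTop_nhds_zero_nat (𝕜 := ℝ),
            Eventually.of_forall fun k => Set.mem_Ioi.2 (by positivity)⟩)
        simpa [Function.comp_def] using this
      simpa using h2.add hlim
    have h3 : Hyp (mvQ ((c • ballB n) ::ₘ u)) :=
      Hyp.of_tendsto (fun x y => tendsto_mv_slot 1 u h1 x y)
        (Eventually.of_forall fun k => (hZ _ (by positivity) k (s k)).2)
    rw [mvQ_smul_cons hcard hc.le] at h3
    have h4 := h3.smul (inv_nonneg.2 hc.le)
    rwa [smul_smul, inv_mul_cancel₀ hc.ne', one_smul] at h4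

/-- The segment `t ↦ (1 - t) K + t L` in the space of convex bodies. -/
def lpath (K L : ConvexBody (En n)) (t : ℝ) : ConvexBody (En n) := (1 - t) • K + t • L

lemma supp_lpath {t : ℝ} (ht : t ∈ Set.Icc (0 : ℝ) 1) (K L : ConvexBody (En n)) (x : En n) :
    supp (lpath K L t) x = (1 - t) * supp K x + t * supp L x := by
  rw [lpath, supp_add, supp_smul (by linarith [ht.2]), supp_smul ht.1]

lemma lpath_zero (K L : ConvexBody (En n)) : lpath K L 0 = K :=
  eq_of_supp_eq fun x => by rw [supp_lpath (by simp)]; ring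

lemma lpath_one (K L : ConvexBody (En n)) : lpath K L 1 = L :=
  eq_of_supp_eq fun x => by rw [supp_lpath (by simp)]; ring

lemma lpath_symm {t : ℝ} (K L : ConvexBody (En n)) : lpath L K (1 - t) = lpath K L t := by
  rw [lpath, lpath, sub_sub_cancel, add_comm]

lemma continuousOn_lpath (K L : ConvexBody (En n)) :
    ContinuousOn (lpath K L) (Set.Icc 0 1) := by
  refine (LipschitzOnWith.of_dist_le_mul (K := nndist K L) fun s hs t ht => ?_).continuousOn
  refine dist_le_of_supp_le (by positivity) fun x => ?_
  rw [supp_lpath hs, supp_lpath ht]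
  have h1 : (1 - s) * supp K x + s * supp L x - ((1 - t) * supp K x + t * supp L x) =
      (t - s) * (supp K x - supp L x) := by ring
  rw [h1, abs_mul, abs_sub_comm, ← Real.dist_eq, coe_nndist]
  have := mul_le_mul_of_nonneg_left (abs_supp_sub_le K L x) (dist_nonneg (x := s) (y := t))
  linarith

lemma interior_lpath_nonempty {K : ConvexBody (En n)} (hK : (interior (K : Set (En n))).Nonempty)
    (L : ConvexBody (En n)) {t : ℝ} (ht : t < 1) :
    (interior (lpath K L t : Set (En n))).Nonempty :=
  interior_add_nonempty (interior_smul_nonempty hK (by linarith)) _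

lemma mvL_lpath {t : ℝ} (ht : t ∈ Set.Icc (0 : ℝ) 1) (K L : ConvexBody (En n))
    {s : Multiset (ConvexBody (En n))} (hs : s.card + 1 = n) :
    mvL s (del (lpath K L t)) = (1 - t) * mvL s (del K) + t * mvL s (del L) := by
  rw [lpath, mvL_del, mv_add_cons hs, mv_smul_cons hs (by linarith [ht.2]), mv_smul_cons hs ht.1,
    mvL_del, mvL_del]

lemma isPath_lpath (K L : ConvexBody (En n)) :
    IsPath (lpath K L) (del L - del K) (Set.Ioo 0 1) := by
  intro t ht t' ht' s hs
  rw [← mvL_del, ← mvL_del, mvL_lpath (Set.Ioo_subset_Icc_self ht) K L hs,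
    mvL_lpath (Set.Ioo_subset_Icc_self ht') K L hs, map_sub]
  ring

lemma mvL_replicate_del (K : ConvexBody (En n)) (m : ℕ) (u : Multiset (ConvexBody (En n))) :
    mvL (Multiset.replicate m K + u) (del K) = mv (Multiset.replicate (m + 1) K + u) := by
  rw [mvL_del, Multiset.replicate_succ, Multiset.cons_add]

lemma mvQ_replicate_del (K : ConvexBody (En n)) (m : ℕ) (u : Multiset (ConvexBody (En n)))
    (x : Formal n) :
    mvQ (Multiset.replicate m K + u) x (del K) = mvL (Multiset.replicate (m + 1) K + u) x := by
  rw [mvQ_del_right, Multiset.replicate_succ, Multiset.cons_add]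

/-- `V(L, N_t[j+1], u) ^ (j+2) / V(N_t[j+2], u) ^ (j+1)` along the segment from `K` to `L`. -/
def minkRatio (j : ℕ) (u : Multiset (ConvexBody (En n))) (K L : ConvexBody (En n)) (t : ℝ) : ℝ :=
  mvL (Multiset.replicate (j + 1) (lpath K L t) + u) (del L) ^ (j + 2) /
    mv (Multiset.replicate (j + 2) (lpath K L t) + u) ^ (j + 1)

lemma minkRatio_zero (j : ℕ) (u : Multiset (ConvexBody (En n))) (K L : ConvexBody (En n)) :
    minkRatio j u K L 0 = mv (L ::ₘ (Multiset.replicate (j + 1) K + u)) ^ (j + 2) /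
      mv (Multiset.replicate (j + 2) K + u) ^ (j + 1) := by
  rw [minkRatio, lpath_zero, mvL_del]

lemma minkRatio_one {j : ℕ} {u : Multiset (ConvexBody (En n))} {K L : ConvexBody (En n)}
    (h : mv (Multiset.replicate (j + 2) L + u) ≠ 0) :
    minkRatio j u K L 1 = mv (Multiset.replicate (j + 2) L + u) := by
  rw [minkRatio, lpath_one, mvL_replicate_del, pow_succ _ (j + 1), mul_comm,
    mul_div_cancel_right₀ _ (pow_ne_zero _ h)]

lemma hasDerivAt_minkRatio {j : ℕ} {u : Multiset (ConvexBody (En n))} (hu : j + u.card + 2 = n)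
    (K L : ConvexBody (En n)) {t : ℝ} (ht : t ∈ Set.Ioo (0 : ℝ) 1)
    (h : mv (Multiset.replicate (j + 2) (lpath K L t) + u) ≠ 0) :
    HasDerivAt (minkRatio j u K L)
      ((j + 1) * (j + 2) * (1 - t) *
        mvL (Multiset.replicate (j + 1) (lpath K L t) + u) (del L) ^ (j + 1)
        * mv (Multiset.replicate (j + 2) (lpath K L t) + u) ^ j *
        (mvQ (Multiset.replicate j (lpath K L t) + u) (del L - del K) (del L - del K) *
          mv (Multiset.replicate (j + 2) (lpath K L t) + u) -
          mvL (Multiset.replicate (j + 1) (lpath K L t) + u) (del L - del K) ^ 2) /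
        (mv (Multiset.replicate (j + 2) (lpath K L t) + u) ^ (j + 1)) ^ 2) t := by
  have hp := isPath_lpath K L
  have d1 := (hp.hasDerivAt isOpen_Ioo ht (j + 2) u (by omega)).fun_pow (j + 1)
  have d2 := (hp.hasDerivAt_mvL isOpen_Ioo ht (j + 1) u (by omega) (del L)).fun_pow (j + 2)
  have d3 := d2.fun_div d1 (pow_ne_zero _ h)
  refine d3.congr_deriv ?_
  congr 1
  have e1 : mvL (Multiset.replicate (j + 1) (lpath K L t) + u) (del L) =
      mv (Multiset.replicate (j + 2) (lpath K L t) + u) +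
        (1 - t) * mvL (Multiset.replicate (j + 1) (lpath K L t) + u) (del L - del K) := by
    rw [← mvL_replicate_del, mvL_lpath (Set.Ioo_subset_Icc_self ht) K L (by simp; omega), map_sub]
    ring
  have e2 : mvQ (Multiset.replicate j (lpath K L t) + u) (del L - del K) (del L) =
      mvL (Multiset.replicate (j + 1) (lpath K L t) + u) (del L - del K) +
        (1 - t) * mvQ (Multiset.replicate j (lpath K L t) + u) (del L - del K) (del L - del K) := by
    have hL : ∀ s : Multiset (ConvexBody (En n)), s.card + 1 = n →
        mvL s (del L) = mvL s (del (lpath K L t) + (1 - t) • (del L - del K)) := fun s hs => by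
      rw [map_add, mvL_lpath (Set.Ioo_subset_Icc_self ht) K L hs, map_smul, map_sub, smul_eq_mul]
      ring
    rw [mvQ_symm, mvQ_congr (by simp; omega) hL, mvQ_symm, map_add, mvQ_replicate_del, map_smul,
      smul_eq_mul]
  simp only [Nat.add_sub_cancel, show j + 2 - 1 = j + 1 from rfl]
  rw [e2]
  generalize mvL (Multiset.replicate (j + 1) (lpath K L t) + u) (del L - del K) = β at *
  generalize mvQ (Multiset.replicate j (lpath K L t) + u) (del L - del K) (del L - del K) = γ at *
  generalize mvL (Multiset.replicate (j + 1) (lpath K L t) + u) (del L) = b at *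
  generalize mv (Multiset.replicate (j + 2) (lpath K L t) + u) = α at *
  have hb : b ^ (j + 2) = b ^ (j + 1) * b := pow_succ _ _
  rw [hb]
  push_cast
  linear_combination -((j : ℝ) + 1) * (j + 2) * b ^ (j + 1) * α ^ j * β * e1

lemma tendsto_mv_slot_pow (m : ℕ) (u : Multiset (ConvexBody (En n))) {α : Type*} {l : Filter α}
    {f : α → ConvexBody (En n)} {K : ConvexBody (En n)} (h : Tendsto f l (𝓝 K)) :
    Tendsto (fun a => mv (Multiset.replicate m (f a) + u)) l
      (𝓝 (mv (Multiset.replicate m K + u))) := by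
  have := tendsto_mv_add (f := fun a (_ : Unit) => f a) (g := fun _ => K)
    (Multiset.replicate m ()) u
    (fun _ => h)
  simpa [Multiset.map_replicate] using this

lemma mv_replicate_pos {m q : ℕ} (h : m + q = n) {K : ConvexBody (En n)}
    (hK : (interior (K : Set (En n))).Nonempty) :
    0 < mv (Multiset.replicate m K + Multiset.replicate q (ballB n)) := by
  have := mv_pos (n := n) (ws := [])
    (s := Multiset.replicate m K + Multiset.replicate q (ballB n)) trivial ?_ (by simpa using h)
  · simpa [segs_nil] using this
  · intro M hM
    rcases Multiset.mem_add.1 hM with hM | hM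
    · rwa [Multiset.eq_of_mem_replicate hM]
    · rw [Multiset.eq_of_mem_replicate hM]
      exact interior_ballB_nonempty

lemma mvQ_mul_mv_le (hn : 2 ≤ n) {j q : ℕ} (h : j + q + 2 = n) (K : ConvexBody (En n))
    (x : Formal n) :
    mvQ (Multiset.replicate j K + Multiset.replicate q (ballB n)) x x *
      mv (Multiset.replicate (j + 2) K + Multiset.replicate q (ballB n)) ≤
      mvL (Multiset.replicate (j + 1) K + Multiset.replicate q (ballB n)) x ^ 2 := by
  have h1 := hyp_segs_ballB hn q j [] K (by simpa using h)
  rw [segs_nil, zero_add] at h1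
  have h2 := h1 x (del K)
  rw [mvQ_replicate_del, mvQ_replicate_del, mvL_replicate_del] at h2
  exact h2 (mv_nonneg (by simp; omega))

lemma continuousOn_minkRatio {j : ℕ} {u : Multiset (ConvexBody (En n))} {K L : ConvexBody (En n)}
    (hω : ∀ t ∈ Set.Icc (0 : ℝ) 1, 0 < mv (Multiset.replicate (j + 2) (lpath K L t) + u)) :
    ContinuousOn (minkRatio j u K L) (Set.Icc 0 1) := by
  intro t ht
  have hc := continuousOn_lpath K L t ht
  refine Tendsto.div (Tendsto.pow ?_ _) (Tendsto.pow ?_ _) (pow_ne_zero _ (hω t ht).ne')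
  · simp only [mvL_del, ← Multiset.add_cons]
    exact tendsto_mv_slot_pow _ _ hc
  · exact tendsto_mv_slot_pow _ _ hc

lemma antitoneOn_minkRatio (hn : 2 ≤ n) {j q : ℕ} (h : j + q + 2 = n) {K L : ConvexBody (En n)}
    (hω : ∀ t ∈ Set.Icc (0 : ℝ) 1,
      0 < mv (Multiset.replicate (j + 2) (lpath K L t) + Multiset.replicate q (ballB n))) :
    AntitoneOn (minkRatio j (Multiset.replicate q (ballB n)) K L) (Set.Icc 0 1) := by
  have hd := fun t (ht : t ∈ Set.Ioo (0 : ℝ) 1) => hasDerivAt_minkRatio (n := n)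
    (u := Multiset.replicate q (ballB n)) (by simpa using h) K L ht
    (hω t (Set.Ioo_subset_Icc_self ht)).ne'
  refine antitoneOn_of_deriv_nonpos (convex_Icc 0 1) (continuousOn_minkRatio hω) ?_ ?_
  · rw [interior_Icc]
    exact fun t ht => (hd t ht).differentiableAt.differentiableWithinAt
  · rw [interior_Icc]
    intro t ht
    rw [(hd t ht).deriv]
    refine div_nonpos_of_nonpos_of_nonneg (mul_nonpos_of_nonneg_of_nonpos ?_ ?_) (by positivity)
    · have h1 := hω t (Set.Ioo_subset_Icc_self ht)
      have h2 : 0 ≤ mvL (Multiset.replicate (j + 1) (lpath K L t) +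
          Multiset.replicate q (ballB n)) (del L) := by
        rw [mvL_del]
        exact mv_nonneg (by simp; omega)
      have h3 : 0 ≤ 1 - t := by linarith [ht.2]
      positivity
    · exact sub_nonpos.2 (mvQ_mul_mv_le hn h _ _)

theorem mv_minkowski (hn : 2 ≤ n) {j q : ℕ} (h : j + q + 2 = n) (K L : ConvexBody (En n)) :
    mv (Multiset.replicate (j + 2) K + Multiset.replicate q (ballB n)) ^ (j + 1) *
      mv (Multiset.replicate (j + 2) L + Multiset.replicate q (ballB n)) ≤
      mv (L ::ₘ (Multiset.replicate (j + 1) K + Multiset.replicate q (ballB n))) ^ (j + 2) := by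
  have key : ∀ K L : ConvexBody (En n), (interior (K : Set (En n))).Nonempty →
      (interior (L : Set (En n))).Nonempty →
      mv (Multiset.replicate (j + 2) K + Multiset.replicate q (ballB n)) ^ (j + 1) *
      mv (Multiset.replicate (j + 2) L + Multiset.replicate q (ballB n)) ≤
      mv (L ::ₘ (Multiset.replicate (j + 1) K + Multiset.replicate q (ballB n))) ^ (j + 2) := by
    intro K L hK hL
    have hpos := fun {K : ConvexBody (En n)} (hK : (interior (K : Set (En n))).Nonempty) =>
      mv_replicate_pos (m := j + 2) (q := q) (by omega) hK
    have h1 := antitoneOn_minkRatio hn h (K := K) (L := L) (fun t ht => hpos (by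
      rcases ht.2.lt_or_eq with h1 | rfl
      · exact interior_lpath_nonempty hK L h1
      · rwa [lpath_one])) (Set.left_mem_Icc.2 zero_le_one) (Set.right_mem_Icc.2 zero_le_one)
      zero_le_one
    rw [minkRatio_zero, minkRatio_one (hpos hL).ne', le_div_iff₀ (pow_pos (hpos hK) _)] at h1
    rwa [mul_comm]
  have hK := tendsto_add_smul_zero_right K (ballB n)
  have hL := tendsto_add_smul_zero_right L (ballB n)
  have hi : ∀ (M : ConvexBody (En n)) (ε : ℝ), 0 < ε →
      (interior ((M + ε • ballB n : ConvexBody (En n)) : Set (En n))).Nonempty := fun M ε hε => by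
    rw [add_comm]
    exact interior_add_nonempty (interior_smul_nonempty interior_ballB_nonempty hε) M
  have h3 : Tendsto (fun ε : ℝ => mv ((L + ε • ballB n) ::ₘ
      (Multiset.replicate (j + 1) (K + ε • ballB n) + Multiset.replicate q (ballB n)))) (𝓝[>] 0)
      (𝓝 (mv (L ::ₘ (Multiset.replicate (j + 1) K + Multiset.replicate q (ballB n))))) := by
    have := tendsto_mv_add (l := 𝓝[>] (0 : ℝ))
      (f := fun ε (b : Bool) => if b then L + ε • ballB n else K + ε • ballB n)
      (g := fun b => if b then L else K) (true ::ₘ Multiset.replicate (j + 1) false)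
      (Multiset.replicate q (ballB n)) (by
        rintro (_ | _)
        · simpa using hK
        · simpa using hL)
    simpa [Multiset.map_replicate] using this
  refine le_of_tendsto_of_tendsto (((tendsto_mv_slot_pow _ _ hK).pow _).mul
    (tendsto_mv_slot_pow _ _ hL)) (h3.pow _) ?_
  filter_upwards [self_mem_nhdsWithin] with ε hε
  exact key _ _ (hi K ε hε) (hi L ε hε)

lemma mv_eq_of_forall_mv_eq (hn : 2 ≤ n) {j q : ℕ} (h : j + q + 2 = n) {K L : ConvexBody (En n)}
    (hK : 0 < mv (Multiset.replicate (j + 2) K + Multiset.replicate q (ballB n)))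
    (hL : 0 < mv (Multiset.replicate (j + 2) L + Multiset.replicate q (ballB n)))
    (he : ∀ M, mv (M ::ₘ (Multiset.replicate (j + 1) L + Multiset.replicate q (ballB n))) =
      mv (M ::ₘ (Multiset.replicate (j + 1) K + Multiset.replicate q (ballB n)))) :
    mv (Multiset.replicate (j + 2) K + Multiset.replicate q (ballB n)) =
      mv (Multiset.replicate (j + 2) L + Multiset.replicate q (ballB n)) := by
  have h1 := mv_minkowski hn h K L
  have h2 := mv_minkowski hn h L K
  rw [← he L, ← Multiset.cons_add, ← Multiset.replicate_succ, pow_succ _ (j + 1),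
    mul_le_mul_iff_left₀ hL] at h1
  rw [he K, ← Multiset.cons_add, ← Multiset.replicate_succ, pow_succ _ (j + 1),
    mul_le_mul_iff_left₀ hK] at h2
  exact le_antisymm (le_of_pow_le_pow_left₀ (by omega) hL.le h1)
    (le_of_pow_le_pow_left₀ (by omega) hK.le h2)

lemma minkRatio_eq_of_forall_mv_eq (hn : 2 ≤ n) {j q : ℕ} (h : j + q + 2 = n)
    {K L : ConvexBody (En n)} (hω : ∀ t ∈ Set.Icc (0 : ℝ) 1,
      0 < mv (Multiset.replicate (j + 2) (lpath K L t) + Multiset.replicate q (ballB n)))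
    (he : ∀ M, mv (M ::ₘ (Multiset.replicate (j + 1) L + Multiset.replicate q (ballB n))) =
      mv (M ::ₘ (Multiset.replicate (j + 1) K + Multiset.replicate q (ballB n))))
    {t : ℝ} (ht : t ∈ Set.Icc (0 : ℝ) 1) :
    minkRatio j (Multiset.replicate q (ballB n)) K L t =
      mv (Multiset.replicate (j + 2) L + Multiset.replicate q (ballB n)) := by
  have hK := hω 0 (by simp)
  have hL := hω 1 (by simp)
  rw [lpath_zero] at hK
  rw [lpath_one] at hL
  have ha := antitoneOn_minkRatio hn h hω
  have h1 := ha ht (Set.right_mem_Icc.2 zero_le_one) ht.2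
  have h0 := ha (Set.left_mem_Icc.2 zero_le_one) ht ht.1
  rw [minkRatio_one hL.ne'] at h1
  rw [minkRatio_zero, ← he L, ← Multiset.cons_add, ← Multiset.replicate_succ,
    mv_eq_of_forall_mv_eq hn h hK hL he, pow_succ _ (j + 1), mul_comm,
    mul_div_cancel_right₀ _ (pow_ne_zero _ hL.ne')] at h0
  exact le_antisymm h0 h1

lemma mvL_mvQ_eq_zero_of_forall_mv_eq (hn : 2 ≤ n) {j q : ℕ} (h : j + q + 2 = n)
    {K L : ConvexBody (En n)} (hω : ∀ t ∈ Set.Icc (0 : ℝ) 1,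
      0 < mv (Multiset.replicate (j + 2) (lpath K L t) + Multiset.replicate q (ballB n)))
    (he : ∀ M, mv (M ::ₘ (Multiset.replicate (j + 1) L + Multiset.replicate q (ballB n))) =
      mv (M ::ₘ (Multiset.replicate (j + 1) K + Multiset.replicate q (ballB n))))
    {t : ℝ} (ht : t ∈ Set.Ioo (0 : ℝ) 1) :
    mvL (Multiset.replicate (j + 1) (lpath K L t) + Multiset.replicate q (ballB n))
      (del L - del K) = 0 ∧
    mvQ (Multiset.replicate j (lpath K L t) + Multiset.replicate q (ballB n))
      (del L - del K) (del L - del K) = 0 := by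
  have htI := Set.Ioo_subset_Icc_self ht
  have hω' : ∀ t ∈ Set.Icc (0 : ℝ) 1,
      0 < mv (Multiset.replicate (j + 2) (lpath L K t) + Multiset.replicate q (ballB n)) := by
    intro t ht
    have := hω (1 - t) ⟨by linarith [ht.2], by linarith [ht.1]⟩
    rwa [lpath_symm] at this
  have hK := hω 0 (by simp)
  have hL := hω 1 (by simp)
  rw [lpath_zero] at hK
  rw [lpath_one] at hL
  have hα := hω t htI
  have r1 := minkRatio_eq_of_forall_mv_eq hn h hω he htI
  have r2 := minkRatio_eq_of_forall_mv_eq hn h hω' (fun M => (he M).symm)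
    (t := 1 - t) ⟨by linarith [ht.2], by linarith [ht.1]⟩
  have hWe := mv_eq_of_forall_mv_eq hn h hK hL he
  have hd := hasDerivAt_minkRatio (n := n) (u := Multiset.replicate q (ballB n)) (by simpa using h)
    K L ht hα.ne'
  rw [hWe, ← r1, minkRatio, minkRatio, lpath_symm, div_left_inj' (pow_ne_zero _ hα.ne')] at r2
  have hnn : ∀ M, 0 ≤ mvL (Multiset.replicate (j + 1) (lpath K L t) +
      Multiset.replicate q (ballB n)) (del M) := fun M => by
    rw [mvL_del]
    exact mv_nonneg (by simp; omega)
  have hβ := (pow_left_inj₀ (hnn K) (hnn L) (by omega)).1 r2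
  have hβ0 : mvL (Multiset.replicate (j + 1) (lpath K L t) + Multiset.replicate q (ballB n))
      (del L - del K) = 0 := by rw [map_sub, hβ, sub_self]
  refine ⟨hβ0, ?_⟩
  have hb : mvL (Multiset.replicate (j + 1) (lpath K L t) + Multiset.replicate q (ballB n))
      (del L) ≠ 0 := by
    intro h0
    rw [minkRatio, h0, zero_pow (by omega), zero_div] at r1
    exact hL.ne r1
  have hconst : minkRatio j (Multiset.replicate q (ballB n)) K L =ᶠ[𝓝 t] fun _ =>
      mv (Multiset.replicate (j + 2) L + Multiset.replicate q (ballB n)) := by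
    filter_upwards [isOpen_Ioo.mem_nhds ht] with s hs
    exact minkRatio_eq_of_forall_mv_eq hn h hω he (Set.Ioo_subset_Icc_self hs)
  have h0 := hd.unique ((hasDerivAt_const t _).congr_of_eventuallyEq hconst)
  rw [hβ0, div_eq_zero_iff, or_iff_left (pow_ne_zero _ (pow_ne_zero _ hα.ne'))] at h0
  have h1t : 1 - t ≠ 0 := by linarith [ht.2]
  have hj1 : (j : ℝ) + 1 ≠ 0 := by positivity
  have hj2 : (j : ℝ) + 2 ≠ 0 := by positivity
  have h2 := (mul_eq_zero.1 h0).resolve_left (mul_ne_zero (mul_ne_zero (mul_ne_zero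
    (mul_ne_zero hj1 hj2) h1t) (pow_ne_zero _ hb)) (pow_ne_zero _ hα.ne'))
  rw [zero_pow two_ne_zero, sub_zero] at h2
  exact (mul_eq_zero.1 h2).resolve_right hα.ne'

lemma mvQ_path_segs_eq_zero (hn : 2 ≤ n) {q : ℕ} {K L : ConvexBody (En n)}
    (hK : (interior (K : Set (En n))).Nonempty) (ws : List (En n)) (hw : Indep ws) (a : ℕ)
    (h : a + ws.length + q + 2 = n)
    (h0 : ∀ t ∈ Set.Ioo (0 : ℝ) 1, ∀ y, mvQ (Multiset.replicate (a + ws.length) (lpath K L t) +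
      Multiset.replicate q (ballB n)) (del L - del K) y = 0)
    {t : ℝ} (ht : t ∈ Set.Ioo (0 : ℝ) 1) (y : Formal n) :
    mvQ (Multiset.replicate a (lpath K L t) + (segs ws + Multiset.replicate q (ballB n)))
      (del L - del K) y = 0 := by
  induction ws generalizing a t y with
  | nil => simpa [segs_nil] using h0 t ht y
  | cons w ws ih =>
    rw [List.length_cons] at h h0
    have ih' := fun {t} (ht : t ∈ Set.Ioo (0 : ℝ) 1) y => ih hw.2 (a + 1) (by omega) (by
      rwa [add_assoc, add_comm 1]) (t := t) ht y
    set u := segs ws + Multiset.replicate q (ballB n) with hu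
    have hcard : u.card = ws.length + q := by simp [hu, card_segs]
    rw [segs_cons, Multiset.cons_add, ← hu]
    have hfun : ∀ t ∈ Set.Ioo (0 : ℝ) 1,
        mvL (Multiset.replicate (a + 1) (lpath K L t) + seg w ::ₘ u) (del L - del K) = 0 := by
      intro t ht
      have := ih' ht (del (seg w))
      rwa [mvQ_del_right, ← Multiset.add_cons] at this
    have hyp := hyp_segs_ballB hn q a (w :: ws) (lpath K L t) (by simp; omega)
    rw [segs_cons, Multiset.cons_add, ← hu] at hyp
    refine hyp.eq_zero (mvQ_symm _) (e := del (lpath K L t)) ?_ ?_ ?_ y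
    · rw [mvQ_replicate_del, mvL_replicate_del]
      have := mv_pos hw (s := Multiset.replicate (a + 2) (lpath K L t) +
        Multiset.replicate q (ballB n)) ?_ (by simp; omega)
      · rwa [segs_cons, add_assoc, Multiset.add_cons, add_comm _ (segs ws), ← hu] at this
      · intro M hM
        rcases Multiset.mem_add.1 hM with hM | hM
        · rw [Multiset.eq_of_mem_replicate hM]
          exact interior_lpath_nonempty hK L ht.2
        · rw [Multiset.eq_of_mem_replicate hM]
          exact interior_ballB_nonempty
    · rw [mvQ_replicate_del]
      exact hfun t ht
    · have hd := (isPath_lpath K L).hasDerivAt_mvL isOpen_Ioo ht (a + 1) (seg w ::ₘ u)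
        (by simp; omega) (del L - del K)
      have hz : (fun t => mvL (Multiset.replicate (a + 1) (lpath K L t) + seg w ::ₘ u)
          (del L - del K)) =ᶠ[𝓝 t] fun _ => 0 := by
        filter_upwards [isOpen_Ioo.mem_nhds ht] with s hs using hfun s hs
      have h1 := hd.unique ((hasDerivAt_const t (0 : ℝ)).congr_of_eventuallyEq hz)
      rw [Nat.add_sub_cancel] at h1
      exact (mul_eq_zero.1 h1).resolve_left (by positivity)

lemma seg_smul {c : ℝ} (hc : 0 ≤ c) (w : En n) : seg (c • w) = c • seg w :=
  eq_of_supp_eq fun x => by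
    rw [supp_smul hc, supp_seg, supp_seg, real_inner_smul_right, mul_max_of_nonneg _ _ hc, mul_zero]

lemma mvQ_seg_self_nonpos (hn : 2 ≤ n) {q : ℕ} {ws : List (En n)} (h : ws.length + q + 3 = n)
    {x : Formal n}
    (hB : ∀ y, mvQ (ballB n ::ₘ (segs ws + Multiset.replicate q (ballB n))) x y = 0) (v : En n) :
    mvQ (seg v ::ₘ (segs ws + Multiset.replicate q (ballB n))) x x ≤ 0 := by
  set u := segs ws + Multiset.replicate q (ballB n) with hu
  have hcard : u.card + 3 = n := by simp [hu, card_segs]; omega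
  have hyp := hyp_segs_ballB hn q 0 (v :: ws) 0 (by simp; omega)
  rw [Multiset.replicate_zero, zero_add, segs_cons, Multiset.cons_add, ← hu] at hyp
  have hnn := mv_nonneg (s := ballB n ::ₘ ballB n ::ₘ seg v ::ₘ u) (by simp; omega)
  rcases hnn.eq_or_lt with h0 | h0
  · rw [mvQ_eq_zero interior_ballB_nonempty (by simp; omega) h0.symm]
    simp
  · refine hyp.nonpos (e := del (ballB n)) (by rwa [mvQ_del, mvL_del]) ?_
    rw [mvQ_del_right, Multiset.cons_swap, ← mvQ_del_right]
    exact hB _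

lemma mvQ_segs_step (hn : 2 ≤ n) {q : ℕ} (hq : q + 3 ≤ n) {x : Formal n}
    (hx : ∀ ws : List (En n), Indep ws → ws.length + (q + 1) + 2 = n → ∀ y,
      mvQ (segs ws + Multiset.replicate (q + 1) (ballB n)) x y = 0)
    {ws : List (En n)} (hw : Indep ws) (h : ws.length + q + 2 = n) (y : Formal n) :
    mvQ (segs ws + Multiset.replicate q (ballB n)) x y = 0 := by
  rcases ws with _ | ⟨w, ws⟩
  · rw [List.length_nil] at h
    omega
  rw [List.length_cons] at h
  have hB : ∀ y, mvQ (ballB n ::ₘ (segs ws + Multiset.replicate q (ballB n))) x y = 0 := fun y => by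
    have := hx ws hw.2 (by omega) y
    rwa [Multiset.replicate_succ, Multiset.add_cons] at this
  have hneg := mvQ_seg_self_nonpos hn (by omega) hB
  have hyp := hyp_segs_ballB hn q 0 (w :: ws) 0 (by simp; omega)
  have hpos := mv_pos hw (s := Multiset.replicate (2 + q) (ballB n)) (fun M hM => by
    rw [Multiset.eq_of_mem_replicate hM]
    exact interior_ballB_nonempty) (by simp; omega)
  rw [Multiset.replicate_add, add_assoc, add_comm _ (segs _)] at hpos
  rw [Multiset.replicate_zero, zero_add] at hyp
  rw [segs_cons, Multiset.cons_add] at hyp hpos ⊢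
  set u := segs ws + Multiset.replicate q (ballB n) with hu
  have hcard : u.card + 3 = n := by simp [hu, card_segs]; omega
  set Φ : ConvexBody (En n) → ℝ := fun A => mvQ (A ::ₘ u) x x with hΦ
  have hΦc : Continuous Φ := continuous_iff_continuousAt.2 fun A =>
    tendsto_mv_slot 1 u tendsto_id x x
  obtain ⟨c, hc, s, m, -, -, hint⟩ := exists_tendsto_ballB hn
  have hI := hint Φ hΦc (fun A B => by simp [hΦ, mvQ_add_cons hcard])
    (fun a ha A => by simp [hΦ, mvQ_smul_cons hcard ha])
  have hΦB : Φ (ballB n) = 0 := hB x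
  rw [hΦB, mul_zero] at hI
  have hsg : ∀ v, Φ (sg v) = Φ (seg ((2 : ℝ) • v)) := fun v => by simp [hΦ, mvQ_sg_cons hcard]
  have hcont : Continuous fun v => -Φ (sg v) := (hΦc.comp continuous_sg).neg
  have hae : (fun v => -Φ (sg v)) =ᵐ[volume.restrict (ball (0 : En n) 1)] 0 := by
    refine (integral_eq_zero_iff_of_nonneg (fun v => ?_) (integrableOn_ball hcont)).1 ?_
    · rw [Pi.zero_apply, hsg]
      exact neg_nonneg.2 (hneg _)
    · rw [integral_neg, hI, neg_zero]
  have heq := Measure.eqOn_open_of_ae_eq hae isOpen_ball hcont.continuousOn continuousOn_const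
  have hr : 0 < (1 + ‖w‖)⁻¹ := by positivity
  have hwr := heq (x := (1 + ‖w‖)⁻¹ • w) (by
    rw [mem_ball_zero_iff, norm_smul, Real.norm_of_nonneg hr.le, inv_mul_lt_iff₀ (by positivity)]
    linarith)
  have hw0 : mvQ (seg w ::ₘ u) x x = 0 := by
    simp only [hsg, smul_smul, Pi.zero_apply, neg_eq_zero] at hwr
    rw [seg_smul (by positivity)] at hwr
    simp only [hΦ] at hwr
    rw [mvQ_smul_cons hcard (by positivity), LinearMap.smul_apply, LinearMap.smul_apply,
      smul_eq_mul] at hwr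
    exact (mul_eq_zero.1 hwr).resolve_left (by positivity)
  refine hyp.eq_zero (mvQ_symm _) (e := del (ballB n)) ?_ ?_ hw0 y
  · rw [mvQ_del, mvL_del]
    rw [Multiset.cons_swap (ballB n) (seg w), Multiset.cons_swap (ballB n) (seg w)]
    simpa [Multiset.replicate_succ] using hpos
  · rw [mvQ_del_right, Multiset.cons_swap, ← mvQ_del_right]
    exact hB _

lemma mvQ_segs_eq_zero (hn : 2 ≤ n) {q : ℕ} (hq : q + 2 ≤ n) {x : Formal n}
    (hx : ∀ ws : List (En n), Indep ws → ws.length + q + 2 = n → ∀ y,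
      mvQ (segs ws + Multiset.replicate q (ballB n)) x y = 0)
    {ws : List (En n)} (hw : Indep ws) (h : ws.length + 2 = n) (y : Formal n) :
    mvQ (segs ws) x y = 0 := by
  induction q with
  | zero => simpa using hx ws hw (by omega) y
  | succ q ih => exact ih (by omega) fun ws hw h y => mvQ_segs_step hn (by omega) hx hw h y

theorem mv_segs_eq_of_forall_mv_eq (hn : 2 ≤ n) {j q : ℕ} (h : j + q + 2 = n)
    {K L : ConvexBody (En n)} (hK : (interior (K : Set (En n))).Nonempty)
    (hL : 0 < mv (Multiset.replicate (j + 2) L + Multiset.replicate q (ballB n)))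
    (he : ∀ M, mv (M ::ₘ (Multiset.replicate (j + 1) L + Multiset.replicate q (ballB n))) =
      mv (M ::ₘ (Multiset.replicate (j + 1) K + Multiset.replicate q (ballB n))))
    {ws : List (En n)} (hw : Indep ws) (hl : ws.length + 2 = n) (M : ConvexBody (En n)) :
    mv (L ::ₘ M ::ₘ segs ws) = mv (K ::ₘ M ::ₘ segs ws) := by
  have hω : ∀ t ∈ Set.Icc (0 : ℝ) 1,
      0 < mv (Multiset.replicate (j + 2) (lpath K L t) + Multiset.replicate q (ballB n)) := by
    intro t ht
    rcases ht.2.lt_or_eq with h1 | rfl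
    · exact mv_replicate_pos (by omega) (interior_lpath_nonempty hK L h1)
    · rwa [lpath_one]
  have h0 : ∀ t ∈ Set.Ioo (0 : ℝ) 1, ∀ y, mvQ (Multiset.replicate j (lpath K L t) +
      Multiset.replicate q (ballB n)) (del L - del K) y = 0 := by
    intro t ht y
    obtain ⟨h1, h2⟩ := mvL_mvQ_eq_zero_of_forall_mv_eq hn h hω he ht
    have hyp := hyp_segs_ballB hn q j [] (lpath K L t) (by simpa using h)
    rw [segs_nil, zero_add] at hyp
    refine hyp.eq_zero (mvQ_symm _) (e := del (lpath K L t)) ?_ ?_ h2 y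
    · rw [mvQ_replicate_del, mvL_replicate_del]
      exact hω t (Set.Ioo_subset_Icc_self ht)
    · rwa [mvQ_replicate_del]
  have h1 := mvQ_segs_eq_zero hn (x := del L - del K) (q := q) (by omega) (fun ws hw hl y => by
    have := mvQ_path_segs_eq_zero (K := K) (L := L) hn hK ws hw 0 (q := q) (by omega)
      (by rwa [zero_add, show ws.length = j by omega]) (t := 2⁻¹) (by norm_num) y
    simpa using this) hw hl (del M)
  rw [map_sub, LinearMap.sub_apply, mvQ_del, mvQ_del, mvL_del, mvL_del, Multiset.cons_swap M,
    Multiset.cons_swap M] at h1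
  linarith

lemma mv_replicate_point_add_smul (m : ℕ) (x : En n) {c : ℝ} (hc : 0 ≤ c) (K : ConvexBody (En n))
    {u : Multiset (ConvexBody (En n))} (h : m + u.card = n) :
    mv (Multiset.replicate m (point x + c • K) + u) = c ^ m * mv (Multiset.replicate m K + u) := by
  induction m generalizing u with
  | zero => simp
  | succ m ih =>
    rw [Multiset.replicate_succ, Multiset.cons_add, mv_point_add_cons (by simp; omega),
      mv_smul_cons (by simp; omega) hc, ← Multiset.add_cons, ih (by simp; omega),
      Multiset.replicate_succ, Multiset.cons_add, ← Multiset.add_cons, pow_succ]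
    ring

/-- `a', b'` is the basis dual to `a, b` of a plane, and `vs` is a basis of its orthogonal
complement. -/
structure Frame (a b a' b' : En n) (vs : List (En n)) : Prop where
  aa : ⟪a, a'⟫_ℝ = 1
  ab : ⟪a, b'⟫_ℝ = 0
  ba : ⟪b, a'⟫_ℝ = 0
  bb : ⟪b, b'⟫_ℝ = 1
  mem : ∀ x, x ∈ wspan vs ↔ ⟪a, x⟫_ℝ = 0 ∧ ⟪b, x⟫_ℝ = 0
  indep : Indep vs
  len : vs.length + 2 = n

lemma exists_indep_wspan (W : Submodule ℝ (En n)) : ∃ ws, Indep ws ∧ wspan ws = W := by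
  have key : ∀ k, k ≤ Module.finrank ℝ W → ∃ ws, Indep ws ∧ wspan ws ≤ W ∧ ws.length = k := by
    intro k
    induction k with
    | zero => exact fun _ => ⟨[], trivial, bot_le, rfl⟩
    | succ k ih =>
      intro hk
      obtain ⟨ws, h, hle, hl⟩ := ih (by omega)
      have hne : ¬ W ≤ wspan ws := fun hW => by
        have := Submodule.finrank_mono hW
        rw [h.finrank] at this
        omega
      obtain ⟨w, hw, hw'⟩ := SetLike.not_le_iff_exists.1 hne
      exact ⟨w :: ws, ⟨hw', h⟩, sup_le hle ((Submodule.span_singleton_le_iff_mem _ _).2 hw), by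
        simp [hl]⟩
  obtain ⟨ws, h, hle, hl⟩ := key _ le_rfl
  exact ⟨ws, h, Submodule.eq_of_le_of_finrank_eq hle (by rw [h.finrank, hl])⟩

lemma exists_frame {a b : En n} (h : ‖a‖ ^ 2 * ‖b‖ ^ 2 - ⟪a, b⟫_ℝ ^ 2 ≠ 0) :
    ∃ a' b' vs, Frame a b a' b' vs := by
  have hab : Indep [b, a] := by
    refine ⟨fun hb => h ?_, fun ha => h ?_, trivial⟩
    · obtain ⟨t, rfl⟩ : ∃ t : ℝ, t • a = b := by
        simpa [wspan, Submodule.mem_span_singleton] using hb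
      rw [norm_smul, real_inner_smul_right, real_inner_self_eq_norm_sq, mul_pow, Real.norm_eq_abs,
        sq_abs]
      ring
    · obtain rfl : a = 0 := by simpa [wspan] using ha
      simp
  have hsup : ∀ x, x ∈ (wspan [b, a])ᗮ ↔ ⟪a, x⟫_ℝ = 0 ∧ ⟪b, x⟫_ℝ = 0 := fun x => by
    simp only [wspan, bot_sup_eq, ← Submodule.inf_orthogonal, Submodule.mem_inf,
      Submodule.mem_orthogonal_singleton_iff_inner_right]
  obtain ⟨vs, hvs, hW⟩ := exists_indep_wspan (wspan [b, a])ᗮ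
  have hl := Submodule.finrank_add_finrank_orthogonal (wspan [b, a])
  rw [hab.finrank, ← hW, hvs.finrank] at hl
  set D := ‖a‖ ^ 2 * ‖b‖ ^ 2 - ⟪a, b⟫_ℝ ^ 2 with hD
  refine ⟨D⁻¹ • (‖b‖ ^ 2 • a - ⟪a, b⟫_ℝ • b), D⁻¹ • (‖a‖ ^ 2 • b - ⟪a, b⟫_ℝ • a), vs,
    ⟨?_, ?_, ?_, ?_, fun x => by rw [hW, hsup], hvs, by simp at hl; omega⟩⟩
  all_goals
    simp only [inner_smul_right, inner_sub_right, real_inner_self_eq_norm_sq,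
      real_inner_comm a b]
    (field_simp; linear_combination -hD)

lemma Frame.indep_cons {a b a' b' : En n} {vs : List (En n)} (F : Frame a b a' b' vs) :
    Indep (a' :: b' :: vs) := by
  refine ⟨fun h => ?_, fun h => ?_, F.indep⟩
  · obtain ⟨x, hx, y, hy, hxy⟩ := Submodule.mem_sup.1 h
    obtain ⟨t, rfl⟩ := Submodule.mem_span_singleton.1 hy
    have := congrArg (fun z => ⟪a, z⟫_ℝ) hxy
    simp [inner_add_right, inner_smul_right, ((F.mem x).1 hx).1, F.ab, F.aa] at this
  · have := ((F.mem _).1 h).2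
    simp [F.bb] at this

/-- The triangle with vertices `0, a, b`. -/
def tri (a b : En n) : ConvexBody (En n) where
  carrier := (fun p : ℝ × ℝ => p.1 • a + p.2 • b) '' {p | 0 ≤ p.1 ∧ 0 ≤ p.2 ∧ p.1 + p.2 ≤ 1}
  convex' := by
    rintro _ ⟨p, ⟨h1, h2, h3⟩, rfl⟩ _ ⟨q, ⟨h4, h5, h6⟩, rfl⟩ s t hs ht hst
    refine ⟨s • p + t • q, ⟨?_, ?_, ?_⟩, ?_⟩
    · exact add_nonneg (mul_nonneg hs h1) (mul_nonneg ht h4)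
    · exact add_nonneg (mul_nonneg hs h2) (mul_nonneg ht h5)
    · simp only [Prod.fst_add, Prod.snd_add, Prod.smul_fst, Prod.smul_snd, smul_eq_mul]
      nlinarith
    · simp only [Prod.fst_add, Prod.snd_add, Prod.smul_fst, Prod.smul_snd, smul_eq_mul]
      module
  isCompact' := by
    refine IsCompact.image ?_ (by fun_prop)
    refine (isCompact_Icc (a := (0 : ℝ × ℝ)) (b := 1)).of_isClosed_subset ?_ ?_
    · exact (isClosed_le continuous_const continuous_fst).inter
        ((isClosed_le continuous_const continuous_snd).inter
          (isClosed_le (continuous_fst.add continuous_snd) continuous_const))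
    · rintro p ⟨h1, h2, h3⟩
      exact ⟨⟨h1, h2⟩, ⟨show p.1 ≤ 1 by linarith, show p.2 ≤ 1 by linarith⟩⟩
  nonempty' := ⟨_, 0, by simp, rfl⟩

lemma mem_smul_tri {a b x : En n} {r : ℝ} (hr : 0 ≤ r) :
    x ∈ r • tri a b ↔ ∃ s t : ℝ, 0 ≤ s ∧ 0 ≤ t ∧ s + t ≤ r ∧ s • a + t • b = x := by
  rw [mem_smul_iff]
  constructor
  · rintro ⟨_, ⟨p, ⟨h1, h2, h3⟩, rfl⟩, rfl⟩
    exact ⟨r * p.1, r * p.2, by positivity, by positivity, by nlinarith, by module⟩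
  · rintro ⟨s, t, hs, ht, hst, rfl⟩
    rcases hr.eq_or_lt with rfl | hr
    · refine ⟨_, ⟨0, by simp, rfl⟩, ?_⟩
      rw [show s = 0 by linarith, show t = 0 by linarith]
      simp
    refine ⟨_, ⟨(s / r, t / r), ⟨by positivity, by positivity, ?_⟩, rfl⟩, ?_⟩
    · rw [← add_div, div_le_one hr]
      exact hst
    · simp only [smul_add, smul_smul, mul_div_cancel₀ _ hr.ne']

lemma mem_tri {a b x : En n} :
    x ∈ tri a b ↔ ∃ s t : ℝ, 0 ≤ s ∧ 0 ≤ t ∧ s + t ≤ 1 ∧ s • a + t • b = x := by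
  rw [← mem_smul_tri zero_le_one, one_smul]

lemma Frame.mv_tri_pos {a b a' b' : En n} {vs : List (En n)} (F : Frame a b a' b' vs) :
    0 < mv (tri a' b' ::ₘ tri a' b' ::ₘ segs vs) := by
  have hl := F.len
  have h := mv_pos (s := 0) F.indep_cons (by simp) (by simpa using hl)
  rw [zero_add, segs_cons, segs_cons] at h
  refine h.trans_le ?_
  have h0 : (0 : En n) ∈ tri a' b' := mem_tri.2 ⟨0, 0, by simp⟩
  have h1 : seg a' ≤ tri a' b' := seg_le h0 (mem_tri.2 ⟨1, 0, by simp⟩)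
  have h2 : seg b' ≤ tri a' b' := seg_le h0 (mem_tri.2 ⟨0, 1, by simp⟩)
  have hc : (segs vs).card + 2 = n := by rw [card_segs, hl]
  calc mv (seg a' ::ₘ seg b' ::ₘ segs vs)
      ≤ mv (tri a' b' ::ₘ seg b' ::ₘ segs vs) := mv_mono_cons (by simpa using hc) h1
    _ = mv (seg b' ::ₘ tri a' b' ::ₘ segs vs) := by rw [Multiset.cons_swap]
    _ ≤ mv (tri a' b' ::ₘ tri a' b' ::ₘ segs vs) := mv_mono_cons (by simpa using hc) h2

lemma mv_replicate_add_zono {C : ConvexBody (En n)}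
    (hC : ∀ u : Multiset (ConvexBody (En n)), u.card + 3 = n → mv (C ::ₘ C ::ₘ C ::ₘ u) = 0)
    (ws : List (En n)) {m : ℕ} (u : Multiset (ConvexBody (En n))) (hm : m + u.card = n) :
    (ws.length + 2 < m → mv (Multiset.replicate m (C + zono ws) + u) = 0) ∧
      (m = ws.length + 2 → mv (Multiset.replicate m (C + zono ws) + u) =
        m.factorial / 2 * mv (C ::ₘ C ::ₘ (segs ws + u))) := by
  induction ws generalizing m u with
  | nil =>
    rw [show zono ([] : List (En n)) = 0 from rfl, add_zero]
    refine ⟨fun h => ?_, ?_⟩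
    · obtain ⟨k, rfl⟩ : ∃ k, m = k + 3 := ⟨m - 3, by simp at h; omega⟩
      simp only [Multiset.replicate_succ, Multiset.cons_add]
      exact hC _ (by simp; omega)
    · rintro rfl
      simp [segs_nil, Multiset.replicate_succ]
  | cons w ws ih =>
    have h := mv_replicate_add_seg (C + zono ws) w m hm zero_le_one
    rw [one_smul, one_mul, add_right_comm, add_assoc, ← zono_cons] at h
    rw [h, List.length_cons, ← Multiset.add_cons]
    refine ⟨fun hl => ?_, ?_⟩
    · rw [(ih u hm).1 (by omega), (ih _ (by simp; omega)).1 (by omega)]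
      simp
    · rintro rfl
      rw [(ih u hm).1 (by omega), (ih _ (by simp; omega)).2 (by omega), segs_cons,
        Multiset.cons_add, Multiset.add_cons, show ws.length + 1 + 2 - 1 = ws.length + 2 by omega,
        show ws.length + 1 + 2 = (ws.length + 2) + 1 by omega, Nat.factorial_succ (ws.length + 2)]
      push_cast
      ring

lemma mv_planar {a b a' b' : En n} {C : ConvexBody (En n)}
    (hC : ∀ z ∈ C, ⟪a, z⟫_ℝ • a' + ⟪b, z⟫_ℝ • b' = z)
    (u : Multiset (ConvexBody (En n))) (hu : u.card + 3 = n) : mv (C ::ₘ C ::ₘ C ::ₘ u) = 0 := by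
  obtain ⟨R, hR, hb⟩ := exists_norm_le C
  set S := (‖a‖ + ‖b‖) * R with hS
  have hS0 : 0 ≤ S := by positivity
  have hle : C ≤ point (-(S • a' + S • b')) + (2 * S) • zono [a', b'] := fun z hz => by
    have h1 := abs_real_inner_le_norm a z
    have h2 := abs_real_inner_le_norm b z
    have h3 : ‖a‖ * ‖z‖ ≤ S := by
      have := hb z hz
      rw [hS]
      gcongr
      linarith [norm_nonneg b]
    have h4 : ‖b‖ * ‖z‖ ≤ S := by
      have := hb z hz
      rw [hS]
      gcongr
      linarith [norm_nonneg a]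
    have h5 := abs_le.1 (h1.trans h3)
    have h6 := abs_le.1 (h2.trans h4)
    have hseg : ∀ (e : En n) (x : ℝ), 0 ≤ x → x ≤ 2 * S → x • e ∈ (2 * S) • seg e := by
      intro e x hx hx'
      rcases (mul_nonneg zero_le_two hS0).eq_or_lt with h0 | h0
      · rw [← h0, zero_smul_body, show x = 0 by linarith, zero_smul]
        exact Set.mem_singleton _
      · exact mem_smul_iff.2 ⟨(x / (2 * S)) • e, mem_seg.2 ⟨_, ⟨by positivity,
          (div_le_one h0).2 hx'⟩, rfl⟩, by rw [smul_smul, mul_div_cancel₀ _ h0.ne']⟩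
    refine mem_add_iff.2 ⟨_, mem_point.2 rfl, (⟪a, z⟫_ℝ + S) • a' + (⟪b, z⟫_ℝ + S) • b', ?_, ?_⟩
    · rw [zono_cons, zono_cons, show zono ([] : List (En n)) = 0 from rfl, add_zero, smul_add_body]
      exact mem_add_iff.2 ⟨_, hseg _ _ (by linarith) (by linarith), _,
        hseg _ _ (by linarith) (by linarith), rfl⟩
    · conv_rhs => rw [← hC z hz]
      module
  refine le_antisymm ?_ (mv_nonneg (by simp; omega))
  have h := mv_le_replicate (s := Multiset.replicate 3 C) (u := u)
    (fun K hK => (Multiset.eq_of_mem_replicate hK).trans_le hle) (by simp; omega)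
  rw [Multiset.card_replicate, mv_replicate_point_add_smul _ _ (by positivity) _ (by omega),
    mv_replicate_zono_eq_zero _ (by simp) _ (by omega), mul_zero] at h
  simpa [Multiset.replicate_succ] using h

lemma Frame.vol_planar {a b a' b' : En n} {vs : List (En n)} (F : Frame a b a' b' vs)
    {C : ConvexBody (En n)} (hC : ∀ z ∈ C, ⟪a, z⟫_ℝ • a' + ⟪b, z⟫_ℝ • b' = z) :
    vol (C + zono vs) = n.factorial / 2 * mv (C ::ₘ C ::ₘ segs vs) := by
  have := (mv_replicate_add_zono (mv_planar hC) vs (m := n) 0 (by simp)).2 F.len.symm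
  rwa [add_zero, add_zero, mv_replicate] at this

lemma mv_zono_cons_eq_zero {vs : List (En n)} (hl : vs.length + 2 = n) (M : ConvexBody (En n))
    {ws : List (En n)} (hw : ∀ w ∈ ws, w ∈ vs) : mv (zono ws ::ₘ M ::ₘ segs vs) = 0 := by
  induction ws with
  | nil => exact mv_zero_cons _
  | cons w ws ih =>
    rw [zono_cons, mv_add_cons (by simp [card_segs, hl]), ih fun x hx => hw x (by simp [hx]),
      add_zero]
    obtain ⟨t, ht⟩ := Multiset.exists_cons_of_mem
      (show seg w ∈ segs vs from Multiset.mem_coe.2 (List.mem_map_of_mem (hw w (by simp))))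
    have hc := card_segs vs
    rw [ht, Multiset.card_cons] at hc
    rw [ht, Multiset.cons_swap M]
    exact mv_seg_seg _ (by simp; omega)

lemma Frame.exists_le_zono {a b a' b' : En n} {vs : List (En n)} (F : Frame a b a' b' vs)
    (R : ℝ) : ∃ c : ℝ, ∃ z₀, 0 ≤ c ∧ ∀ x ∈ wspan vs, ‖x‖ ≤ R → x ∈ c • (point z₀ + zono vs) := by
  obtain ⟨x₀, hx₀⟩ := F.indep_cons.interior_zono (by simpa using F.len)
  obtain ⟨r, hr, hb⟩ := Metric.isOpen_iff.1 isOpen_interior x₀ hx₀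
  have hz : ∀ ws : List (En n), (∀ w ∈ ws, w ∈ wspan vs) → ∀ z ∈ zono ws, z ∈ wspan vs := by
    intro ws
    induction ws with
    | nil =>
      rintro - z rfl
      exact zero_mem _
    | cons w ws ih =>
      intro h z hz
      rw [zono_cons] at hz
      obtain ⟨_, h1, y, hy, rfl⟩ := mem_add_iff.1 hz
      obtain ⟨t, -, rfl⟩ := mem_seg.1 h1
      exact add_mem (Submodule.smul_mem _ _ (h w (by simp)))
        (ih (fun x hx => h x (by simp [hx])) y hy)
  have hmem : ∀ ws : List (En n), ∀ w ∈ ws, w ∈ wspan ws := by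
    intro ws
    induction ws with
    | nil => simp
    | cons v ws ih =>
      intro w hw
      rcases List.mem_cons.1 hw with rfl | hw
      · exact Submodule.mem_sup_right (Submodule.mem_span_singleton_self _)
      · exact Submodule.mem_sup_left (ih w hw)
  have hzv := hz vs (hmem vs)
  have split : ∀ x ∈ zono (a' :: b' :: vs), ∃ z ∈ zono vs,
      x = ⟪a, x⟫_ℝ • a' + ⟪b, x⟫_ℝ • b' + z := by
    intro x hx
    rw [zono_cons, zono_cons] at hx
    obtain ⟨_, h1, _, h2, rfl⟩ := mem_add_iff.1 hx
    obtain ⟨_, h3, z, h4, rfl⟩ := mem_add_iff.1 h2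
    obtain ⟨s, -, rfl⟩ := mem_seg.1 h1
    obtain ⟨t, -, rfl⟩ := mem_seg.1 h3
    refine ⟨z, h4, ?_⟩
    have := (F.mem z).1 (hzv z h4)
    simp only [inner_add_right, inner_smul_right, F.aa, F.ab, F.ba, F.bb, this.1, this.2]
    module
  obtain ⟨z₀, -, h₀⟩ := split x₀ (interior_subset hx₀)
  have hc : 0 < (|R| + 1) * 2 / r := by positivity
  refine ⟨(|R| + 1) * 2 / r, -z₀, hc.le, fun x hx hxR => ?_⟩
  set c := (|R| + 1) * 2 / r with hcdef
  have hball : c⁻¹ • x + x₀ ∈ zono (a' :: b' :: vs) := by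
    refine interior_subset (hb ?_)
    rw [mem_ball, dist_eq_norm, add_sub_cancel_right, norm_smul,
      Real.norm_of_nonneg (by positivity),
      inv_mul_lt_iff₀ hc, hcdef, div_mul_cancel₀ _ hr.ne']
    linarith [le_abs_self R, abs_nonneg R]
  obtain ⟨z, hz, h⟩ := split _ hball
  have hx' := (F.mem x).1 hx
  simp only [inner_add_right, inner_smul_right, hx'.1, hx'.2, mul_zero, zero_add] at h
  refine mem_smul_iff.2 ⟨c⁻¹ • x, mem_add_iff.2 ⟨_, mem_point.2 rfl, z, hz, ?_⟩, ?_⟩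
  · generalize ⟪a, x₀⟫_ℝ • a' + ⟪b, x₀⟫_ℝ • b' = p at h h₀
    linear_combination (norm := module) h₀ - h
  · rw [smul_smul, mul_inv_cancel₀ hc.ne', one_smul]

/-- The projection of `K` onto the plane spanned by `a', b'`. -/
def planeProj (a b a' b' : En n) (K : ConvexBody (En n)) : ConvexBody (En n) where
  carrier := (fun z => ⟪a, z⟫_ℝ • a' + ⟪b, z⟫_ℝ • b') '' K
  convex' := by
    rintro _ ⟨x, hx, rfl⟩ _ ⟨y, hy, rfl⟩ s t hs ht hst
    refine ⟨s • x + t • y, K.convex hx hy hs ht hst, ?_⟩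
    simp only [inner_add_right, inner_smul_right]
    module
  isCompact' := K.isCompact.image (by fun_prop)
  nonempty' := K.nonempty.image _

lemma mem_planeProj {a b a' b' x : En n} {K : ConvexBody (En n)} :
    x ∈ planeProj a b a' b' K ↔ ∃ z ∈ K, ⟪a, z⟫_ℝ • a' + ⟪b, z⟫_ℝ • b' = x := Iff.rfl

lemma Frame.inner_left {a b a' b' : En n} {vs : List (En n)} (F : Frame a b a' b' vs) (s t : ℝ) :
    ⟪a, s • a' + t • b'⟫_ℝ = s := by
  simp [inner_add_right, inner_smul_right, F.aa, F.ab]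

lemma Frame.inner_right {a b a' b' : En n} {vs : List (En n)} (F : Frame a b a' b' vs) (s t : ℝ) :
    ⟪b, s • a' + t • b'⟫_ℝ = t := by
  simp [inner_add_right, inner_smul_right, F.ba, F.bb]

lemma Frame.mv_planeProj {a b a' b' : En n} {vs : List (En n)} (F : Frame a b a' b' vs)
    (K M : ConvexBody (En n)) :
    mv (planeProj a b a' b' K ::ₘ M ::ₘ segs vs) = mv (K ::ₘ M ::ₘ segs vs) := by
  obtain ⟨R₁, -, h₁⟩ := exists_norm_le K
  obtain ⟨R₂, -, h₂⟩ := exists_norm_le (planeProj a b a' b' K)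
  obtain ⟨c, z₀, hc, hZ⟩ := F.exists_le_zono (R₁ + R₂)
  have hcard : (M ::ₘ segs vs).card + 1 = n := by simp [card_segs, F.len]
  have hmv : mv (c • (point z₀ + zono vs) ::ₘ M ::ₘ segs vs) = 0 := by
    rw [mv_smul_cons hcard hc, mv_point_add_cons hcard,
      mv_zono_cons_eq_zero F.len M fun _ h => h, mul_zero]
  have hd : ∀ z ∈ K, ‖z - (⟪a, z⟫_ℝ • a' + ⟪b, z⟫_ℝ • b')‖ ≤ R₁ + R₂ := fun z hz =>
    (norm_sub_le _ _).trans (add_le_add (h₁ z hz) (h₂ _ (mem_planeProj.2 ⟨z, hz, rfl⟩)))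
  have hW : ∀ z, z - (⟪a, z⟫_ℝ • a' + ⟪b, z⟫_ℝ • b') ∈ wspan vs := fun z =>
    (F.mem _).2 ⟨by rw [inner_sub_right, F.inner_left, sub_self],
      by rw [inner_sub_right, F.inner_right, sub_self]⟩
  have le_of : ∀ A B : ConvexBody (En n), A ≤ B + c • (point z₀ + zono vs) →
      mv (A ::ₘ M ::ₘ segs vs) ≤ mv (B ::ₘ M ::ₘ segs vs) := fun A B h => by
    have := mv_mono_cons hcard h
    rwa [mv_add_cons hcard, hmv, add_zero] at this
  apply le_antisymm <;> apply le_of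
  · rintro _ hx
    obtain ⟨z, hz, rfl⟩ := mem_planeProj.1 hx
    refine mem_add_iff.2 ⟨z, hz, _, hZ _ (neg_mem (hW z)) (by rw [norm_neg]; exact hd z hz), ?_⟩
    abel
  · intro z hz
    exact mem_add_iff.2 ⟨_, mem_planeProj.2 ⟨z, hz, rfl⟩, _, hZ _ (hW z) (hd z hz), by abel⟩

lemma Frame.supp_planeProj {a b a' b' : En n} {vs : List (En n)} (F : Frame a b a' b' vs)
    (K : ConvexBody (En n)) (s t : ℝ) :
    supp (planeProj a b a' b' K) (s • a + t • b) = supp K (s • a + t • b) := by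
  have key : ∀ z, ⟪s • a + t • b, ⟪a, z⟫_ℝ • a' + ⟪b, z⟫_ℝ • b'⟫_ℝ = ⟪s • a + t • b, z⟫_ℝ := by
    intro z
    simp only [inner_add_left, real_inner_smul_left, F.inner_left, F.inner_right]
  apply le_antisymm
  · refine supp_le fun y hy => ?_
    obtain ⟨z, hz, rfl⟩ := mem_planeProj.1 hy
    rw [key]
    exact inner_le_supp hz _
  · refine supp_le fun z hz => ?_
    rw [← key]
    exact inner_le_supp (mem_planeProj.2 ⟨z, hz, rfl⟩) _
/-- The size of the triangle homothetic to `tri a' b'` circumscribed about `K`. -/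
def triSize (a b : En n) (K : ConvexBody (En n)) : ℝ := supp K (a + b) + supp K (-a) + supp K (-b)

lemma neg_supp_neg_le {K : ConvexBody (En n)} {z : En n} (hz : z ∈ K) (a : En n) :
    -supp K (-a) ≤ ⟪a, z⟫_ℝ := by
  have := inner_le_supp hz (-a)
  rw [inner_neg_left] at this
  linarith

lemma triSize_nonneg (a b : En n) (K : ConvexBody (En n)) : 0 ≤ triSize a b K := by
  obtain ⟨z, hz⟩ := K.nonempty
  have h1 := inner_le_supp hz (a + b)
  have h2 := neg_supp_neg_le hz a
  have h3 := neg_supp_neg_le hz b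
  rw [inner_add_left] at h1
  rw [triSize]
  linarith

lemma Frame.le_tri {a b a' b' : En n} {C : ConvexBody (En n)}
    (hC : ∀ z ∈ C, ⟪a, z⟫_ℝ • a' + ⟪b, z⟫_ℝ • b' = z) :
    C ≤ point (-supp C (-a) • a' + -supp C (-b) • b') + triSize a b C • tri a' b' := by
  intro z hz
  have h1 := inner_le_supp hz (a + b)
  have h2 := neg_supp_neg_le hz a
  have h3 := neg_supp_neg_le hz b
  rw [inner_add_left] at h1
  refine mem_add_iff.2 ⟨_, mem_point.2 rfl, (⟪a, z⟫_ℝ + supp C (-a)) • a' +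
    (⟪b, z⟫_ℝ + supp C (-b)) • b', (mem_smul_tri (triSize_nonneg _ _ _)).2
      ⟨_, _, by linarith, by linarith, by rw [triSize]; linarith, rfl⟩, ?_⟩
  conv_rhs => rw [← hC z hz]
  module

lemma Frame.mv_tri_le {a b a' b' : En n} {vs : List (En n)} (F : Frame a b a' b' vs)
    {C : ConvexBody (En n)} (hC : ∀ z ∈ C, ⟪a, z⟫_ℝ • a' + ⟪b, z⟫_ℝ • b' = z) :
    mv (C ::ₘ tri a' b' ::ₘ segs vs) ≤
      triSize a b C * mv (tri a' b' ::ₘ tri a' b' ::ₘ segs vs) := by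
  have hcard : (tri a' b' ::ₘ segs vs).card + 1 = n := by simp [card_segs, F.len]
  have := mv_mono_cons hcard (Frame.le_tri hC)
  rwa [mv_point_add_cons hcard, mv_smul_cons hcard (triSize_nonneg _ _ _)] at this

/-- A triangle enlarged by the size of `C` is covered by the sum of `C` and the original triangle
together with three corners. -/
lemma Frame.tri_subset {a b a' b' : En n} {vs : List (En n)} (F : Frame a b a' b' vs)
    {C : ConvexBody (En n)} (hC : ∀ z ∈ C, ⟪a, z⟫_ℝ • a' + ⟪b, z⟫_ℝ • b' = z) {t : ℝ} (ht : 0 ≤ t) :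
    ∃ x₀ x₁ x₂ x₃, ∀ x ∈ point x₀ + (t + triSize a b C) • tri a' b',
      x ∈ C + t • tri a' b' ∨ x ∈ point x₁ + (2 * triSize a b C) • tri a' b' ∨
      x ∈ point x₂ + (2 * triSize a b C) • tri a' b' ∨
      x ∈ point x₃ + (2 * triSize a b C) • tri a' b' := by
  set r := triSize a b C with hr
  have hr0 : 0 ≤ r := triSize_nonneg a b C
  set A := supp C (-a)
  set B := supp C (-b)
  have hrAB : r = supp C (a + b) + A + B := rfl
  set x₀ := -A • a' + -B • b' with hx₀
  refine ⟨x₀, x₀, x₀ + (t - r) • a', x₀ + (t - r) • b', fun x hx => ?_⟩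
  obtain ⟨_, h1, _, h2, rfl⟩ := mem_add_iff.1 hx
  obtain rfl := mem_point.1 h1
  obtain ⟨p, q, hp, hq, hpq, rfl⟩ := (mem_smul_tri (add_nonneg ht hr0)).1 h2
  have corner : ∀ y : En n, ∀ p' q' : ℝ, 0 ≤ p' → 0 ≤ q' → p' + q' ≤ 2 * r →
      y + (p' • a' + q' • b') ∈ point y + (2 * r) • tri a' b' := fun y p' q' h1 h2 h3 =>
    mem_add_iff.2 ⟨_, mem_point.2 rfl, _, (mem_smul_tri (by positivity)).2
      ⟨p', q', h1, h2, h3, rfl⟩, rfl⟩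
  have inside : ∀ z ∈ C, ⟪a, z⟫_ℝ + A ≤ p → ⟪b, z⟫_ℝ + B ≤ q →
      p + q ≤ ⟪a, z⟫_ℝ + A + (⟪b, z⟫_ℝ + B) + t →
      x₀ + (p • a' + q • b') ∈ C + t • tri a' b' := fun z hz h1 h2 h3 =>
    mem_add_iff.2 ⟨z, hz, _, (mem_smul_tri ht).2 ⟨p - (⟪a, z⟫_ℝ + A), q - (⟪b, z⟫_ℝ + B),
      by linarith, by linarith, by linarith, rfl⟩, by
        conv_lhs => rw [← hC z hz]
        rw [hx₀]
        simp only [F.inner_left, F.inner_right]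
        module⟩
  have bd : ∀ z ∈ C, 0 ≤ ⟪a, z⟫_ℝ + A ∧ 0 ≤ ⟪b, z⟫_ℝ + B ∧
      ⟪a, z⟫_ℝ + A + (⟪b, z⟫_ℝ + B) ≤ r := fun z hz => by
    have h1 := inner_le_supp hz (a + b)
    have h2 := neg_supp_neg_le hz a
    have h3 := neg_supp_neg_le hz b
    rw [inner_add_left] at h1
    exact ⟨by linarith, by linarith, by linarith⟩
  by_cases c1 : p + q ≤ 2 * r
  · exact Or.inr (Or.inl (corner _ _ _ hp hq c1))
  by_cases c2 : t - r ≤ p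
  · refine Or.inr (Or.inr (Or.inl ?_))
    convert corner (x₀ + (t - r) • a') (p - (t - r)) q (by linarith) hq (by linarith) using 1
    module
  by_cases c3 : t - r ≤ q
  · refine Or.inr (Or.inr (Or.inr ?_))
    convert corner (x₀ + (t - r) • b') p (q - (t - r)) hp (by linarith) (by linarith) using 1
    module
  left
  push Not at c1 c2 c3
  by_cases c4 : p + q ≤ t
  · by_cases c5 : r ≤ q
    · obtain ⟨z, hz, he⟩ := exists_mem_supp_eq C (-a)
      have := bd z hz
      rw [inner_neg_left] at he
      exact inside z hz (by linarith) (by linarith) (by linarith)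
    · obtain ⟨z, hz, he⟩ := exists_mem_supp_eq C (-b)
      have := bd z hz
      rw [inner_neg_left] at he
      exact inside z hz (by linarith) (by linarith) (by linarith)
  · obtain ⟨z, hz, he⟩ := exists_mem_supp_eq C (a + b)
    have := bd z hz
    rw [inner_add_left] at he
    exact inside z hz (by linarith) (by linarith) (by linarith)

lemma Frame.vol_point_add_smul_tri {a b a' b' : En n} {vs : List (En n)} (F : Frame a b a' b' vs)
    (x : En n) {r : ℝ} (hr : 0 ≤ r) : vol (point x + r • tri a' b' + zono vs) =
      n.factorial / 2 * (r ^ 2 * mv (tri a' b' ::ₘ tri a' b' ::ₘ segs vs)) := by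
  have h1 : (tri a' b' ::ₘ segs vs).card + 1 = n := by simp [card_segs, F.len]
  have h2 : ((r • tri a' b') ::ₘ segs vs).card + 1 = n := by simp [card_segs, F.len]
  rw [add_assoc, vol_add_point, F.vol_planar, mv_smul_cons h2 hr, Multiset.cons_swap,
    mv_smul_cons h1 hr]
  · ring
  · intro z hz
    obtain ⟨s, t, -, -, -, rfl⟩ := (mem_smul_tri hr).1 hz
    rw [F.inner_left, F.inner_right]

lemma Frame.mv_tri_ge {a b a' b' : En n} {vs : List (En n)} (F : Frame a b a' b' vs)
    {C : ConvexBody (En n)} (hC : ∀ z ∈ C, ⟪a, z⟫_ℝ • a' + ⟪b, z⟫_ℝ • b' = z) :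
    triSize a b C * mv (tri a' b' ::ₘ tri a' b' ::ₘ segs vs) ≤
      mv (C ::ₘ tri a' b' ::ₘ segs vs) := by
  set T := tri a' b' with hT
  set r := triSize a b C with hr
  have hr0 : 0 ≤ r := triSize_nonneg a b C
  have hcard : ∀ A : ConvexBody (En n), (A ::ₘ segs vs).card + 1 = n := fun A => by
    simp [card_segs, F.len]
  have hfac : (0 : ℝ) < n.factorial / 2 := by positivity
  have key : ∀ t : ℝ, 0 ≤ t → 2 * t * (r * mv (T ::ₘ T ::ₘ segs vs) - mv (C ::ₘ T ::ₘ segs vs)) ≤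
      mv (C ::ₘ C ::ₘ segs vs) + 12 * r ^ 2 * mv (T ::ₘ T ::ₘ segs vs) := by
    intro t ht
    obtain ⟨x₀, x₁, x₂, x₃, hx⟩ := F.tri_subset hC ht
    have hv : vol (point x₀ + (t + r) • T + zono vs) ≤ vol (C + t • T + zono vs) +
        (vol (point x₁ + (2 * r) • T + zono vs) + (vol (point x₂ + (2 * r) • T + zono vs) +
          vol (point x₃ + (2 * r) • T + zono vs))) := by
      refine (measureReal_mono (μ := volume) (s₂ := ((C + t • T + zono vs : ConvexBody (En n)) :
        Set (En n)) ∪ ((point x₁ + (2 * r) • T + zono vs : ConvexBody (En n)) ∪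
          ((point x₂ + (2 * r) • T + zono vs : ConvexBody (En n)) ∪
            (point x₃ + (2 * r) • T + zono vs : ConvexBody (En n)))))
              (fun y hy => ?_) ?_).trans ?_
      · obtain ⟨x, hx', z, hz, rfl⟩ := mem_add_iff.1 hy
        rcases hx x hx' with h | h | h | h
        · exact Or.inl (mem_add_iff.2 ⟨x, h, z, hz, rfl⟩)
        · exact Or.inr (Or.inl (mem_add_iff.2 ⟨x, h, z, hz, rfl⟩))
        · exact Or.inr (Or.inr (Or.inl (mem_add_iff.2 ⟨x, h, z, hz, rfl⟩)))
        · exact Or.inr (Or.inr (Or.inr (mem_add_iff.2 ⟨x, h, z, hz, rfl⟩)))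
      · exact measure_union_ne_top (volume_ne_top _) (measure_union_ne_top (volume_ne_top _)
          (measure_union_ne_top (volume_ne_top _) (volume_ne_top _)))
      · exact (measureReal_union_le _ _).trans (add_le_add le_rfl ((measureReal_union_le _ _).trans
          (add_le_add le_rfl (measureReal_union_le _ _))))
    have hCT : vol (C + t • T + zono vs) = n.factorial / 2 * (mv (C ::ₘ C ::ₘ segs vs) +
        2 * t * mv (C ::ₘ T ::ₘ segs vs) + t ^ 2 * mv (T ::ₘ T ::ₘ segs vs)) := by
      rw [F.vol_planar, mv_add_cons (hcard _), Multiset.cons_swap, mv_add_cons (hcard _),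
        mv_smul_cons (hcard _) ht, Multiset.cons_swap _ (C + t • T), mv_add_cons (hcard _),
        mv_smul_cons (hcard _) ht, Multiset.cons_swap C (t • T), Multiset.cons_swap T (t • T),
        mv_smul_cons (hcard _) ht, mv_smul_cons (hcard _) ht, Multiset.cons_swap T C]
      · ring
      · intro z hz
        obtain ⟨y, hy, w, hw, rfl⟩ := mem_add_iff.1 hz
        obtain ⟨p, q, -, -, -, rfl⟩ := (mem_smul_tri ht).1 hw
        rw [inner_add_right a y, inner_add_right b y, F.inner_left, F.inner_right]
        conv_rhs => rw [← hC y hy]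
        module
    rw [hCT, F.vol_point_add_smul_tri _ (by positivity), F.vol_point_add_smul_tri _ (by positivity),
      F.vol_point_add_smul_tri _ (by positivity), F.vol_point_add_smul_tri _ (by positivity),
      ← mul_add, ← mul_add, ← mul_add, mul_le_mul_iff_right₀ hfac] at hv
    nlinarith [mul_nonneg (sq_nonneg r) F.mv_tri_pos.le]
  by_contra! h
  set d := r * mv (T ::ₘ T ::ₘ segs vs) - mv (C ::ₘ T ::ₘ segs vs)
  have hd : 0 < d := sub_pos.2 h
  set E := mv (C ::ₘ C ::ₘ segs vs) + 12 * r ^ 2 * mv (T ::ₘ T ::ₘ segs vs)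
  have := key ((|E| + 1) / d) (by positivity)
  rw [mul_assoc, div_mul_cancel₀ _ hd.ne'] at this
  linarith [le_abs_self E, abs_nonneg E]

lemma Frame.mv_tri {a b a' b' : En n} {vs : List (En n)} (F : Frame a b a' b' vs)
    (K : ConvexBody (En n)) : mv (K ::ₘ tri a' b' ::ₘ segs vs) =
      triSize a b K * mv (tri a' b' ::ₘ tri a' b' ::ₘ segs vs) := by
  have hC : ∀ z ∈ planeProj a b a' b' K, ⟪a, z⟫_ℝ • a' + ⟪b, z⟫_ℝ • b' = z := fun z hz => by
    obtain ⟨y, -, rfl⟩ := mem_planeProj.1 hz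
    rw [F.inner_left, F.inner_right]
  have hs : triSize a b (planeProj a b a' b' K) = triSize a b K := by
    have h1 := F.supp_planeProj K 1 1
    have h2 := F.supp_planeProj K (-1) 0
    have h3 := F.supp_planeProj K 0 (-1)
    simp only [one_smul, zero_smul, neg_smul, add_zero, zero_add] at h1 h2 h3
    rw [triSize, triSize, h1, h2, h3]
  rw [← F.mv_planeProj, ← hs]
  exact le_antisymm (F.mv_tri_le hC) (F.mv_tri_ge hC)

lemma exists_inner_eq_zero (hn : 2 ≤ n) (a b : En n) :
    ∃ c, c ≠ 0 ∧ ⟪a, c⟫_ℝ = 0 ∧ 0 ≤ ⟪b, c⟫_ℝ := by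
  have hne : (Submodule.span ℝ {a})ᗮ ≠ ⊥ := fun h => by
    have h1 := (finrank_span_le_card (R := ℝ) ({a} : Set (En n))).trans (by simp : _ ≤ 1)
    rw [Submodule.orthogonal_eq_bot_iff.1 h, finrank_top, finrank_euclideanSpace_fin] at h1
    omega
  obtain ⟨c, hc, hc0⟩ := Submodule.exists_mem_ne_zero_of_ne_bot hne
  rw [Submodule.mem_orthogonal_singleton_iff_inner_right] at hc
  rcases le_total 0 ⟪b, c⟫_ℝ with h | h
  · exact ⟨c, hc0, hc, h⟩
  · exact ⟨-c, neg_ne_zero.2 hc0, by rw [inner_neg_right, hc, neg_zero], by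
      rw [inner_neg_right]; linarith⟩

lemma exists_point_add_eq (hn : 2 ≤ n) {K L : ConvexBody (En n)}
    (h : ∀ a b : En n, ‖a‖ ^ 2 * ‖b‖ ^ 2 - ⟪a, b⟫_ℝ ^ 2 ≠ 0 → triSize a b K = triSize a b L) :
    ∃ x, K = point x + L := by
  set g : En n → ℝ := fun x => supp K x - supp L x with hg
  have hgc : Continuous g := (continuous_supp K).sub (continuous_supp L)
  have hg0 : g 0 = 0 := by simp only [hg, supp_zero_arg, sub_zero]
  have key : ∀ a b, a ≠ 0 → g (a + b) + g (-a) + g (-b) = 0 := by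
    intro a b ha
    obtain ⟨c, hc, hac, hbc⟩ := exists_inner_eq_zero hn a b
    have h1 : Tendsto (fun ε : ℝ => g (a + (b + ε • c)) + g (-a) + g (-(b + ε • c))) (𝓝[>] 0)
        (𝓝 (g (a + b) + g (-a) + g (-b))) := by
      have : Continuous fun ε : ℝ => g (a + (b + ε • c)) + g (-a) + g (-(b + ε • c)) := by fun_prop
      have := (this.tendsto 0).mono_left (nhdsWithin_le_nhds (s := Set.Ioi 0))
      simpa using this
    refine tendsto_nhds_unique h1 (tendsto_const_nhds.congr' ?_)
    filter_upwards [self_mem_nhdsWithin] with ε hε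
    have hε : 0 < ε := hε
    have h2 := h a (b + ε • c) (by
      have h3 := abs_real_inner_le_norm a b
      have h4 : ⟪a, b⟫_ℝ ^ 2 ≤ (‖a‖ * ‖b‖) ^ 2 := sq_le_sq' (by linarith [neg_le_of_abs_le h3])
        (le_of_abs_le h3)
      have h5 : ‖b + ε • c‖ ^ 2 = ‖b‖ ^ 2 + 2 * (ε * ⟪b, c⟫_ℝ) + (ε * ‖c‖) ^ 2 := by
        rw [norm_add_sq_real, real_inner_smul_right, norm_smul, Real.norm_of_nonneg hε.le]
      have h6 : 0 < (‖a‖ * (ε * ‖c‖)) ^ 2 := by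
        have := norm_pos_iff.2 ha
        have := norm_pos_iff.2 hc
        positivity
      have h7 : 0 ≤ ‖a‖ ^ 2 * (2 * (ε * ⟪b, c⟫_ℝ)) := by positivity
      rw [inner_add_right, real_inner_smul_right, hac, mul_zero, add_zero, h5]
      nlinarith)
    simp only [triSize] at h2
    simp only [hg]
    linarith
  have hodd : ∀ a, g (-a) = -g a := fun a => by
    rcases eq_or_ne a 0 with rfl | ha
    · simp [hg0]
    · have := key a 0 ha
      simp only [add_zero, neg_zero, hg0] at this
      linarith
  have hadd : ∀ a b, g (a + b) = g a + g b := fun a b => by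
    rcases eq_or_ne a 0 with rfl | ha
    · simp [hg0]
    · have := key a b ha
      rw [hodd, hodd] at this
      linarith
  set φ : En n →L[ℝ] ℝ := (AddMonoidHom.mk' g hadd).toRealLinearMap hgc with hφ
  refine ⟨(InnerProductSpace.toDual ℝ (En n)).symm φ, eq_of_supp_eq fun y => ?_⟩
  rw [supp_add, supp_point, real_inner_comm, InnerProductSpace.toDual_symm_apply]
  change supp K y = (supp K y - supp L y) + supp L y
  ring

/-- Mixed volumes with `j + 1` copies of a full-dimensional body and balls determine the body up to
translation. -/
lemma eq_point_add_of_forall_mv_eq (hn : 2 ≤ n) {j q : ℕ} (h : j + q + 2 = n)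
    {K L : ConvexBody (En n)} (hK : (interior (K : Set (En n))).Nonempty)
    (hL : 0 < mv (Multiset.replicate (j + 2) L + Multiset.replicate q (ballB n)))
    (he : ∀ M, mv (M ::ₘ (Multiset.replicate (j + 1) L + Multiset.replicate q (ballB n))) =
      mv (M ::ₘ (Multiset.replicate (j + 1) K + Multiset.replicate q (ballB n)))) :
    ∃ x, L = point x + K := by
  refine exists_point_add_eq hn fun a b hab => ?_
  obtain ⟨a', b', vs, F⟩ := exists_frame hab
  have := mv_segs_eq_of_forall_mv_eq hn h hK hL he F.indep F.len (tri a' b')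
  rw [F.mv_tri L, F.mv_tri K] at this
  exact mul_right_cancel₀ F.mv_tri_pos.ne' this

/-- The closed convex hull of the union of two bodies. -/
def hull (K L : ConvexBody (En n)) : ConvexBody (En n) where
  carrier := closure (convexHull ℝ ((K : Set (En n)) ∪ L))
  convex' := (convex_convexHull ℝ _).closure
  isCompact' := Metric.isCompact_of_isClosed_isBounded isClosed_closure
    ((isBounded_convexHull.2 (K.isBounded.union L.isBounded)).closure)
  nonempty' := ((K.nonempty.mono Set.subset_union_left).mono (subset_convexHull ℝ _)).closure

lemma supp_hull (K L : ConvexBody (En n)) (x : En n) :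
    supp (hull K L) x = max (supp K x) (supp L x) := by
  have hsub : ((K : Set (En n)) ∪ L) ⊆ (hull K L : Set (En n)) :=
    (subset_convexHull ℝ _).trans subset_closure
  apply le_antisymm
  · refine supp_le fun y hy => ?_
    have hcl : IsClosed {y : En n | ⟪x, y⟫_ℝ ≤ max (supp K x) (supp L x)} :=
      isClosed_le (by fun_prop) continuous_const
    have hcv : Convex ℝ {y : En n | ⟪x, y⟫_ℝ ≤ max (supp K x) (supp L x)} :=
      convex_halfSpace_le (innerₛₗ ℝ x).isLinear _
    refine closure_minimal (convexHull_min ?_ hcv) hcl hy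
    rintro z (hz | hz)
    · exact (inner_le_supp hz x).trans (le_max_left _ _)
    · exact (inner_le_supp hz x).trans (le_max_right _ _)
  · exact max_le (supp_mono (fun z hz => hsub (Or.inl hz)) x)
      (supp_mono (fun z hz => hsub (Or.inr hz)) x)

/-- Differences of support functions, as continuous functions on the sphere. -/
def suppDiffs (n : ℕ) : Set C(Sph n, ℝ) :=
  {f | ∃ K L : ConvexBody (En n), ∀ v, f v = supp K (v : En n) - supp L (v : En n)}

lemma sup_mem_suppDiffs {f g : C(Sph n, ℝ)} (hf : f ∈ suppDiffs n) (hg : g ∈ suppDiffs n) :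
    f ⊔ g ∈ suppDiffs n := by
  obtain ⟨K, L, hf⟩ := hf
  obtain ⟨M, N, hg⟩ := hg
  refine ⟨hull (K + N) (M + L), L + N, fun v => ?_⟩
  rw [ContinuousMap.sup_apply, hf, hg, supp_hull, supp_add, supp_add, supp_add, ← max_sub_sub_right]
  congr 1 <;> ring

lemma neg_mem_suppDiffs {f : C(Sph n, ℝ)} (hf : f ∈ suppDiffs n) : -f ∈ suppDiffs n := by
  obtain ⟨K, L, hf⟩ := hf
  exact ⟨L, K, fun v => by simp [hf]⟩

lemma inf_mem_suppDiffs {f g : C(Sph n, ℝ)} (hf : f ∈ suppDiffs n) (hg : g ∈ suppDiffs n) :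
    f ⊓ g ∈ suppDiffs n := by
  have := neg_mem_suppDiffs (sup_mem_suppDiffs (neg_mem_suppDiffs hf) (neg_mem_suppDiffs hg))
  convert this using 1
  ext v
  simp [← min_neg_neg]

lemma exists_mem_suppDiffs (c : ℝ) (z : En n) :
    ∃ f ∈ suppDiffs n, ∀ v : Sph n, f v = c + ⟪(v : En n), z⟫_ℝ := by
  refine ⟨⟨fun v => c + ⟪(v : En n), z⟫_ℝ, by fun_prop⟩,
    ⟨(max c 0) • ballB n + point z, (max (-c) 0) • ballB n, fun v => ?_⟩, fun v => rfl⟩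
  have hv : ‖(v : En n)‖ = 1 := by simp
  rw [supp_add, supp_smul (le_max_right _ _), supp_smul (le_max_right _ _), supp_ballB, supp_point,
    hv, real_inner_comm]
  change c + _ = _
  rcases le_total c 0 with h | h
  · rw [max_eq_right h, max_eq_left (by linarith)]
    ring_nf
    simp [real_inner_comm]
  · rw [max_eq_left h, max_eq_right (by linarith)]
    ring_nf
    simp [real_inner_comm]

lemma separatesPointsStrongly_suppDiffs : (suppDiffs n).SeparatesPointsStrongly := by
  intro g x y
  have hx : ‖(x : En n)‖ = 1 := by simp
  have hy : ‖(y : En n)‖ = 1 := by simp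
  have hxx : ⟪(x : En n), (x : En n)⟫_ℝ = 1 := by rw [real_inner_self_eq_norm_sq, hx]; norm_num
  have hyy : ⟪(y : En n), (y : En n)⟫_ℝ = 1 := by rw [real_inner_self_eq_norm_sq, hy]; norm_num
  set s := ⟪(x : En n), (y : En n)⟫_ℝ with hs
  have hyx : ⟪(y : En n), (x : En n)⟫_ℝ = s := real_inner_comm _ _
  obtain ⟨f, hf, hfv⟩ := exists_mem_suppDiffs ((g x + g y) / 2)
    (((g x - g y) / (2 * (1 - s))) • ((x : En n) - (y : En n)))
  have key : (g x - g y) / (2 * (1 - s)) * (1 - s) = (g x - g y) / 2 := by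
    rcases eq_or_ne x y with rfl | hxy
    · simp
    · have : s ≠ 1 := fun h => hxy (Subtype.ext ((inner_eq_one_iff_of_norm_eq_one hx hy).1 h))
      have : 1 - s ≠ 0 := fun h => this (by linarith)
      field_simp
  refine ⟨f, hf, ?_, ?_⟩
  · rw [hfv, inner_smul_right, inner_sub_right, hxx, ← hs, key]
    ring
  · rw [hfv, inner_smul_right, inner_sub_right, hyx, hyy]
    linear_combination -key

/-- Differences of support functions are dense in `C(𝕊ⁿ⁻¹)`. -/
lemma closure_suppDiffs : closure (suppDiffs n) = ⊤ :=
  ContinuousMap.sublattice_closure_eq_top _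
    (by obtain ⟨f, hf, -⟩ := exists_mem_suppDiffs 0 (0 : En n); exact ⟨f, hf⟩)
    (fun _ hf _ hg => inf_mem_suppDiffs hf hg) (fun _ hf _ hg => sup_mem_suppDiffs hf hg)
    separatesPointsStrongly_suppDiffs

lemma integral_supp {j q : ℕ} (h : j + q + 2 = n) {K : ConvexBody (En n)} {μ : Measure (Sph n)}
    (hμ : IsAreaMeasure (j + 1) K μ) (L : ConvexBody (En n)) :
    ∫ v : Sph n, supp L (v : En n) ∂μ =
      n * mv (L ::ₘ (Multiset.replicate (j + 1) K + Multiset.replicate q (ballB n))) := by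
  rw [hμ L, mixedVol_eq_mv, Fin.univ_val_map]
  congr 2
  change _ = Multiset.ofList (L :: (List.replicate (j + 1) K ++ List.replicate q (ballB n)))
  congr 1
  refine List.ext_getElem (by simp; omega) fun k h₁ h₂ => ?_
  rw [List.getElem_ofFn]
  rcases k with _ | k
  · simp
  · rw [List.getElem_cons_succ, List.getElem_append]
    by_cases hk : k < j + 1
    · simp [hk, Nat.succ_le_of_lt hk]
    · simp [hk, show ¬ k ≤ j by omega]

lemma mv_ballB_cons_pos {j q : ℕ} (h : j + q + 2 = n) {K : ConvexBody (En n)}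
    (hK : (interior (K : Set (En n))).Nonempty) :
    0 < mv (ballB n ::ₘ (Multiset.replicate (j + 1) K + Multiset.replicate q (ballB n))) := by
  have := mv_replicate_pos (m := j + 1) (q := q + 1) (by omega) hK
  rwa [Multiset.replicate_succ (n := q), Multiset.add_cons] at this

lemma integral_supp_ballB (μ : Measure (Sph n)) :
    ∫ v : Sph n, supp (ballB n) (v : En n) ∂μ = μ.real Set.univ := by
  simp [supp_ballB]

lemma measureReal_univ {j q : ℕ} (h : j + q + 2 = n) {K : ConvexBody (En n)}
    {μ : Measure (Sph n)} (hμ : IsAreaMeasure (j + 1) K μ) :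
    μ.real Set.univ =
      n * mv (ballB n ::ₘ (Multiset.replicate (j + 1) K + Multiset.replicate q (ballB n))) := by
  rw [← integral_supp_ballB, integral_supp h hμ]

lemma measureReal_univ_pos {j q : ℕ} (h : j + q + 2 = n) {K : ConvexBody (En n)}
    (hK : (interior (K : Set (En n))).Nonempty) {μ : Measure (Sph n)}
    (hμ : IsAreaMeasure (j + 1) K μ) : 0 < μ.real Set.univ := by
  rw [measureReal_univ h hμ]
  have : 0 < (n : ℝ) := by exact_mod_cast (by omega : 0 < n)
  exact mul_pos this (mv_ballB_cons_pos h hK)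

lemma isFiniteMeasure_of_pos {X : Type*} [MeasurableSpace X] {μ : Measure X}
    (h : 0 < μ.real Set.univ) : IsFiniteMeasure μ := by
  refine ⟨lt_top_iff_ne_top.2 fun h' => ?_⟩
  simp [Measure.real, h'] at h

lemma integrable_continuousMap {μ : Measure (Sph n)} [IsFiniteMeasure μ] (f : C(Sph n, ℝ)) :
    Integrable f μ :=
  f.continuous.integrable_of_hasCompactSupport (HasCompactSupport.of_compactSpace _)

/-- Convergence of the integrals of all support functions is weak convergence. -/
lemma tendsto_integral_of_tendsto_supp {μm : ℕ → Measure (Sph n)} {μ : Measure (Sph n)}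
    [∀ m, IsFiniteMeasure (μm m)] [IsFiniteMeasure μ]
    (h : ∀ L : ConvexBody (En n), Tendsto (fun m => ∫ v : Sph n, supp L (v : En n) ∂(μm m)) atTop
      (𝓝 (∫ v : Sph n, supp L (v : En n) ∂μ))) (f : C(Sph n, ℝ)) :
    Tendsto (fun m => ∫ v, f v ∂(μm m)) atTop (𝓝 (∫ v, f v ∂μ)) := by
  have hmass := h (ballB n)
  simp only [integral_supp_ballB] at hmass
  obtain ⟨C, hC⟩ := hmass.bddAbove_range
  have hCm : ∀ m, (μm m).real Set.univ ≤ C := fun m => hC ⟨m, rfl⟩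
  have hC0 : 0 ≤ C := measureReal_nonneg.trans (hCm 0)
  have hapx : ∀ (ν : Measure (Sph n)) [IsFiniteMeasure ν] (g : C(Sph n, ℝ)),
      |∫ v, f v ∂ν - ∫ v, g v ∂ν| ≤ dist f g * ν.real Set.univ := fun ν _ g => by
    rw [← integral_sub (integrable_continuousMap f) (integrable_continuousMap g),
      ← Real.norm_eq_abs]
    refine norm_integral_le_of_norm_le_const  (Eventually.of_forall fun v => ?_)
    rw [← dist_eq_norm]
    exact ContinuousMap.dist_apply_le_dist v
  have hsup : ∀ g ∈ suppDiffs n, Tendsto (fun m => ∫ v, g v ∂(μm m)) atTop (𝓝 (∫ v, g v ∂μ)) := by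
    rintro g ⟨K, L, hg⟩
    have hi : ∀ (ν : Measure (Sph n)) [IsFiniteMeasure ν] (K : ConvexBody (En n)),
        Integrable (fun v : Sph n => supp K (v : En n)) ν := fun ν _ K =>
      integrable_continuousMap ⟨fun v : Sph n => supp K (v : En n),
        (continuous_supp K).comp continuous_subtype_val⟩
    simp only [hg]
    simp only [fun (ν : Measure (Sph n)) [IsFiniteMeasure ν] => integral_sub (hi ν K) (hi ν L)]
    exact (h K).sub (h L)
  rw [Metric.tendsto_atTop]
  intro ε hε
  set D := max C (μ.real Set.univ) + 1 with hD
  have hD0 : 0 < D := by have := le_max_left C (μ.real Set.univ); linarith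
  have hf : f ∈ closure (suppDiffs n) := by rw [closure_suppDiffs]; trivial
  obtain ⟨g, hg, hfg⟩ := Metric.mem_closure_iff.1 hf (ε / (3 * D)) (by positivity)
  obtain ⟨N, hN⟩ := Metric.tendsto_atTop.1 (hsup g hg) (ε / 3) (by positivity)
  refine ⟨N, fun m hm => ?_⟩
  have hb : ∀ (ν : Measure (Sph n)) [IsFiniteMeasure ν], ν.real Set.univ ≤ D →
      |∫ v, f v ∂ν - ∫ v, g v ∂ν| ≤ ε / 3 := fun ν _ hν => by
    refine (hapx ν g).trans ((mul_le_mul hfg.le hν measureReal_nonneg (by positivity)).trans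
      (le_of_eq ?_))
    field_simp
  have h1 := abs_le.1 (hb (μm m) (by have := le_max_left C (μ.real Set.univ); linarith [hCm m]))
  have h2 := abs_le.1 (hb μ (by have := le_max_right C (μ.real Set.univ); linarith))
  have h3 := abs_lt.1 (Real.dist_eq _ _ ▸ hN m hm)
  rw [Real.dist_eq, abs_lt]
  constructor <;> linarith [h1.1, h1.2, h2.1, h2.2, h3.1, h3.2]

/-- `ε` is admissible in the definition of the Lévy–Prokhorov distance of `μ` and `ν`. -/
def LPBound (μ ν : Measure (Sph n)) (ε : ℝ) : Prop :=
  0 < ε ∧ ∀ A : Set (Sph n), MeasurableSet A →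
    μ A ≤ ν (Metric.thickening ε A) + ENNReal.ofReal ε ∧
    ν A ≤ μ (Metric.thickening ε A) + ENNReal.ofReal ε

lemma LPBound.symm {μ ν : Measure (Sph n)} {ε : ℝ} (h : LPBound μ ν ε) : LPBound ν μ ε :=
  ⟨h.1, fun A hA => (h.2 A hA).symm⟩

lemma LPBound.dLP_le {μ ν : Measure (Sph n)} {ε : ℝ} (h : LPBound μ ν ε) : dLP μ ν ≤ ε :=
  csInf_le ⟨0, fun _ hx => hx.1.le⟩ h

lemma dLP_nonneg (μ ν : Measure (Sph n)) : 0 ≤ dLP μ ν :=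
  Real.sInf_nonneg fun _ hx => hx.1.le

lemma exists_LPBound (μ ν : Measure (Sph n)) [IsFiniteMeasure μ] [IsFiniteMeasure ν] :
    ∃ ε, LPBound μ ν ε := by
  have hle : ∀ (κ : Measure (Sph n)) [IsFiniteMeasure κ] (c : ℝ) (A : Set (Sph n)),
      κ.real Set.univ ≤ c → κ A ≤ ENNReal.ofReal c := fun κ _ c A hc =>
    (measure_mono (Set.subset_univ A)).trans
      (by rw [← ofReal_measureReal]; exact ENNReal.ofReal_le_ofReal hc)
  have h1 := measureReal_nonneg (μ := μ) (s := Set.univ)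
  have h2 := measureReal_nonneg (μ := ν) (s := Set.univ)
  exact ⟨μ.real Set.univ + ν.real Set.univ + 1, by positivity, fun A _ =>
    ⟨(hle μ _ A (by linarith)).trans le_add_self, (hle ν _ A (by linarith)).trans le_add_self⟩⟩

lemma exists_LPBound_lt {μ ν : Measure (Sph n)} [IsFiniteMeasure μ] [IsFiniteMeasure ν] {δ : ℝ}
    (h : dLP μ ν < δ) : ∃ ε < δ, LPBound μ ν ε := by
  obtain ⟨ε, hε, hlt⟩ := exists_lt_of_csInf_lt (exists_LPBound μ ν) h
  exact ⟨ε, hlt, hε⟩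

/-- Comparison of integrals of Lipschitz functions under a Lévy–Prokhorov bound. -/
lemma LPBound.integral_le {μ ν : Measure (Sph n)} [IsFiniteMeasure μ] [IsFiniteMeasure ν] {ε : ℝ}
    (h : LPBound μ ν ε) {f : C(Sph n, ℝ)} {R M : ℝ} (hR : 0 ≤ R) (hf0 : ∀ v, 0 ≤ f v)
    (hfM : ∀ v, f v ≤ M) (hfR : ∀ v w, f v - f w ≤ R * dist v w) :
    ∫ v, f v ∂μ ≤ ∫ v, f v ∂ν + ε * (R * ν.real Set.univ + |M|) := by
  have hε := h.1
  have key : ∫⁻ v, ENNReal.ofReal (f v) ∂μ ≤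
      ∫⁻ v, ENNReal.ofReal (f v + R * ε) ∂ν + ENNReal.ofReal (ε * |M|) := by
    rw [lintegral_eq_lintegral_meas_le μ (Eventually.of_forall hf0)
        f.continuous.aemeasurable,
      lintegral_eq_lintegral_meas_le ν (f := fun v => f v + R * ε)
        (Eventually.of_forall fun v => add_nonneg (hf0 v) (by positivity))
        (f.continuous.add continuous_const).aemeasurable]
    have e : ENNReal.ofReal (ε * |M|) = ∫⁻ t in Set.Ioi (0 : ℝ),
        (Set.Ioc 0 |M|).indicator (fun _ => ENNReal.ofReal ε) t := by
      rw [lintegral_indicator measurableSet_Ioc, lintegral_const,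
        Measure.restrict_apply MeasurableSet.univ, Set.univ_inter,
        Measure.restrict_apply measurableSet_Ioc,
        Set.inter_eq_left.2 (fun x hx => hx.1), Real.volume_Ioc, sub_zero,
        ENNReal.ofReal_mul hε.le]
    rw [e, ← lintegral_add_right _ (measurable_const.indicator measurableSet_Ioc)]
    refine setLIntegral_mono' measurableSet_Ioi fun t ht => ?_
    by_cases htM : t ≤ |M|
    · rw [Set.indicator_of_mem (show t ∈ Set.Ioc 0 |M| from ⟨ht, htM⟩)]
      refine (h.2 {v | t ≤ f v} (f.continuous.measurable measurableSet_Ici)).1.trans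
        (add_le_add_left (measure_mono fun v hv => ?_) _)
      obtain ⟨w, hw, hvw⟩ := Metric.mem_thickening_iff.1 hv
      have h1 := hfR w v
      rw [dist_comm] at h1
      have h2 := mul_le_mul_of_nonneg_left hvw.le hR
      have h3 : t ≤ f w := hw
      change t ≤ f v + R * ε
      linarith
    · have : {v | t ≤ f v} = ∅ := by
        ext v
        simp only [Set.mem_ofPred_eq, Set.mem_empty_iff_false, iff_false, not_le]
        push Not at htM
        exact ((hfM v).trans (le_abs_self M)).trans_lt htM
      rw [this, measure_empty]
      exact zero_le
  have hint : Integrable (fun v => f v + R * ε) ν :=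
    (integrable_continuousMap f).add (integrable_const _)
  rw [← ofReal_integral_eq_lintegral_ofReal (integrable_continuousMap f)
      (Eventually.of_forall hf0),
    ← ofReal_integral_eq_lintegral_ofReal hint
      (Eventually.of_forall fun v => add_nonneg (hf0 v) (by positivity)),
    ← ENNReal.ofReal_add (integral_nonneg fun v => add_nonneg (hf0 v) (by positivity))
      (by positivity),
    ENNReal.ofReal_le_ofReal_iff (add_nonneg
      (integral_nonneg fun v => add_nonneg (hf0 v) (by positivity)) (by positivity)),
    integral_add (integrable_continuousMap f) (integrable_const _), integral_const,
    smul_eq_mul] at key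
  linarith

/-- Lévy–Prokhorov convergence implies convergence of the integrals of Lipschitz functions. -/
lemma tendsto_integral_of_tendsto_dLP {μm : ℕ → Measure (Sph n)} {μ : Measure (Sph n)}
    [∀ m, IsFiniteMeasure (μm m)] [IsFiniteMeasure μ]
    (h : Tendsto (fun m => dLP (μm m) μ) atTop (𝓝 0)) {f : C(Sph n, ℝ)} {R M : ℝ} (hR : 0 ≤ R)
    (hf0 : ∀ v, 0 ≤ f v) (hfM : ∀ v, f v ≤ M) (hfR : ∀ v w, f v - f w ≤ R * dist v w) :
    Tendsto (fun m => ∫ v, f v ∂(μm m)) atTop (𝓝 (∫ v, f v ∂μ)) := by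
  set D := R * (μ.real Set.univ + 1) + |M| + 1 with hD
  have hD0 : 0 < D := by positivity
  rw [Metric.tendsto_atTop] at h ⊢
  intro η hη
  obtain ⟨N, hN⟩ := h (min 1 (η / D)) (by positivity)
  refine ⟨N, fun m hm => ?_⟩
  have hlt := hN m hm
  rw [Real.dist_eq, sub_zero] at hlt
  obtain ⟨ε, hε, hb⟩ := exists_LPBound_lt ((le_abs_self _).trans_lt hlt)
  have hε0 := hb.1
  have hε1 : ε < 1 := hε.trans_le (min_le_left _ _)
  have hεD : ε * D < η := (lt_div_iff₀ hD0).1 (hε.trans_le (min_le_right _ _))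
  have hmass : (μm m).real Set.univ ≤ μ.real Set.univ + 1 := by
    have := (hb.2 Set.univ MeasurableSet.univ).1.trans
      (add_le_add_left (measure_mono (Set.subset_univ _)) _)
    have := ENNReal.toReal_mono (by finiteness) this
    rw [ENNReal.toReal_add (by finiteness) (by finiteness), ENNReal.toReal_ofReal hε0.le] at this
    change (μm m).real Set.univ ≤ μ.real Set.univ + ε at this
    linarith
  have h1 := hb.integral_le hR hf0 hfM hfR
  have h2 := hb.symm.integral_le hR hf0 hfM hfR
  have h3 : R * (μm m).real Set.univ + |M| ≤ D := by
    have := mul_le_mul_of_nonneg_left hmass hR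
    linarith
  have h4 : R * μ.real Set.univ + |M| ≤ D := by
    rw [hD, mul_add]; linarith
  have h5 := mul_le_mul_of_nonneg_left h3 hε0.le
  have h6 := mul_le_mul_of_nonneg_left h4 hε0.le
  rw [Real.dist_eq, abs_lt]
  constructor <;> linarith

/-- Lévy–Prokhorov convergence implies convergence of the integrals of support functions. -/
lemma tendsto_integral_supp_of_tendsto_dLP {μm : ℕ → Measure (Sph n)} {μ : Measure (Sph n)}
    [∀ m, IsFiniteMeasure (μm m)] [IsFiniteMeasure μ]
    (h : Tendsto (fun m => dLP (μm m) μ) atTop (𝓝 0)) (L : ConvexBody (En n)) :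
    Tendsto (fun m => ∫ v : Sph n, supp L (v : En n) ∂(μm m)) atTop
      (𝓝 (∫ v : Sph n, supp L (v : En n) ∂μ)) := by
  obtain ⟨R, hR, hL⟩ := exists_abs_supp_le L
  have hv : ∀ v : Sph n, ‖(v : En n)‖ = 1 := fun v => by simp
  let g : C(Sph n, ℝ) :=
    ⟨fun v : Sph n => supp L (v : En n), (continuous_supp L).comp continuous_subtype_val⟩
  have hg : ∀ v, |g v| ≤ R := fun v => by
    have := hL (v : En n)
    rwa [hv, mul_one] at this
  have h1 := tendsto_integral_of_tendsto_dLP h (f := g + ContinuousMap.const _ R) (R := R)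
    (M := 2 * R) hR.le
    (fun v => by
      have := (abs_le.1 (hg v)).1
      change 0 ≤ g v + R
      linarith)
    (fun v => by
      have := (abs_le.1 (hg v)).2
      change g v + R ≤ 2 * R
      linarith)
    (fun v w => by
      have := (abs_le.1 (abs_supp_sub_arg_le hL (v : En n) w)).2
      change (g v + R) - (g w + R) ≤ R * dist v w
      rw [Subtype.dist_eq, dist_eq_norm]
      change supp L (v : En n) + R - (supp L (w : En n) + R) ≤ _
      linarith)
  have h2 := tendsto_integral_of_tendsto_dLP h (f := ContinuousMap.const _ R) (R := 0)
    (M := R) le_rfl (fun v => hR.le) (fun v => le_rfl) (fun v w => by simp)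
  have h3 := h1.sub h2
  have e : ∀ (ν : Measure (Sph n)) [IsFiniteMeasure ν],
      ∫ v, (g + ContinuousMap.const (Sph n) R) v ∂ν - ∫ v, (ContinuousMap.const (Sph n) R) v ∂ν =
        ∫ v : Sph n, supp L (v : En n) ∂ν := fun ν _ => by
    rw [← integral_sub (integrable_continuousMap _) (integrable_continuousMap _)]
    refine integral_congr_ae (Eventually.of_forall fun v => ?_)
    change g v + R - R = g v
    ring
  simpa only [e] using h3

/-- A one-sided Lévy–Prokhorov estimate from finitely many test functions. -/
lemma measure_le_of_forall_integral {μ ν : Measure (Sph n)} [IsFiniteMeasure μ] [IsFiniteMeasure ν]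
    {ε δ : ℝ} (hδ : 0 < δ) (hδε : 3 * δ ≤ ε) {t : Finset (Sph n)}
    (ht : ∀ x, ∃ y ∈ t, dist x y < δ) {F : Finset (Sph n) → C(Sph n, ℝ)}
    (hF : ∀ s v, F s v = (thickenedIndicator hδ (thickening δ (s : Set (Sph n))) v : ℝ))
    (h : ∀ s ∈ t.powerset, ∫ v, F s v ∂μ ≤ ∫ v, F s v ∂ν + ε) (A : Set (Sph n)) :
    μ A ≤ ν (thickening ε A) + ENNReal.ofReal ε := by
  classical
  set s := t.filter fun y => ∃ x ∈ A, dist x y < δ with hs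
  set U := thickening δ (s : Set (Sph n)) with hU
  have hAU : A ⊆ U := fun x hx => by
    obtain ⟨y, hy, hxy⟩ := ht x
    exact mem_thickening_iff.2
      ⟨y, by simp only [hs, Finset.coe_filter]; exact ⟨hy, x, hx, hxy⟩, hxy⟩
  have hUA : thickening δ U ⊆ thickening ε A := fun z hz => by
    obtain ⟨u, hu, hzu⟩ := mem_thickening_iff.1 hz
    obtain ⟨y, hy, huy⟩ := mem_thickening_iff.1 hu
    obtain ⟨x, hx, hxy⟩ := (Finset.mem_filter.1 (Finset.mem_coe.1 hy)).2
    refine mem_thickening_iff.2 ⟨x, hx, ?_⟩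
    have h1 := dist_triangle z u y
    have h2 := dist_triangle z y x
    rw [dist_comm y x] at h2
    linarith
  have hF0 : ∀ v, 0 ≤ F s v := fun v => by rw [hF]; positivity
  have h1 : μ.real U ≤ ∫ v, F s v ∂μ := by
    rw [← integral_indicator_one isOpen_thickening.measurableSet]
    refine integral_mono ((integrable_const 1).indicator isOpen_thickening.measurableSet)
      (integrable_continuousMap _) fun v => ?_
    by_cases hv : v ∈ U
    · rw [Set.indicator_of_mem hv, hF, thickenedIndicator_one hδ _ hv]
      simp
    · rw [Set.indicator_of_notMem hv]
      exact hF0 v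
  have h2 : ∫ v, F s v ∂ν ≤ ν.real (thickening ε A) := by
    rw [← integral_indicator_one isOpen_thickening.measurableSet]
    refine integral_mono (integrable_continuousMap _)
      ((integrable_const 1).indicator isOpen_thickening.measurableSet) fun v => ?_
    by_cases hv : v ∈ thickening δ U
    · rw [Set.indicator_of_mem (hUA hv), hF]
      exact_mod_cast thickenedIndicator_le_one hδ _ v
    · rw [hF, thickenedIndicator_zero hδ _ hv]
      exact Set.indicator_nonneg (fun _ _ => zero_le_one) v
  have h3 := h s (Finset.mem_powerset.2 (Finset.filter_subset _ _))
  have h4 : μ.real U ≤ ν.real (thickening ε A) + ε := by linarith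
  refine (measure_mono hAU).trans ?_
  rw [← ofReal_measureReal (μ := μ), ← ofReal_measureReal (μ := ν),
    ← ENNReal.ofReal_add measureReal_nonneg (by linarith)]
  exact ENNReal.ofReal_le_ofReal h4

/-- Weak convergence implies Lévy–Prokhorov convergence. -/
lemma tendsto_dLP_of_tendsto_integral {μm : ℕ → Measure (Sph n)} {μ : Measure (Sph n)}
    [∀ m, IsFiniteMeasure (μm m)] [IsFiniteMeasure μ]
    (h : ∀ f : C(Sph n, ℝ), Tendsto (fun m => ∫ v, f v ∂(μm m)) atTop (𝓝 (∫ v, f v ∂μ))) :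
    Tendsto (fun m => dLP (μm m) μ) atTop (𝓝 0) := by
  rw [Metric.tendsto_nhds]
  intro ε hε
  have hδ : 0 < ε / 6 := by positivity
  obtain ⟨t, -, hfin, hcov⟩ := finite_cover_balls_of_compact (isCompact_univ (X := Sph n)) hδ
  lift t to Finset (Sph n) using hfin
  let F : Finset (Sph n) → C(Sph n, ℝ) := fun s =>
    ⟨fun v => (thickenedIndicator hδ (thickening (ε / 6) (s : Set (Sph n))) v : ℝ), by fun_prop⟩
  have hev : ∀ᶠ m in atTop, ∀ s ∈ t.powerset,
      |∫ v, F s v ∂(μm m) - ∫ v, F s v ∂μ| < ε / 2 := by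
    rw [Finset.eventually_all]
    exact fun s _ => (Metric.tendsto_nhds.1 (h (F s))) (ε / 2) (by positivity)
  have ht : ∀ x, ∃ y ∈ t, dist x y < ε / 6 := fun x => by
    simpa using hcov (Set.mem_univ x)
  filter_upwards [hev] with m hm
  have hb : LPBound (μm m) μ (ε / 2) := ⟨by positivity, fun A _ =>
    ⟨measure_le_of_forall_integral hδ (by linarith) ht (F := F) (fun _ _ => rfl)
      (fun s hs => by have := (abs_lt.1 (hm s hs)).2; linarith) A,
    measure_le_of_forall_integral hδ (by linarith) ht (F := F) (fun _ _ => rfl)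
      (fun s hs => by have := (abs_lt.1 (hm s hs)).1; linarith) A⟩⟩
  rw [Real.dist_eq, sub_zero, abs_of_nonneg (dLP_nonneg _ _)]
  linarith [hb.dLP_le]

/-- The Blaschke selection theorem. -/
lemma exists_subseq_tendsto_body {Km : ℕ → ConvexBody (En n)} {R : ℝ}
    (hR : ∀ m, ∀ x ∈ Km m, ‖x‖ ≤ R) :
    ∃ (L : ConvexBody (En n)) (φ : ℕ → ℕ), StrictMono φ ∧ Tendsto (Km ∘ φ) atTop (𝓝 L) := by
  let T : ℕ → TopologicalSpace.NonemptyCompacts (En n) := fun m =>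
    ⟨⟨Km m, (Km m).isCompact⟩, (Km m).nonempty⟩
  have hT : ∀ m, (T m : Set (En n)) = Km m := fun _ => rfl
  obtain ⟨S, -, φ, hφ, hS⟩ := (TopologicalSpace.NonemptyCompacts.isCompact_subsets_of_isCompact
    (isCompact_closedBall (0 : En n) R)).tendsto_subseq (x := T)
    (fun m x hx => mem_closedBall_zero_iff.2 (hR m x ((hT m).le hx)))
  have hinf : ∀ x, Tendsto (fun m => infDist x (Km (φ m) : Set (En n))) atTop
      (𝓝 (infDist x (S : Set (En n)))) := fun x => by
    have := ((lipschitz_infDist_set x).continuous.tendsto S).comp hS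
    exact this.congr fun m => by rw [Function.comp_apply, Function.comp_apply, hT]
  have hmem : ∀ x, x ∈ (S : Set (En n)) ↔ infDist x (S : Set (En n)) = 0 := fun x =>
    S.isCompact.isClosed.mem_iff_infDist_zero S.nonempty
  have hconv : Convex ℝ (S : Set (En n)) := by
    intro x hx y hy a b ha hb hab
    rw [hmem] at hx hy ⊢
    have hx' := hinf x
    have hy' := hinf y
    rw [hx] at hx'
    rw [hy] at hy'
    have hlim := (hx'.const_mul a).add (hy'.const_mul b)
    rw [mul_zero, mul_zero, add_zero] at hlim
    refine tendsto_nhds_unique (hinf _) (squeeze_zero (fun _ => infDist_nonneg) (fun m => ?_) hlim)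
    obtain ⟨u, hu, hxu⟩ := (Km (φ m)).isCompact.exists_infDist_eq_dist (Km (φ m)).nonempty x
    obtain ⟨w, hw, hyw⟩ := (Km (φ m)).isCompact.exists_infDist_eq_dist (Km (φ m)).nonempty y
    rw [hxu, hyw]
    refine (infDist_le_dist_of_mem ((Km (φ m)).convex hu hw ha hb hab)).trans ?_
    have e : a • x + b • y - (a • u + b • w) = a • (x - u) + b • (y - w) := by module
    rw [dist_eq_norm, dist_eq_norm, dist_eq_norm, e]
    refine (norm_add_le _ _).trans (le_of_eq ?_)
    rw [norm_smul, norm_smul, Real.norm_of_nonneg ha, Real.norm_of_nonneg hb]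
  let L : ConvexBody (En n) := ⟨(S : Set (En n)), hconv, S.isCompact, S.nonempty⟩
  refine ⟨L, φ, hφ, ?_⟩
  rw [tendsto_iff_dist_tendsto_zero] at hS ⊢
  refine hS.congr fun m => ?_
  rw [Metric.NonemptyCompacts.dist_eq, Function.comp_apply, Function.comp_apply,
    ← ConvexBody.hausdorffDist_coe]
  rfl

lemma zero_mem_of_centroid {K : ConvexBody (En n)} (hK : (interior (K : Set (En n))).Nonempty)
    (hc : ∫ x in (K : Set (En n)), x = 0) : (0 : En n) ∈ K := by
  have h := Convex.set_average_mem (μ := volume) (f := fun x : En n => x) K.convex K.isClosed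
    (Measure.measure_pos_of_nonempty_interior _ hK).ne' (volume_ne_top K)
    (ae_restrict_mem (measurableSet_body K))
    (continuousOn_id.integrableOn_compact K.isCompact)
  rwa [setAverage_eq, hc, smul_zero] at h

lemma eq_zero_of_centroid {K : ConvexBody (En n)} (hK : (interior (K : Set (En n))).Nonempty)
    (hc : ∫ x in (K : Set (En n)), x = 0) {x : En n}
    (hx : ∫ y in ((point x + K : ConvexBody (En n)) : Set (En n)), y = 0) : x = 0 := by
  have e : ((point x + K : ConvexBody (En n)) : Set (En n)) = (fun y => x + y) '' K := by
    rw [ConvexBody.coe_add]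
    exact Set.singleton_add
  rw [e, (measurePreserving_add_left volume x).setIntegral_image_emb
    (measurableEmbedding_addLeft x), integral_add, hc, add_zero, setIntegral_const] at hx
  · exact (smul_eq_zero.1 hx).resolve_left (vol_pos hK).ne'
  · exact integrableOn_const (volume_ne_top K)
  · exact continuousOn_id.integrableOn_compact K.isCompact

/-- The `n - 1` bodies entering the area measure of order `j + 1` of `K`. -/
def areaBodies (j q : ℕ) (K : ConvexBody (En n)) : Multiset (ConvexBody (En n)) :=
  Multiset.replicate (j + 1) K + Multiset.replicate q (ballB n)

lemma card_areaBodies {j q : ℕ} (h : j + q + 2 = n) (K : ConvexBody (En n)) :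
    (areaBodies j q K).card + 1 = n := by
  simp only [areaBodies, Multiset.card_add, Multiset.card_replicate]
  omega

lemma tendsto_mv_areaBodies (j q : ℕ) {Km : ℕ → ConvexBody (En n)} {K : ConvexBody (En n)}
    (hK : Tendsto Km atTop (𝓝 K)) (L : ConvexBody (En n)) :
    Tendsto (fun m => mv (L ::ₘ areaBodies j q (Km m))) atTop
      (𝓝 (mv (L ::ₘ areaBodies j q K))) := by
  have := tendsto_mv_slot_pow (j + 1) (L ::ₘ Multiset.replicate q (ballB n)) hK
  simpa only [areaBodies, Multiset.add_cons] using this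

lemma tendsto_dLP_of_tendsto_body {j q : ℕ} (h : j + q + 2 = n) {Km : ℕ → ConvexBody (En n)}
    {K : ConvexBody (En n)} {μm : ℕ → Measure (Sph n)} {μ : Measure (Sph n)}
    [∀ m, IsFiniteMeasure (μm m)] [IsFiniteMeasure μ]
    (hμm : ∀ m, IsAreaMeasure (j + 1) (Km m) (μm m)) (hμ : IsAreaMeasure (j + 1) K μ)
    (hK : Tendsto Km atTop (𝓝 K)) : Tendsto (fun m => dLP (μm m) μ) atTop (𝓝 0) := by
  refine tendsto_dLP_of_tendsto_integral (tendsto_integral_of_tendsto_supp fun L => ?_)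
  simp only [fun m => integral_supp h (hμm m), integral_supp h hμ]
  exact (tendsto_mv_areaBodies j q hK L).const_mul _

lemma mv_seg_le {s : Multiset (ConvexBody (En n))} (hs : s.card + 1 = n) (v w : En n) :
    mv (seg v ::ₘ s) ≤ mv (seg w ::ₘ s) + ‖v - w‖ * mv (ballB n ::ₘ s) := by
  rw [← mv_smul_cons hs (norm_nonneg _), ← mv_add_cons hs]
  refine mv_mono_cons hs (le_of_supp_le fun x => ?_)
  rw [supp_add, supp_smul (norm_nonneg _), supp_ballB, supp_seg, supp_seg]
  have h1 := real_inner_le_norm x (v - w)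
  rw [inner_sub_right, mul_comm] at h1
  have h2 := le_max_left 0 ⟪x, w⟫_ℝ
  have h3 := le_max_right 0 ⟪x, w⟫_ℝ
  have h4 : 0 ≤ ‖v - w‖ * ‖x‖ := by positivity
  exact max_le (by linarith) (by linarith)

lemma continuous_mv_seg {s : Multiset (ConvexBody (En n))} (hs : s.card + 1 = n) :
    Continuous fun v : En n => mv (seg v ::ₘ s) := by
  have h0 : 0 ≤ mv (ballB n ::ₘ s) := mv_nonneg (by simpa using hs)
  refine (LipschitzWith.of_dist_le_mul (K := ⟨_, h0⟩) fun v w => ?_).continuous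
  have h1 := mv_seg_le hs v w
  have h2 := mv_seg_le hs w v
  rw [norm_sub_rev] at h2
  rw [Real.dist_eq, dist_eq_norm, abs_le]
  change -(mv (ballB n ::ₘ s) * ‖v - w‖) ≤ _ ∧ _ ≤ mv (ballB n ::ₘ s) * ‖v - w‖
  constructor <;> linarith

lemma mv_seg_areaBodies_pos {j q : ℕ} (h : j + q + 2 = n) {K : ConvexBody (En n)}
    (hK : (interior (K : Set (En n))).Nonempty) {v : En n} (hv : v ≠ 0) :
    0 < mv (seg v ::ₘ areaBodies j q K) := by
  have := mv_pos (ws := [v]) (s := areaBodies j q K) ⟨by simpa [wspan] using hv, trivial⟩ ?_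
    (by simpa using card_areaBodies h K)
  · rwa [segs_cons, segs_nil, Multiset.add_cons, add_zero] at this
  · intro M hM
    rcases Multiset.mem_add.1 hM with hM | hM
    · rwa [Multiset.eq_of_mem_replicate hM]
    · rw [Multiset.eq_of_mem_replicate hM]
      exact interior_ballB_nonempty

/-- Convergence of mixed volumes forces a uniform lower bound in all directions. -/
lemma exists_eventually_le_mv_seg {j q : ℕ} (h : j + q + 2 = n) {Km : ℕ → ConvexBody (En n)}
    {K : ConvexBody (En n)} (hK : (interior (K : Set (En n))).Nonempty)
    (hlim : ∀ L, Tendsto (fun m => mv (L ::ₘ areaBodies j q (Km m))) atTop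
      (𝓝 (mv (L ::ₘ areaBodies j q K)))) :
    ∃ c, 0 < c ∧ ∀ᶠ m in atTop, ∀ v : En n, ‖v‖ = 1 → c ≤ mv (seg v ::ₘ areaBodies j q (Km m)) := by
  have hn : 0 < n := by omega
  have hne : (sphere (0 : En n) 1).Nonempty :=
    ⟨EuclideanSpace.single ⟨0, hn⟩ 1, by simp⟩
  obtain ⟨v₀, hv₀, hmin⟩ := (isCompact_sphere (0 : En n) 1).exists_isMinOn hne
    (continuous_mv_seg (card_areaBodies h K)).continuousOn
  have hpos : 0 < mv (seg v₀ ::ₘ areaBodies j q K) :=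
    mv_seg_areaBodies_pos h hK (ne_zero_of_mem_unit_sphere ⟨v₀, hv₀⟩)
  set c₀ := mv (seg v₀ ::ₘ areaBodies j q K) with hc₀
  set B := mv (ballB n ::ₘ areaBodies j q K) + 1 with hB
  have hB0 : 0 < B := by
    have : 0 ≤ mv (ballB n ::ₘ areaBodies j q K) :=
      mv_nonneg (by simpa using card_areaBodies h K)
    linarith
  have hδ : 0 < c₀ / (4 * B) := by positivity
  obtain ⟨t, hts, hfin, hcov⟩ := finite_cover_balls_of_compact (isCompact_sphere (0 : En n) 1) hδ
  refine ⟨c₀ / 4, by positivity, ?_⟩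
  have h1 : ∀ᶠ m in atTop, ∀ y ∈ t, c₀ / 2 < mv (seg y ::ₘ areaBodies j q (Km m)) := by
    rw [hfin.eventually_all]
    intro y hy
    have : c₀ ≤ mv (seg y ::ₘ areaBodies j q K) := hmin (hts hy)
    exact (hlim _).eventually (lt_mem_nhds (by linarith))
  have h2 : ∀ᶠ m in atTop, mv (ballB n ::ₘ areaBodies j q (Km m)) < B :=
    (hlim _).eventually (gt_mem_nhds (by linarith))
  filter_upwards [h1, h2] with m hm1 hm2 v hv
  obtain ⟨y, hy, hvy⟩ := Set.mem_iUnion₂.1 (hcov (mem_sphere_zero_iff_norm.2 hv))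
  have h3 := mv_seg_le (card_areaBodies h (Km m)) y v
  have h4 : ‖y - v‖ * mv (ballB n ::ₘ areaBodies j q (Km m)) ≤ c₀ / (4 * B) * B := by
    refine mul_le_mul ?_ hm2.le (mv_nonneg (by simpa using card_areaBodies h (Km m))) hδ.le
    rw [← dist_eq_norm, dist_comm]
    exact hvy.le
  have h5 : c₀ / (4 * B) * B = c₀ / 4 := by field_simp
  have := hm1 y hy
  linarith

lemma mv_self_cons_areaBodies (j q : ℕ) (K : ConvexBody (En n)) :
    mv (K ::ₘ areaBodies j q K) =
      mv (Multiset.replicate (j + 2) K + Multiset.replicate q (ballB n)) := by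
  rw [areaBodies, ← Multiset.cons_add, ← Multiset.replicate_succ]

/-- Convergence of mixed volumes bounds the bodies uniformly. -/
lemma exists_bound_of_tendsto_mv (hn : 2 ≤ n) {j q : ℕ} (h : j + q + 2 = n)
    {Km : ℕ → ConvexBody (En n)} {K : ConvexBody (En n)}
    (h0 : ∀ m, (0 : En n) ∈ Km m) (hK : (interior (K : Set (En n))).Nonempty)
    (hlim : ∀ L, Tendsto (fun m => mv (L ::ₘ areaBodies j q (Km m))) atTop
      (𝓝 (mv (L ::ₘ areaBodies j q K)))) :
    ∃ R, ∀ m, ∀ x ∈ Km m, ‖x‖ ≤ R := by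
  obtain ⟨c, hc, hev⟩ := exists_eventually_le_mv_seg h hK hlim
  set B := mv (ballB n ::ₘ areaBodies j q K) + 1 with hB
  have h2 : ∀ᶠ m in atTop, mv (ballB n ::ₘ areaBodies j q (Km m)) < B :=
    (hlim _).eventually (gt_mem_nhds (by linarith))
  obtain ⟨N, hN⟩ := eventually_atTop.1 (hev.and h2)
  have hw : 0 < mv (Multiset.replicate (j + 2) (ballB n) + Multiset.replicate q (ballB n)) :=
    mv_replicate_pos (by omega) interior_ballB_nonempty
  set w := mv (Multiset.replicate (j + 2) (ballB n) + Multiset.replicate q (ballB n))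
  choose r hr0 hr using fun m => exists_norm_le (Km m)
  refine ⟨max (∑ m ∈ Finset.range N, r m) (max 1 (B ^ (j + 2) / w) / c), fun m x hx => ?_⟩
  rcases lt_or_ge m N with hm | hm
  · exact ((hr m x hx).trans (Finset.single_le_sum (f := r) (fun k _ => (hr0 k).le)
      (Finset.mem_range.2 hm))).trans (le_max_left _ _)
  · refine le_max_of_le_right ?_
    rw [le_div_iff₀ hc]
    obtain ⟨hseg, hball⟩ := hN m hm
    have hcard := card_areaBodies h (Km m)
    have hxc : ‖x‖ * c ≤ mv (Km m ::ₘ areaBodies j q (Km m)) := by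
      rcases eq_or_ne x 0 with rfl | hx0
      · rw [norm_zero, zero_mul]
        exact mv_nonneg (by simpa using hcard)
      · have hxn : ‖x‖ ≠ 0 := norm_ne_zero_iff.2 hx0
        have h1 := hseg (‖x‖⁻¹ • x) (by rw [norm_smul, norm_inv, norm_norm, inv_mul_cancel₀ hxn])
        calc ‖x‖ * c ≤ ‖x‖ * mv (seg (‖x‖⁻¹ • x) ::ₘ areaBodies j q (Km m)) := by gcongr
          _ = mv (seg x ::ₘ areaBodies j q (Km m)) := by
            rw [← mv_smul_cons hcard (norm_nonneg _), ← seg_smul (norm_nonneg _),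
              smul_inv_smul₀ hxn]
          _ ≤ _ := mv_mono_cons hcard (seg_le (h0 m) hx)
    have hmink := mv_minkowski hn h (Km m) (ballB n)
    rw [← mv_self_cons_areaBodies j q (Km m)] at hmink
    change _ * w ≤ mv (ballB n ::ₘ areaBodies j q (Km m)) ^ (j + 2) at hmink
    have hball0 : 0 ≤ mv (ballB n ::ₘ areaBodies j q (Km m)) := mv_nonneg (by simpa using hcard)
    have hpow : (‖x‖ * c) ^ (j + 1) ≤ B ^ (j + 2) / w := by
      rw [le_div_iff₀ hw]
      calc (‖x‖ * c) ^ (j + 1) * w ≤ mv (Km m ::ₘ areaBodies j q (Km m)) ^ (j + 1) * w := by gcongr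
        _ ≤ _ := hmink
        _ ≤ _ := by gcongr
    rcases le_total (‖x‖ * c) 1 with h1 | h1
    · exact h1.trans (le_max_left _ _)
    · exact ((le_self_pow₀ h1 (Nat.succ_ne_zero j)).trans hpow).trans (le_max_right _ _)

/-- A body with the same mixed volumes as a full-dimensional body is one of its translates. -/
lemma exists_eq_point_add_of_mv_areaBodies_eq (hn : 2 ≤ n) {j q : ℕ} (h : j + q + 2 = n)
    {K L : ConvexBody (En n)} (hK : (interior (K : Set (En n))).Nonempty)
    (he : ∀ M, mv (M ::ₘ areaBodies j q L) = mv (M ::ₘ areaBodies j q K)) :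
    ∃ x, L = point x + K := by
  refine eq_point_add_of_forall_mv_eq hn h hK ?_ he
  rw [← mv_self_cons_areaBodies, he]
  obtain ⟨x, hx⟩ := L.nonempty
  by_cases hL : ∃ y ∈ L, y ≠ x
  · obtain ⟨y, hy, hyx⟩ := hL
    have hcard := card_areaBodies h K
    have hle : point x + seg (y - x) ≤ L := le_of_supp_le fun z => by
      rw [supp_add, supp_point, supp_seg, inner_sub_right]
      have h1 := inner_le_supp hx z
      have h2 := inner_le_supp hy z
      rcases max_choice 0 (⟪z, y⟫_ℝ - ⟪z, x⟫_ℝ) with e | e <;> rw [e] <;> linarith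
    refine lt_of_lt_of_le ?_ (mv_mono_cons hcard hle)
    rw [mv_add_cons hcard, mv_point_cons, zero_add]
    exact mv_seg_areaBodies_pos h hK (sub_ne_zero.2 hyx)
  · push Not at hL
    have hLx : L = point x := by
      refine ConvexBody.ext (Set.eq_singleton_iff_unique_mem.2 ⟨hx, hL⟩)
    have h1 := he (ballB n)
    have h2 := mv_ballB_cons_pos h hK
    rw [areaBodies, hLx, Multiset.replicate_succ, Multiset.cons_add, Multiset.cons_swap,
      mv_point_cons] at h1
    exact absurd h1 h2.ne

/-- **Proposition 3.1.** For convex bodies with centroid at the origin, weak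
(Lévy–Prokhorov) convergence of the area measures of order `i` is equivalent to
Hausdorff convergence of the bodies. -/
theorem levyProkhorov_iff_hausdorff
    (n i : ℕ) (hn : 2 ≤ n) (hi₁ : 1 ≤ i) (hi₂ : i ≤ n - 1)
    (Km : ℕ → ConvexBody (En n)) (K : ConvexBody (En n))
    (hKmint : ∀ m, (interior (Km m : Set (En n))).Nonempty)
    (hKint : (interior (K : Set (En n))).Nonempty)
    (hKmcent : ∀ m, (∫ x in (Km m : Set (En n)), x) = 0)
    (hKcent : (∫ x in (K : Set (En n)), x) = 0)
    (μm : ℕ → Measure (Sph n)) (μ : Measure (Sph n))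
    (hμm : ∀ m, IsAreaMeasure i (Km m) (μm m))
    (hμ : IsAreaMeasure i K μ) :
    Tendsto (fun m => dLP (μm m) μ) atTop (𝓝 0) ↔
      Tendsto (fun m => hausdorffDist ((Km m : Set (En n))) ((K : Set (En n))))
        atTop (𝓝 0) := by
  obtain ⟨j, rfl⟩ : ∃ j, i = j + 1 := ⟨i - 1, by omega⟩
  obtain ⟨q, h⟩ : ∃ q, j + q + 2 = n := ⟨n - (j + 2), by omega⟩
  have hfm : ∀ m, IsFiniteMeasure (μm m) := fun m =>
    isFiniteMeasure_of_pos (measureReal_univ_pos h (hKmint m) (hμm m))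
  have hf : IsFiniteMeasure μ := isFiniteMeasure_of_pos (measureReal_univ_pos h hKint hμ)
  simp only [ConvexBody.hausdorffDist_coe]
  rw [← tendsto_iff_dist_tendsto_zero]
  refine ⟨fun hd => ?_, tendsto_dLP_of_tendsto_body h hμm hμ⟩
  have hn0 : (n : ℝ) ≠ 0 := by exact_mod_cast (by omega : n ≠ 0)
  have hlim : ∀ L, Tendsto (fun m => mv (L ::ₘ areaBodies j q (Km m))) atTop
      (𝓝 (mv (L ::ₘ areaBodies j q K))) := fun L => by
    have := (tendsto_integral_supp_of_tendsto_dLP hd L).const_mul (n : ℝ)⁻¹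
    simpa only [areaBodies, fun m => integral_supp h (hμm m), integral_supp h hμ,
      inv_mul_cancel_left₀ hn0] using this
  obtain ⟨R, hR⟩ := exists_bound_of_tendsto_mv hn h
    (fun m => zero_mem_of_centroid (hKmint m) (hKmcent m)) hKint hlim
  refine tendsto_of_subseq_tendsto fun ns hns => ?_
  obtain ⟨L, φ, hφ, hL⟩ := exists_subseq_tendsto_body (Km := Km ∘ ns) fun m => hR (ns m)
  have hsub : Tendsto (ns ∘ φ) atTop atTop := hns.comp hφ.tendsto_atTop
  obtain ⟨x, rfl⟩ := exists_eq_point_add_of_mv_areaBodies_eq hn h hKint fun M =>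
    tendsto_nhds_unique (tendsto_mv_areaBodies j q hL M) ((hlim M).comp hsub)
  have hcent := ((continuous_setIntegral_body (E := En n) continuous_id).tendsto _).comp hL
  have hx : x = 0 := eq_zero_of_centroid hKint hKcent
    (tendsto_nhds_unique hcent (tendsto_const_nhds.congr fun m => (hKmcent (ns (φ m))).symm))
  have e : point x + K = K := eq_of_supp_eq fun y => by
    rw [supp_add, supp_point, hx, inner_zero_right, zero_add]
  rw [e] at hL
  exact ⟨φ, hL⟩

end MinkIter
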